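/- There exists a strong (O₃ × ℤ₂)-equivariant deformation retraction from Hom(S²) to O₃; that is, a jointly continuous map ρ : Hom(S²) × [0,1] → Hom(S²) such that ρ(f,0) = f for all f ∈ Hom(S²), ρ(f,1) is the restriction to S² of an orthogonal matrix for all f, ρ(Q,t) = Q for every Q ∈ O₃ and t ∈ [0,1], and ρ(Q ∘ f ∘ σ_s, t) = Q ∘ ρ(f,t) ∘ σ_s for every Q ∈ O₃, s ∈ {1,-1}, f ∈ Hom(S²), and t ∈ [0,1]. -/

import Mathlib

open Metric unitInterval

noncomputable section

/-- The Euclidean 3-space. -/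
abbrev E3 : Type := EuclideanSpace ℝ (Fin 3)

/-- The unit 2-sphere in `ℝ³`. -/
abbrev Sph : Type := Metric.sphere (0 : E3) 1

/-- The group of self-homeomorphisms of the sphere, as a subspace of `C(S², S²)`
(whose compact-open topology coincides with the sup-metric topology). -/
abbrev HomS2 : Type := {f : C(Sph, Sph) // IsHomeomorph f}

/-- `g` is the restriction to the sphere of the (orthogonal) matrix `Q`. -/
def AgreesWith (g : HomS2) (Q : Matrix (Fin 3) (Fin 3) ℝ) : Prop :=
  ∀ x : Sph, ((g.1 x : E3)) = Q.mulVec (x : E3)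


namespace HS
open Set Filter Topology MeasureTheory
open scoped Real ENNReal
variable {φ : ℂ ≃ₜ ℂ} {r ℓ s : ℝ} {K h : ℂ → ℂ}

lemma area {U : Set ℂ} (hU : IsOpen U) {Ψ : ℂ → ℂ} (hΨ : DifferentiableOn ℂ Ψ U)
    (hi : InjOn Ψ U) (ρ : ℂ → ℝ≥0∞) :
    ∫⁻ w in Ψ '' U, ρ w = ∫⁻ z in U, ‖deriv Ψ z‖ₑ ^ 2 * ρ (Ψ z) := by
  rw [lintegral_image_eq_lintegral_abs_det_fderiv_mul volume hU.measurableSet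
    (f' := fun z => (ContinuousLinearMap.toSpanSingleton ℂ (deriv Ψ z)).restrictScalars ℝ) ?_ hi]
  · refine lintegral_congr fun z => ?_
    congr 1
    have : ((ContinuousLinearMap.toSpanSingleton ℂ (deriv Ψ z)).restrictScalars ℝ).det
        = ‖deriv Ψ z‖ ^ 2 := by
      have h1 := LinearMap.det_restrictScalars (R := ℝ)
        (f := ((ContinuousLinearMap.toSpanSingleton ℂ (deriv Ψ z)) : ℂ →ₗ[ℂ] ℂ))
      rw [ContinuousLinearMap.det]
      refine Eq.trans h1 ?_
      rw [LinearMap.det_ring]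
      simp [Algebra.norm_complex_apply, Complex.normSq_eq_norm_sq]
    rw [this, abs_of_nonneg (by positivity), ENNReal.ofReal_pow (by positivity), ofReal_norm]
  · intro z hz
    have := (hΨ.differentiableAt (hU.mem_nhds hz)).hasDerivAt.hasFDerivAt
    exact (this.restrictScalars ℝ).hasFDerivWithinAt

lemma LA {a b c d : ℝ} {Ψ : ℂ → ℂ}
    (hΨ : DifferentiableOn ℂ Ψ (Ioo a b ×ℂ Ioo c d)) (hi : InjOn Ψ (Ioo a b ×ℂ Ioo c d))
    {ρ : ℂ → ℝ≥0∞} (hρ : Measurable ρ) {V : Set ℂ} (hV : Ψ '' (Ioo a b ×ℂ Ioo c d) ⊆ V)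
    {L : ℝ≥0∞} (hL : ∀ x ∈ Ioo a b,
      L ≤ ∫⁻ y in Ioo c d, ‖deriv Ψ (⟨x, y⟩ : ℂ)‖ₑ * ρ (Ψ ⟨x, y⟩)) :
    L ^ 2 * ENNReal.ofReal (b - a) ≤ ENNReal.ofReal (d - c) * ∫⁻ w in V, ρ w ^ 2 := by
  set U := Ioo a b ×ℂ Ioo c d with hUd
  have hU : IsOpen U := isOpen_Ioo.reProdIm isOpen_Ioo
  have hUp : U = Complex.measurableEquivRealProd ⁻¹' (Ioo a b ×ˢ Ioo c d) := by
    ext z; simp [U, Complex.mem_reProdIm]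
  set k : ℂ → ℝ≥0∞ := U.indicator fun z => ‖deriv Ψ z‖ₑ * ρ (Ψ z) with hk
  have hkm : Measurable k := by
    have e : k = fun z => ‖deriv Ψ z‖ₑ * (U.indicator (fun z => ρ (Ψ z)) z) := by
      ext z; by_cases hz : z ∈ U <;> simp [k, hz]
    rw [e]
    refine ((measurable_deriv Ψ).enorm).mul ?_
    classical
    have : (U.indicator (fun z => ρ (Ψ z))) =
        U.indicator (fun z => ρ (U.piecewise Ψ (fun _ => 0) z)) := by
      ext z; by_cases hz : z ∈ U <;> simp [hz]
    rw [this]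
    refine Measurable.indicator (hρ.comp ?_) hU.measurableSet
    exact ContinuousOn.measurable_piecewise hΨ.continuousOn continuousOn_const hU.measurableSet
  have hkv : ∀ x ∈ Ioo a b, ∀ y ∈ Ioo c d, k ⟨x, y⟩ = ‖deriv Ψ (⟨x, y⟩ : ℂ)‖ₑ * ρ (Ψ ⟨x, y⟩) := by
    intro x hx y hy
    have : (⟨x, y⟩ : ℂ) ∈ U := by simp only [U, Complex.mem_reProdIm]; exact ⟨hx, hy⟩
    simp [k, this]
  have h1 : ∫⁻ z in U, k z ^ 2 ≤ ∫⁻ w in V, ρ w ^ 2 := by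
    refine le_trans ?_ (lintegral_mono_set hV)
    rw [area hU hΨ hi]
    refine setLIntegral_mono_ae' hU.measurableSet (Eventually.of_forall fun z hz => ?_)
    simp [k, hz, mul_pow]
  have h2 : ∫⁻ z in U, k z ^ 2 = ∫⁻ x in Ioo a b, ∫⁻ y in Ioo c d, k ⟨x, y⟩ ^ 2 := by
    rw [hUp, ← (Complex.volume_preserving_equiv_real_prod.symm).setLIntegral_comp_preimage_emb
      Complex.measurableEquivRealProd.symm.measurableEmbedding]
    rw [show (Complex.measurableEquivRealProd.symm ⁻¹' (Complex.measurableEquivRealProd ⁻¹'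
      (Ioo a b ×ˢ Ioo c d))) = Ioo a b ×ˢ Ioo c d by ext; simp]
    rw [Measure.volume_eq_prod, ← Measure.prod_restrict, lintegral_prod]
    · rfl
    · exact ((hkm.comp Complex.measurableEquivRealProd.symm.measurable).pow_const 2).aemeasurable
  have h3 : ∀ x ∈ Ioo a b, L ^ 2 ≤ ENNReal.ofReal (d - c) * ∫⁻ y in Ioo c d, k ⟨x, y⟩ ^ 2 := by
    intro x hx
    have hm : Measurable fun y : ℝ => k ⟨x, y⟩ := hkm.comp
      (Complex.measurableEquivRealProd.symm.measurable.comp measurable_prodMk_left)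
    have h := ENNReal.lintegral_mul_le_Lp_mul_Lq (volume.restrict (Ioo c d))
      (Real.HolderConjugate.two_two) (f := fun _ => 1) (g := fun y => k ⟨x, y⟩)
      aemeasurable_const hm.aemeasurable
    have hl : L ≤ ∫⁻ y in Ioo c d, k ⟨x, y⟩ := by
      refine (hL x hx).trans (le_of_eq ?_)
      exact setLIntegral_congr_fun measurableSet_Ioo fun y hy => (hkv x hx y hy).symm
    have h4 : L ≤ _ := hl.trans (by simpa using h)
    calc L ^ 2 ≤ _ := pow_le_pow_left' h4 2
      _ = _ := by
        rw [mul_pow]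
        congr 1
        · rw [← ENNReal.rpow_two, ← ENNReal.rpow_mul]; norm_num
        · rw [← ENNReal.rpow_two, ← ENNReal.rpow_mul]; norm_num
  calc L ^ 2 * ENNReal.ofReal (b - a) = ∫⁻ x in Ioo a b, L ^ 2 := by simp
    _ ≤ ∫⁻ x in Ioo a b, ENNReal.ofReal (d - c) * ∫⁻ y in Ioo c d, k ⟨x, y⟩ ^ 2 :=
      setLIntegral_mono_ae' measurableSet_Ioo (Eventually.of_forall h3)
    _ = ENNReal.ofReal (d - c) * ∫⁻ z in U, k z ^ 2 := by
      rw [lintegral_const_mul' _ _ ENNReal.ofReal_ne_top, h2]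
    _ ≤ _ := by gcongr

lemma len {E : Type*} [NormedAddCommGroup E] [NormedSpace ℝ E] {u : ℂ → E} (hu : ContDiff ℝ 1 u)
    {ρ : ℂ → ℝ≥0∞} (hρ : ∀ w, ‖fderiv ℝ u w‖ₑ ≤ ρ w) {U : Set ℂ} (hU : IsOpen U) {G : ℂ → ℂ}
    (hG : DifferentiableOn ℂ G U) {x c d : ℝ} (hx : ∀ y ∈ Ioo c d, (⟨x, y⟩ : ℂ) ∈ U)
    {y1 y2 : ℝ} (h1 : y1 ∈ Ioo c d) (h2 : y2 ∈ Ioo c d) :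
    ‖u (G ⟨x, y1⟩) - u (G ⟨x, y2⟩)‖ₑ ≤ ∫⁻ y in Ioo c d, ‖deriv G (⟨x, y⟩ : ℂ)‖ₑ * ρ (G ⟨x, y⟩) := by
  wlog h : y2 ≤ y1 generalizing y1 y2
  · rw [← edist_eq_enorm_sub, edist_comm, edist_eq_enorm_sub]
    exact this h2 h1 (le_of_not_ge h)
  have hsub : Icc y2 y1 ⊆ Ioo c d := fun y hy => ⟨h2.1.trans_le hy.1, hy.2.trans_lt h1.2⟩
  have hv : ∀ y : ℝ, HasDerivAt (fun y : ℝ => (⟨x, y⟩ : ℂ)) Complex.I y := by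
    intro y
    have : (fun y : ℝ => (⟨x, y⟩ : ℂ)) = fun y : ℝ => (x : ℂ) + y * Complex.I := by
      ext y; simp [Complex.ext_iff]
    rw [this]
    simpa using ((Complex.ofRealCLM.hasDerivAt (x := y)).mul_const Complex.I).const_add (x : ℂ)
  have hvc : ContDiff ℝ 1 (fun y : ℝ => (⟨x, y⟩ : ℂ)) := by
    have : (fun y : ℝ => (⟨x, y⟩ : ℂ)) = fun y : ℝ => (x : ℂ) + y * Complex.I := by
      ext y; simp [Complex.ext_iff]
    rw [this]
    exact contDiff_const.add ((Complex.ofRealCLM.contDiff).mul contDiff_const)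
  have hGc : ContDiffOn ℝ 1 G U := ((hG.contDiffOn hU (n := 1)).restrict_scalars ℝ)
  have hc : ContDiffOn ℝ 1 (fun y : ℝ => u (G ⟨x, y⟩)) (Icc y2 y1) :=
    hu.comp_contDiffOn (hGc.comp hvc.contDiffOn fun y hy => hx y (hsub hy))
  refine (enorm_sub_le_lintegral_deriv_of_contDiffOn_Icc hc h).trans ?_
  refine le_trans ?_ (lintegral_mono_set hsub)
  refine setLIntegral_mono_ae' measurableSet_Icc (Eventually.of_forall fun y hy => ?_)
  have hd := (hG.differentiableAt (hU.mem_nhds (hx y (hsub hy)))).hasDerivAt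
  have hd2 := hd.scomp y (hv y)
  have hd3 := ((hu.differentiable one_ne_zero).differentiableAt (x := G ⟨x, y⟩)).hasFDerivAt.comp_hasDerivAt y hd2
  have : deriv (fun y : ℝ => u (G ⟨x, y⟩)) y = _ := hd3.deriv
  rw [this]
  refine (ContinuousLinearMap.le_opENorm _ _).trans ?_
  rw [enorm_smul, mul_comm]
  have : ‖Complex.I‖ₑ = 1 := by rw [← ofReal_norm]; simp
  rw [this, one_mul]
  gcongr
  exact hρ _

lemma bcl {f : ℂ → ℂ} {z w : ℂ} {d R : ℝ} (hd : 0 < d) (hR : 0 < R)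
    (hf : DifferentiableOn ℂ f (ball z d)) (hb : ∀ w ∈ ball z d, |(f w).re| ≤ R)
    (hw : ‖w - z‖ ≤ d / 2) : ‖f w - f z‖ ≤ 8 * R / d * ‖w - z‖ := by
  have hm : MapsTo (fun ζ => z + ζ) (ball 0 d) (ball z d) := by
    intro ζ hζ; simpa [mem_ball, dist_eq_norm] using hζ
  have hz : z ∈ ball z d := by simpa
  have h := Complex.borelCaratheodory_zero (M := 2 * R) (R := d) (z := w - z)
    (f := fun ζ => f (z + ζ) - f z) (by positivity)
    ((hf.comp (by fun_prop) hm).sub_const _) (fun ζ hζ => by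
      have := abs_le.1 (hb _ (hm hζ)); have h2 := abs_le.1 (hb _ hz)
      simp only [Set.mem_ofPred_eq, Complex.sub_re]; linarith [this.2, h2.1]) hd
      (by rw [mem_ball_zero_iff]; linarith) (by simp)
  simp only [add_sub_cancel] at h
  refine h.trans ?_
  rw [div_mul_eq_mul_div, div_le_div_iff₀ (by linarith) hd]
  have : 0 ≤ R * ‖w - z‖ := by positivity
  nlinarith

abbrev St (a b : ℝ) : Set ℂ := Complex.re ⁻¹' Ioo a b
lemma St_open (a b : ℝ) : IsOpen (St a b) := isOpen_Ioo.preimage Complex.continuous_re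
lemma exp_inj_norm {w : ℂ} {R : ℝ} (h : |w.re| ≤ R) :
    Real.exp (-R) ≤ ‖Complex.exp w‖ ∧ ‖Complex.exp w‖ ≤ Real.exp R := by
  rw [Complex.norm_exp]; have := abs_le.1 h
  exact ⟨Real.exp_le_exp.2 this.1, Real.exp_le_exp.2 this.2⟩

lemma arc {Ψ : ℂ → ℂ} (hΨ : DifferentiableOn ℂ Ψ (St 0 1)) {R y0 s1 s2 L : ℝ} (hs1 : 0 < s1)
    (hs2 : s2 ≤ 1) (hL : 0 < L) (h12 : s1 < s2)
    (hb : ∀ z ∈ St 0 1, |(Ψ z).re| ≤ R)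
    (hi : ∀ a ∈ St 0 1, ∀ b ∈ St 0 1, ‖a - y0 * Complex.I‖ < s2 → ‖b - y0 * Complex.I‖ < s2 →
      Complex.exp (Ψ a) = Complex.exp (Ψ b) → a = b)
    (hlog : π * π * Real.exp R ^ 2 < L ^ 2 * (Real.log s2 - Real.log s1)) :
    ∃ s ∈ Ioo s1 s2, ∀ a ∈ St 0 1, ∀ b ∈ St 0 1, ‖a - y0 * Complex.I‖ = s →
      ‖b - y0 * Complex.I‖ = s → ‖Ψ a - Ψ b‖ ≤ Real.exp R * L := by
  by_contra! hcon
  set z0 : ℂ := y0 * Complex.I with hz0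
  have hz0r : z0.re = 0 := by simp [hz0]
  set c : ℝ := -(π / 2)
  set d : ℝ := π / 2
  set U := Ioo (Real.log s1) (Real.log s2) ×ℂ Ioo c d with hU
  have hs2' : 0 < s2 := hs1.trans h12
  have hUo : IsOpen U := isOpen_Ioo.reProdIm isOpen_Ioo
  have hmem : ∀ ζ ∈ U, z0 + Complex.exp ζ ∈ St 0 1 ∧ ‖z0 + Complex.exp ζ - z0‖ < s2 := by
    intro ζ hζ
    rw [hU, Complex.mem_reProdIm] at hζ
    have h1 : Real.exp ζ.re < s2 := by
      rw [← Real.exp_log hs2']; exact Real.exp_lt_exp.2 hζ.1.2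
    refine ⟨?_, by simpa [Complex.norm_exp] using h1⟩
    simp only [mem_preimage, Complex.add_re, hz0r, zero_add, Complex.exp_re]
    have h2 : 0 < Real.cos ζ.im := Real.cos_pos_of_mem_Ioo ⟨hζ.2.1, hζ.2.2⟩
    have h3 := Real.cos_le_one ζ.im
    have h4 := Real.exp_pos ζ.re
    constructor
    · positivity
    · nlinarith
  set G : ℂ → ℂ := fun ζ => Ψ (z0 + Complex.exp ζ) with hGd
  have hG : DifferentiableOn ℂ G U :=
    hΨ.comp (((Complex.differentiable_exp).const_add z0).differentiableOn) fun ζ hζ => (hmem ζ hζ).1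
  have hF : DifferentiableOn ℂ (fun ζ => Complex.exp (G ζ)) U := hG.cexp
  have hFi : InjOn (fun ζ => Complex.exp (G ζ)) U := by
    intro a ha b hb' hab
    have h1 := hi _ (hmem a ha).1 _ (hmem b hb').1 (hmem a ha).2 (hmem b hb').2 hab
    have h2 := add_left_cancel h1
    rw [hU, Complex.mem_reProdIm] at ha hb'
    have hp := Real.pi_pos
    have hc : c = -(π / 2) := rfl
    have hd : d = π / 2 := rfl
    exact Complex.exp_inj_of_neg_pi_lt_of_le_pi (by linarith [ha.2.1]) (by linarith [ha.2.2])
      (by linarith [hb'.2.1]) (by linarith [hb'.2.2]) h2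
  have key := LA (V := closedBall 0 (Real.exp R)) (ρ := fun _ => 1) hF hFi measurable_const ?_
    (L := ENNReal.ofReal L) ?_
  · simp only [one_pow, setLIntegral_one, Complex.volume_closedBall] at key
    rw [← ENNReal.ofReal_pow hL.le, ← ENNReal.ofReal_mul (by positivity)] at key
    have e : ENNReal.ofReal (d - c) * (ENNReal.ofReal (Real.exp R) ^ 2 * (NNReal.pi : ℝ≥0∞)) =
        ENNReal.ofReal (π * π * Real.exp R ^ 2) := by
      have : d - c = π := by simp only [d, c]; ring
      have h2 : (NNReal.pi : ℝ≥0∞) = ENNReal.ofReal π := by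
        rw [← NNReal.coe_real_pi, ENNReal.ofReal_coe_nnreal]
      rw [this, h2, ← ENNReal.ofReal_pow (Real.exp_pos _).le, ← ENNReal.ofReal_mul (by positivity),
        ← ENNReal.ofReal_mul (by positivity)]
      congr 1; ring
    rw [e, ENNReal.ofReal_le_ofReal_iff (by positivity)] at key
    linarith
  · rintro _ ⟨ζ, hζ, rfl⟩
    rw [mem_closedBall_zero_iff]
    exact (exp_inj_norm (hb _ (hmem ζ hζ).1)).2
  · intro x hx
    have hxs : Real.exp x ∈ Ioo s1 s2 := by
      rw [← Real.exp_log hs1, ← Real.exp_log hs2']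
      exact ⟨Real.exp_lt_exp.2 hx.1, Real.exp_lt_exp.2 hx.2⟩
    obtain ⟨a, ha, b, hb', ha', hb'', hab⟩ := hcon _ hxs
    have pol : ∀ a ∈ St 0 1, ‖a - z0‖ = Real.exp x →
        ∃ y ∈ Ioo c d, a = z0 + Complex.exp ⟨x, y⟩ := by
      intro a ha ha'
      refine ⟨Complex.arg (a - z0), ?_, ?_⟩
      · have : 0 < (a - z0).re := by simp [hz0r]; exact ha.1
        have := (Complex.abs_arg_lt_pi_div_two_iff).2 (Or.inl this)
        exact abs_lt.1 this
      · have h0 : a - z0 ≠ 0 := by intro h; rw [h] at ha'; simp at ha'; linarith [Real.exp_pos x]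
        have : (⟨x, Complex.arg (a - z0)⟩ : ℂ) = Complex.log (a - z0) := by
          rw [Complex.ext_iff]; simp [ha', Complex.log_re, Complex.log_im]
        rw [this, Complex.exp_log h0]; ring
    obtain ⟨y1, hy1, rfl⟩ := pol a ha ha'
    obtain ⟨y2, hy2, rfl⟩ := pol b hb' hb''
    have hxU : ∀ y ∈ Ioo c d, (⟨x, y⟩ : ℂ) ∈ U := fun y hy => by
      rw [hU, Complex.mem_reProdIm]; exact ⟨hx, hy⟩
    have hl := len (u := fun z : ℂ => z) contDiff_id (ρ := fun _ => 1) (fun w => by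
      rw [fderiv_fun_id, ← ofReal_norm]
      exact ENNReal.ofReal_le_one.2 ContinuousLinearMap.norm_id_le) hUo hG hxU hy1 hy2
    have h1 : ENNReal.ofReal (Real.exp R) * ENNReal.ofReal L ≤
        ∫⁻ y in Ioo c d, ‖deriv G (⟨x, y⟩ : ℂ)‖ₑ * 1 := by
      refine le_trans ?_ hl
      rw [← ENNReal.ofReal_mul (Real.exp_pos _).le, ← ofReal_norm]
      exact ENNReal.ofReal_le_ofReal hab.le
    have h2 : ENNReal.ofReal L = ENNReal.ofReal (Real.exp (-R)) * (ENNReal.ofReal (Real.exp R) * ENNReal.ofReal L) := by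
      rw [← ENNReal.ofReal_mul (Real.exp_pos _).le, ← ENNReal.ofReal_mul (Real.exp_pos _).le,
        ← mul_assoc, ← Real.exp_add]; simp
    rw [h2]
    refine (mul_le_mul_right h1 _).trans ?_
    rw [← lintegral_const_mul' _ _ ENNReal.ofReal_ne_top]
    refine setLIntegral_mono_ae' measurableSet_Ioo (Eventually.of_forall fun y hy => ?_)
    have hd := (hG.differentiableAt (hUo.mem_nhds (hxU y hy))).hasDerivAt.cexp
    rw [hd.deriv, enorm_mul, mul_one, mul_one]
    gcongr
    rw [← ofReal_norm]
    exact ENNReal.ofReal_le_ofReal (exp_inj_norm (hb _ (hmem _ (hxU y hy)).1)).1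

lemma per_int {D : Set ℂ} {f : ℂ → ℂ} {p q : ℂ} (hD : ∀ z, z + p ∈ D ↔ z ∈ D)
    (h : ∀ z ∈ D, f (z + p) = f z + q) (n : ℤ) : ∀ z ∈ D, z + n * p ∈ D ∧ f (z + n * p) = f z + n * q := by
  induction n using Int.induction_on with
  | zero => intro z hz; simpa
  | succ n ih =>
    intro z hz
    obtain ⟨h1, h2⟩ := ih z hz
    have e : z + ((n + 1 : ℤ) : ℂ) * p = (z + (n : ℤ) * p) + p := by push_cast; ring
    rw [e]
    refine ⟨(hD _).2 h1, ?_⟩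
    rw [h _ h1, h2]; push_cast; ring
  | pred n ih =>
    intro z hz
    obtain ⟨h1, h2⟩ := ih z hz
    have e : z + ((-n - 1 : ℤ) : ℂ) * p = (z + ((-n : ℤ) : ℂ) * p) - p := by push_cast; ring
    have h3 : z + ((-n - 1 : ℤ) : ℂ) * p ∈ D := by rw [e, ← hD]; simpa using h1
    refine ⟨h3, ?_⟩
    have h4 := h _ h3
    rw [e, sub_add_cancel, h2] at h4
    rw [e]; push_cast at h4 ⊢; linear_combination -h4

abbrev A : Set ℂ := St 0 1
abbrev TP : ℂ := 2 * π * Complex.I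
def vi (y : ℝ) : ℂ := y * Complex.I
@[simp] lemma vi_re (y : ℝ) : (vi y).re = 0 := by simp [vi]
@[simp] lemma vi_im (y : ℝ) : (vi y).im = y := by simp [vi]
lemma TP_eq : TP = vi (2 * π) := by simp [vi]
@[simp] lemma TP_re : TP.re = 0 := by simp [TP_eq]
@[simp] lemma TP_im : TP.im = 2 * π := by simp [TP_eq]
lemma vi_add (x y : ℝ) : vi (x + y) = vi x + vi y := by simp [vi]; ring
lemma vi_int (n : ℤ) (y : ℝ) : (n : ℂ) * vi y = vi (n * y) := by simp [vi]; ring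
lemma norm_vi (y : ℝ) : ‖vi y‖ = |y| := by simp [vi]

structure OU (φ : ℂ ≃ₜ ℂ) (r ℓ s : ℝ) (K h : ℂ → ℂ) : Prop where
  r0 : 0 < r
  l0 : 0 < ℓ
  s1 : s = 1 ∨ s = -1
  mK : MapsTo K A (St (-r) r)
  mh : MapsTo h (St (-r) r) A
  Kh : ∀ w ∈ St (-r) r, K (h w) = w
  hK : ∀ z ∈ A, h (K z) = z
  cK : ContinuousOn K A
  ch : ContinuousOn h (St (-r) r)
  per : ∀ z ∈ A, K (z + vi ℓ) = K z + vi (s * (2 * π))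
  hol : DifferentiableOn ℂ (fun z => φ (K z)) A
  fp : ∀ z, φ (z + TP) = φ z + TP


lemma OU.perZ (H : OU φ r ℓ s K h) (n : ℤ) {z : ℂ} (hz : z ∈ A) :
    z + vi (n * ℓ) ∈ A ∧ K (z + vi (n * ℓ)) = K z + vi (n * (s * (2 * π))) := by
  have := per_int (D := A) (p := vi ℓ) (fun z => by simp) H.per n z hz
  simpa only [vi_int] using this

lemma OU.fpZ (H : OU φ r ℓ s K h) (n : ℤ) (z : ℂ) : φ (z + vi (n * (2 * π))) = φ z + vi (n * (2 * π)) := by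
  have := (per_int (D := univ) (f := φ) (p := TP) (fun z => by simp) (fun z _ => H.fp z) n z (mem_univ _)).2
  simpa only [vi_int, TP_eq] using this

lemma OU.s2 (H : OU φ r ℓ s K h) : s * s = 1 := by rcases H.s1 with h | h <;> rw [h] <;> norm_num

lemma OU.inj (H : OU φ r ℓ s K h) : InjOn K A := fun a ha b hb hab => by
  rw [← H.hK a ha, ← H.hK b hb, hab]

lemma OU.expinj (H : OU φ r ℓ s K h) {a b : ℂ} (ha : a ∈ A) (hb : b ∈ A) (hab : ‖a - b‖ < ℓ)
    (he : Complex.exp (φ (K a)) = Complex.exp (φ (K b))) : a = b := by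
  obtain ⟨n, hn⟩ := Complex.exp_eq_exp_iff_exists_int.1 he
  obtain ⟨m, hm⟩ : ∃ m : ℤ, (m : ℝ) = s := by
    rcases H.s1 with h | h
    · exact ⟨1, by simp [h]⟩
    · exact ⟨-1, by simp [h]⟩
  have h1 := H.perZ (n * m) hb
  have h2 : φ (K a) = φ (K (b + vi ((n * m : ℤ) * ℓ))) := by
    rw [hn, h1.2]
    have : ((n * m : ℤ) : ℝ) * (s * (2 * π)) = n * (2 * π) := by
      push_cast; rw [hm]; linear_combination (n * (2 * π)) * H.s2
    rw [this, H.fpZ n]; simp [vi]; ring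
  have h3 := H.inj ha h1.1 (φ.injective h2)
  rw [h3, add_sub_cancel_left, norm_vi, abs_mul, abs_of_pos H.l0] at hab
  have h4 : |((n * m : ℤ) : ℝ)| < 1 := by
    by_contra! h; nlinarith [H.l0]
  have h5 : n * m = 0 := by
    rw [← Int.abs_lt_one_iff]; exact_mod_cast h4
  rw [h3, h5]; simp [vi]

lemma OU.meet (H : OU φ r ℓ s K h) {z0 a b : ℂ} {t : ℝ} {W : Set ℂ} (hW : IsPreconnected W)
    (hWs : W ⊆ St (-r) r) (ha : a ∈ A) (hb : b ∈ A) (haW : K a ∈ W) (hbW : K b ∈ W)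
    (h1 : ‖a - z0‖ < t) (h2 : t ≤ ‖b - z0‖) : ∃ c ∈ A, ‖c - z0‖ = t ∧ K c ∈ W := by
  have hc : ContinuousOn (fun w => ‖h w - z0‖) W := ((H.ch.mono hWs).sub continuousOn_const).norm
  have := (hW.image _ hc).ordConnected.out ⟨K a, haW, rfl⟩ ⟨K b, hbW, rfl⟩
  simp only [H.hK a ha, H.hK b hb] at this
  obtain ⟨w, hw, hwt⟩ := this ⟨h1.le, h2⟩
  exact ⟨h w, H.mh (hWs hw), hwt, by rwa [H.Kh w (hWs hw)]⟩

lemma St_convex (a b : ℝ) : Convex ℝ (St a b) :=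
  (convex_halfSpace_re_gt a).inter (convex_halfSpace_re_lt b)

lemma OU.cross (H : OU φ r ℓ s K h) {z0 p : ℂ} {t ε : ℝ}
    (hC : ∀ a ∈ A, ‖a - z0‖ = t → |(K a - p).re| ≤ ε ∧ |(K a - p).im| ≤ ε)
    {a : ℂ} (ha : a ∈ A) (hat : ‖a - z0‖ < t) : |(K a - p).re| ≤ ε ∧ |(K a - p).im| ≤ ε := by
  obtain ⟨N, hN⟩ := exists_nat_ge ((t + |(a - z0).im|) / ℓ)
  rw [div_le_iff₀ H.l0] at hN
  have far : ∀ n : ℤ, |n| = N → t ≤ ‖a + vi (n * ℓ) - z0‖ := by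
    intro n hn
    refine le_trans ?_ (Complex.abs_im_le_norm _)
    have e : (a + vi (n * ℓ) - z0).im = (a - z0).im + n * ℓ := by simp; ring
    have : |(n : ℝ) * ℓ| = N * ℓ := by
      rw [abs_mul, abs_of_pos H.l0, ← Int.cast_abs, hn]; simp
    rw [e]
    have := abs_sub_abs_le_abs_sub ((n : ℝ) * ℓ) (-(a - z0).im)
    rw [abs_neg, sub_neg_eq_add, add_comm _ (a - z0).im] at this
    linarith
  have key : ∀ (W : Set ℂ) (n : ℤ), Convex ℝ W → W ⊆ {w | ¬ (|(w - p).re| ≤ ε ∧ |(w - p).im| ≤ ε)} →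
      K a ∈ W → |n| = N → K a + vi (n * (s * (2 * π))) ∈ W → False := by
    intro W n hW hWs haW hn hnW
    obtain ⟨h1, h2⟩ := H.perZ n ha
    rw [← h2] at hnW
    obtain ⟨c, hcA, hct, hcW⟩ := H.meet (W := W ∩ St (-r) r) (hW.inter (St_convex _ _)).isPreconnected
      inter_subset_right ha h1 ⟨haW, H.mK ha⟩ ⟨hnW, H.mK h1⟩ hat (far n hn)
    exact hWs hcW.1 (hC c hcA hct)
  have im2 : ∀ n : ℤ, (K a + vi (n * (s * (2 * π)))).im = (K a).im + n * s * (2 * π) := by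
    intro n; simp; ring
  have hpi := Real.pi_pos
  have hN0 : (0 : ℝ) ≤ N := Nat.cast_nonneg N
  obtain ⟨n1, hn1, hs1⟩ : ∃ n : ℤ, |n| = N ∧ (n : ℝ) * s = N := by
    rcases H.s1 with h | h
    · exact ⟨N, by simp, by simp [h]⟩
    · exact ⟨-N, by simp, by simp [h]⟩
  by_contra hcon
  rw [not_and_or, not_le, not_le, lt_abs, lt_abs] at hcon
  simp only [Complex.sub_re, Complex.sub_im] at hcon
  have ab : ∀ x : ℝ, ε < x ∨ ε < -x → ¬ |x| ≤ ε := fun x hx h => by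
    have := abs_le.1 h; rcases hx with h' | h' <;> linarith [this.1, this.2]
  rcases hcon with (hc | hc) | (hc | hc)
  · refine key {w | p.re + ε < w.re} n1 (convex_halfSpace_re_gt _) ?_ (by simp; linarith) hn1 (by simp; linarith)
    rintro w hw ⟨h1, h2⟩
    simp only [Set.mem_ofPred_eq] at hw
    exact ab _ (Or.inl (by simp; linarith)) h1
  · refine key {w | w.re < p.re - ε} n1 (convex_halfSpace_re_lt _) ?_ (by simp; linarith) hn1 (by simp; linarith)
    rintro w hw ⟨h1, h2⟩
    simp only [Set.mem_ofPred_eq] at hw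
    exact ab _ (Or.inr (by simp; linarith)) h1
  · refine key {w | p.im + ε < w.im} n1 (convex_halfSpace_im_gt _) ?_ (by simp; linarith) hn1 ?_
    · rintro w hw ⟨h1, h2⟩
      simp only [Set.mem_ofPred_eq] at hw
      exact ab _ (Or.inl (by simp; linarith)) h2
    · simp only [Set.mem_ofPred_eq, im2, hs1]; nlinarith
  · refine key {w | w.im < p.im - ε} (-n1) (convex_halfSpace_im_lt _) ?_ (by simp; linarith) (by simpa using hn1) ?_
    · rintro w hw ⟨h1, h2⟩
      simp only [Set.mem_ofPred_eq] at hw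
      exact ab _ (Or.inr (by simp; linarith)) h2
    · have : ((-n1 : ℤ) : ℝ) * s = -N := by push_cast; linarith
      simp only [Set.mem_ofPred_eq, im2, this]; nlinarith

lemma OU.wall (H : OU φ r ℓ s K h) {R s1 s2 L ε : ℝ} (hR : ∀ w ∈ St (-r) r, |(φ w).re| ≤ R)
    (hs1 : 0 < s1) (h12 : s1 < s2) (hs2 : s2 ≤ 1) (hs2' : 2 * s2 ≤ ℓ) (hL : 0 < L)
    (hlog : π * π * Real.exp R ^ 2 < L ^ 2 * (Real.log s2 - Real.log s1))
    (hm : ∀ p ∈ St (-r) r, ∀ q ∈ St (-r) r, ‖φ p - φ q‖ ≤ Real.exp R * L → ‖p - q‖ ≤ ε) (y0 : ℝ)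
    {z z' : ℂ} (hz : z ∈ A) (hz' : z' ∈ A) (h1 : ‖z - vi y0‖ < s1) (h2 : ‖z' - vi y0‖ < s1) :
    ‖K z - K z'‖ ≤ 4 * ε := by
  obtain ⟨t, ht, hta⟩ := arc (y0 := y0) H.hol hs1 hs2 hL h12 (fun z hz => hR _ (H.mK hz))
    (fun a ha b hb ha' hb' he => H.expinj ha hb (by
      have := norm_sub_le (a - vi y0) (b - vi y0)
      rw [sub_sub_sub_cancel_right] at this
      have e1 : ‖a - vi y0‖ < s2 := ha'
      have e2 : ‖b - vi y0‖ < s2 := hb'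
      linarith) he) hlog
  have ht0 : 0 < t := hs1.trans ht.1
  set c : ℂ := vi y0 + t
  have hcA : c ∈ A := by simp [c]; exact ⟨ht0, ht.2.trans_le hs2⟩
  have hct : ‖c - vi y0‖ = t := by simp [c, abs_of_pos ht0]
  have hC : ∀ a ∈ A, ‖a - vi y0‖ = t → |(K a - K c).re| ≤ ε ∧ |(K a - K c).im| ≤ ε := by
    intro a ha hat
    have := hm _ (H.mK ha) _ (H.mK hcA) (hta a ha c hcA hat hct)
    exact ⟨(Complex.abs_re_le_norm _).trans this, (Complex.abs_im_le_norm _).trans this⟩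
  have g1 := H.cross hC hz (h1.trans ht.1)
  have g2 := H.cross hC hz' (h2.trans ht.1)
  refine (Complex.norm_le_abs_re_add_abs_im _).trans ?_
  have e : K z - K z' = (K z - K c) - (K z' - K c) := by ring
  rw [e, Complex.sub_re (K z - K c), Complex.sub_im (K z - K c)]
  have t1 := abs_sub (K z - K c).re (K z' - K c).re
  have t2 := abs_sub (K z - K c).im (K z' - K c).im
  linarith [g1.1, g1.2, g2.1, g2.2]

lemma OU.flip (H : OU φ r ℓ s K h) : OU φ r ℓ (-s) (fun z => K (1 - z)) (fun w => 1 - h w) := by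
  have m : ∀ z ∈ A, 1 - z ∈ A := fun z hz => by
    simp only [mem_preimage, mem_Ioo, Complex.sub_re, Complex.one_re] at hz ⊢
    constructor <;> linarith [hz.1, hz.2]
  refine ⟨H.r0, H.l0, ?_, fun z hz => H.mK (m z hz), fun w hw => m _ (H.mh hw), fun w hw => ?_,
    fun z hz => ?_, H.cK.comp (by fun_prop) m, continuousOn_const.sub H.ch, fun z hz => ?_,
    H.hol.comp (by fun_prop) m, H.fp⟩
  · rcases H.s1 with h | h <;> simp [h]
  · simp [H.Kh w hw]
  · simp [H.hK _ (m z hz)]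
  · have hm : 1 - (z + vi ℓ) ∈ A := m _ (by simpa using hz)
    have := H.per _ hm
    have e : 1 - (z + vi ℓ) + vi ℓ = 1 - z := by ring
    rw [e] at this
    simp only [this]; simp [vi]

theorem EQ {R ℓ0 ε η : ℝ} (hR : 0 < R) (hl : 0 < ℓ0) (hη : 0 < η) : ∃ δ > 0,
    ∀ (φ : ℂ ≃ₜ ℂ) (r ℓ s : ℝ) (K h : ℂ → ℂ), OU φ r ℓ s K h → ℓ0 ≤ ℓ →
    (∀ w ∈ St (-r) r, |(φ w).re| ≤ R) →
    (∀ p ∈ St (-r) r, ∀ q ∈ St (-r) r, ‖φ p - φ q‖ ≤ η → ‖p - q‖ ≤ ε) →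
    ∀ z ∈ A, ∀ z' ∈ A, ‖z - z'‖ < δ → ‖K z - K z'‖ ≤ 4 * ε := by
  obtain ⟨s2, hs20, hs21, hs22⟩ : ∃ s2 : ℝ, 0 < s2 ∧ s2 ≤ 1 ∧ 2 * s2 ≤ ℓ0 :=
    ⟨min 1 (ℓ0 / 2), by positivity, min_le_left _ _, by linarith [min_le_right 1 (ℓ0 / 2)]⟩
  obtain ⟨L, hL, hLe⟩ : ∃ L : ℝ, 0 < L ∧ Real.exp R * L = η :=
    ⟨η / Real.exp R, by positivity, by field_simp⟩
  obtain ⟨s1, hs1, hs12, hlog⟩ : ∃ s1 : ℝ, 0 < s1 ∧ s1 < s2 ∧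
      π * π * Real.exp R ^ 2 < L ^ 2 * (Real.log s2 - Real.log s1) := by
    refine ⟨s2 * Real.exp (-((π * π * Real.exp R ^ 2 + 1) / L ^ 2)), by positivity, ?_, ?_⟩
    · conv_rhs => rw [← mul_one s2]
      gcongr
      rw [Real.exp_lt_one_iff]
      have : 0 < (π * π * Real.exp R ^ 2 + 1) / L ^ 2 := by positivity
      linarith
    · rw [Real.log_mul hs20.ne' (Real.exp_pos _).ne', Real.log_exp]
      have : L ^ 2 * (Real.log s2 - (Real.log s2 + -((π * π * Real.exp R ^ 2 + 1) / L ^ 2))) =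
        π * π * Real.exp R ^ 2 + 1 := by field_simp; ring
      rw [this]; linarith
  refine ⟨min (s1 / 4) (η * s1 / (16 * R)), by positivity, ?_⟩
  intro φ r ℓ s K h H hℓ hRw hm z hz z' hz' hd
  have hd1 := hd.trans_le (min_le_left _ _)
  have hd2 := hd.trans_le (min_le_right _ _)
  have tri : ∀ a : ℂ, ‖z' - a‖ ≤ ‖z - z'‖ + ‖z - a‖ := fun a => by
    have := norm_sub_le (z - a) (z - z')
    rw [sub_sub_sub_cancel_left] at this; linarith
  rw [← hLe] at hm
  by_cases c1 : z.re < s1 / 2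
  · have : ‖z - vi z.im‖ < s1 / 2 := by
      have : z - vi z.im = (z.re : ℂ) := by simp [Complex.ext_iff]
      rw [this, Complex.norm_real, Real.norm_eq_abs, abs_of_pos hz.1]; exact c1
    exact H.wall hRw hs1 hs12 hs21 (hs22.trans hℓ) hL hlog hm z.im hz hz'
      (by linarith) (by linarith [tri (vi z.im)])
  by_cases c2 : 1 - z.re < s1 / 2
  · have e1 : ‖(1 - z) - vi (-z.im)‖ < s1 / 2 := by
      have : (1 - z) - vi (-z.im) = ((1 - z.re : ℝ) : ℂ) := by simp [Complex.ext_iff]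
      rw [this, Complex.norm_real, Real.norm_eq_abs, abs_of_pos (by linarith [hz.2])]; exact c2
    have e2 : ‖(1 - z') - vi (-z.im)‖ < s1 := by
      have := norm_add_le (z - z') ((1 - z) - vi (-z.im))
      rw [show z - z' + ((1 - z) - vi (-z.im)) = (1 - z') - vi (-z.im) by ring] at this
      linarith
    have m : ∀ z ∈ A, 1 - z ∈ A := fun z hz => by
      simp only [mem_preimage, mem_Ioo, Complex.sub_re, Complex.one_re] at hz ⊢
      constructor <;> linarith [hz.1, hz.2]
    have := H.flip.wall hRw hs1 hs12 hs21 (hs22.trans hℓ) hL hlog hm (-z.im) (m z hz) (m z' hz')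
      (by linarith) e2
    simpa using this
  · push Not at c1 c2
    have hb : ball z (s1 / 2) ⊆ A := by
      intro w hw
      rw [mem_ball, dist_eq_norm] at hw
      have := abs_lt.1 ((Complex.abs_re_le_norm _).trans_lt hw)
      simp only [Complex.sub_re] at this
      constructor <;> linarith [this.1, this.2]
    have := bcl (w := z') (by positivity) hR (H.hol.mono hb) (fun w hw => hRw _ (H.mK (hb hw))) (by
      rw [norm_sub_rev]; linarith)
    have h1 := hm _ (H.mK hz') _ (H.mK hz) (this.trans (by
      rw [norm_sub_rev z' z, hLe]
      have : 8 * R / (s1 / 2) * (η * s1 / (16 * R)) = η := by field_simp; norm_num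
      rw [← this]; gcongr))
    rw [norm_sub_rev]
    have := norm_nonneg (K z' - K z)
    linarith

lemma OU.llow (H : OU φ r ℓ s K h) {R : ℝ} (hR0 : 0 < R) (hR : ∀ w ∈ St (-r) r, |(φ w).re| ≤ R) :
    min (1 / 4) (π / (8 * R)) ≤ ℓ := by
  by_contra! hlt
  have hb : ball (1 / 2 : ℂ) (1 / 2) ⊆ A := by
    intro w hw
    rw [mem_ball, dist_eq_norm] at hw
    have := abs_lt.1 ((Complex.abs_re_le_norm _).trans_lt hw)
    simp at this
    constructor <;> linarith [this.1, this.2]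
  have hm : (1 / 2 : ℂ) ∈ A := hb (by simp)
  have e : ‖(1 / 2 : ℂ) + vi ℓ - 1 / 2‖ = ℓ := by simp [norm_vi, abs_of_pos H.l0]
  have h1 := bcl (w := (1 / 2 : ℂ) + vi ℓ) (by norm_num) hR0 (H.hol.mono hb)
    (fun w hw => hR _ (H.mK (hb hw))) (by
      rw [e]; linarith [hlt.trans_le (min_le_left _ _)])
  have h2 : ‖φ (K (1 / 2 + vi ℓ)) - φ (K (1 / 2))‖ = 2 * π := by
    rw [H.per _ hm]
    rcases H.s1 with h | h
    · have := H.fpZ 1 (K (1 / 2))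
      simp only [Int.cast_one] at this
      rw [h, this, add_sub_cancel_left, norm_vi]; simp [Real.pi_pos.le]
    · have := H.fpZ (-1) (K (1 / 2))
      simp only [Int.cast_neg, Int.cast_one] at this
      rw [h, this, add_sub_cancel_left, norm_vi]; simp [Real.pi_pos.le]
  rw [h2, e] at h1
  have h3 := hlt.trans_le (min_le_right _ _)
  rw [lt_div_iff₀ (by positivity)] at h3
  have : 8 * R / (1 / 2) * ℓ = 2 * (ℓ * (8 * R)) := by ring
  linarith

lemma rho_int {η C : ℝ} (hη : 0 < η) (hC : 0 < C) (w0 : ℂ) :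
    ∫⁻ w in closedBall w0 C, (ENNReal.ofReal (‖w - w0‖ / (‖w - w0‖ ^ 2 + η ^ 2))) ^ 2 ≤
      ENNReal.ofReal (2 * π * (Real.log (C ^ 2 + η ^ 2) / 2 - Real.log (η ^ 2) / 2)) := by
  set f : ℝ → ℝ≥0∞ := fun s => (Iic C).indicator (fun s => (ENNReal.ofReal (s / (s ^ 2 + η ^ 2))) ^ 2) s with hf
  have h1 : ∫⁻ w in closedBall w0 C, (ENNReal.ofReal (‖w - w0‖ / (‖w - w0‖ ^ 2 + η ^ 2))) ^ 2 =
      ∫⁻ w : ℂ, f ‖w‖ := by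
    rw [← lintegral_indicator measurableSet_closedBall, ← lintegral_sub_right_eq_self (fun w => f ‖w‖) w0]
    refine lintegral_congr fun w => ?_
    by_cases hw : ‖w - w0‖ ≤ C
    · rw [indicator_of_mem (by rwa [mem_closedBall, dist_eq_norm]), hf]
      simp [hw]
    · rw [indicator_of_notMem (by rwa [mem_closedBall, dist_eq_norm]), hf]
      simp [hw]
  have hfm : Measurable f := by
    refine Measurable.indicator ?_ measurableSet_Iic
    fun_prop
  have h2 : ∫⁻ w : ℂ, f ‖w‖ = ENNReal.ofReal (2 * π) * ∫⁻ s in Ioi (0 : ℝ), ENNReal.ofReal s * f s := by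
    rw [← Complex.lintegral_comp_polarCoord_symm, polarCoord_target, Measure.volume_eq_prod,
      ← Measure.prod_restrict, lintegral_prod]
    · have : ∀ x ∈ Ioi (0 : ℝ), ∫⁻ y in Ioo (-π) π, ENNReal.ofReal x • f ‖Complex.polarCoord.symm (x, y)‖ =
          ENNReal.ofReal (2 * π) * (ENNReal.ofReal x * f x) := by
        intro x hx
        have e : ∀ y, ‖Complex.polarCoord.symm (x, y)‖ = x := fun y => by
          rw [Complex.norm_polarCoord_symm, abs_of_pos hx]
        simp only [e, lintegral_const, smul_eq_mul]
        rw [mul_comm]; congr 1; rw [Measure.restrict_apply_univ, Real.volume_Ioo]; congr 1; ring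
      rw [← lintegral_const_mul' _ _ ENNReal.ofReal_ne_top]
      exact setLIntegral_congr_fun measurableSet_Ioi this
    · refine Measurable.aemeasurable ?_
      refine (ENNReal.measurable_ofReal.comp measurable_fst).smul (hfm.comp (Measurable.norm ?_))
      have : (Complex.polarCoord.symm : ℝ × ℝ → ℂ) = fun a => (a.1 : ℂ) * (Real.cos a.2 + Real.sin a.2 * Complex.I) := by
        ext a; rw [Complex.polarCoord_symm_apply]
      rw [this]; fun_prop
  have h3 : ∫⁻ s in Ioi (0 : ℝ), ENNReal.ofReal s * f s ≤ ∫⁻ s in Ioc 0 C, ENNReal.ofReal (s / (s ^ 2 + η ^ 2)) := by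
    rw [← Ioi_inter_Iic, inter_comm, ← Measure.restrict_restrict measurableSet_Iic, ← lintegral_indicator measurableSet_Iic]
    refine setLIntegral_mono_ae' measurableSet_Ioi (Eventually.of_forall fun s hs => ?_)
    rw [mem_Ioi] at hs
    by_cases hsC : s ≤ C
    · simp only [hf, indicator_of_mem (show s ∈ Iic C from hsC)]
      rw [← ENNReal.ofReal_pow (by positivity), ← ENNReal.ofReal_mul hs.le]
      refine ENNReal.ofReal_le_ofReal ?_
      rw [div_pow, mul_div_assoc', div_le_div_iff₀ (by positivity) (by positivity)]
      have : 0 ≤ s * (s ^ 2 + η ^ 2) * η ^ 2 := by positivity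
      nlinarith
    · simp [hf, hsC]
  have hd : ∀ s : ℝ, HasDerivAt (fun s => Real.log (s ^ 2 + η ^ 2) / 2) (s / (s ^ 2 + η ^ 2)) s := by
    intro s
    have h0 : s ^ 2 + η ^ 2 ≠ 0 := by positivity
    have := (((hasDerivAt_pow 2 s).add_const (η ^ 2)).log h0).div_const 2
    refine this.congr_deriv ?_
    norm_num; field_simp
  have hcont : Continuous fun s : ℝ => s / (s ^ 2 + η ^ 2) := by
    refine continuous_id.div (by fun_prop) fun s => by positivity
  have h4 : ∫⁻ s in Ioc 0 C, ENNReal.ofReal (s / (s ^ 2 + η ^ 2)) =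
      ENNReal.ofReal (Real.log (C ^ 2 + η ^ 2) / 2 - Real.log (η ^ 2) / 2) := by
    rw [← ofReal_integral_eq_lintegral_ofReal]
    · rw [← intervalIntegral.integral_of_le hC.le, intervalIntegral.integral_eq_sub_of_hasDerivAt (fun s _ => hd s)
        (hcont.intervalIntegrable _ _)]
      simp
    · exact (hcont.integrableOn_Icc (a := 0) (b := C)).mono_set Ioc_subset_Icc_self
    · refine (ae_restrict_mem measurableSet_Ioc).mono fun s hs => ?_
      have := hs.1; simp only [Pi.zero_apply]; positivity
  rw [h1, h2, ENNReal.ofReal_mul (show 0 ≤ 2 * π by positivity), ← h4]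
  gcongr

lemma u_fd {η : ℝ} (hη : 0 < η) (w0 : ℂ) : ContDiff ℝ 1 (fun w : ℂ => Real.log (‖w - w0‖ ^ 2 + η ^ 2) / 2) ∧
    ∀ w, ‖fderiv ℝ (fun w : ℂ => Real.log (‖w - w0‖ ^ 2 + η ^ 2) / 2) w‖ₑ ≤
      ENNReal.ofReal (‖w - w0‖ / (‖w - w0‖ ^ 2 + η ^ 2)) := by
  have hp : ∀ w : ℂ, ‖w - w0‖ ^ 2 + η ^ 2 ≠ 0 := fun w => by positivity
  constructor
  · refine ContDiff.div_const (ContDiff.log ?_ hp) 2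
    exact ((contDiff_id.sub contDiff_const).norm_sq ℝ).add contDiff_const
  · intro w
    have h1 : HasFDerivAt (fun w : ℂ => ‖w - w0‖ ^ 2 + η ^ 2) (2 • (innerSL ℝ (w - w0)).comp (ContinuousLinearMap.id ℝ ℂ)) w :=
      (((hasFDerivAt_id w).sub_const w0).norm_sq).add_const _
    have h2 := ((h1.log (hp w)).mul_const (2⁻¹ : ℝ))
    simp only [← div_eq_mul_inv] at h2
    rw [h2.fderiv, ← ofReal_norm]
    refine ENNReal.ofReal_le_ofReal ?_
    rw [ContinuousLinearMap.comp_id, norm_smul, norm_smul, ← Nat.cast_smul_eq_nsmul ℝ, norm_smul, innerSL_apply_norm]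
    have : 0 < ‖w - w0‖ ^ 2 + η ^ 2 := by positivity
    rw [norm_inv, norm_inv, Real.norm_of_nonneg this.le, Nat.cast_ofNat, Real.norm_ofNat]
    apply le_of_eq; field_simp

lemma inv_core {Ψ : ℂ → ℂ} (hol : DifferentiableOn ℂ Ψ A) (inj : InjOn Ψ A) {c d : ℝ} (hcd : c < d)
    {w0 : ℂ} {m C : ℝ} (hm : 0 < m) (hC0 : 0 < C) (hmid : ∀ y ∈ Ioo c d, m ≤ ‖Ψ ⟨1 / 2, y⟩ - w0‖)
    (hC : ∀ z ∈ A, z.im ∈ Ioo c d → ‖Ψ z - w0‖ ≤ C)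
    (hclose : ∀ η > 0, ∀ y ∈ Ioo c d, ∃ x ∈ Ioo (0 : ℝ) 1, ‖Ψ ⟨x, y⟩ - w0‖ ≤ η) : False := by
  have main : ∀ η : ℝ, 0 < η → 2 * η < m → (Real.log (m / (2 * η))) ^ 2 * (d - c) ≤
      2 * π * (Real.log (C ^ 2 + η ^ 2) / 2 - Real.log (η ^ 2) / 2) := by
    intro η hη hηm
    set U := Ioo (-d) (-c) ×ℂ Ioo (0 : ℝ) 1 with hU
    have hUo : IsOpen U := isOpen_Ioo.reProdIm isOpen_Ioo
    have hmem : ∀ ζ ∈ U, -Complex.I * ζ ∈ A ∧ (-Complex.I * ζ).im ∈ Ioo c d := by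
      intro ζ hζ
      rw [hU, Complex.mem_reProdIm] at hζ
      simp only [mem_preimage, mem_Ioo] at hζ ⊢
      simp
      exact ⟨hζ.2, by linarith [hζ.1.2], by linarith [hζ.1.1]⟩
    have hF : DifferentiableOn ℂ (fun ζ => Ψ (-Complex.I * ζ)) U :=
      hol.comp (by fun_prop) fun ζ hζ => (hmem ζ hζ).1
    have hFi : InjOn (fun ζ => Ψ (-Complex.I * ζ)) U := by
      intro a ha b hb hab
      have := inj (hmem a ha).1 (hmem b hb).1 hab
      simpa using this
    obtain ⟨hu1, hu2⟩ := u_fd hη w0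
    have key := LA (V := closedBall w0 C) hF hFi (ρ := fun w => ENNReal.ofReal (‖w - w0‖ / (‖w - w0‖ ^ 2 + η ^ 2)))
      (by fun_prop) ?_ (L := ENNReal.ofReal (Real.log (m / (2 * η)))) ?_
    · have := key.trans (mul_le_mul_right (rho_int hη hC0 w0) _)
      have hl : 0 ≤ Real.log (m / (2 * η)) := Real.log_nonneg (by
        rw [le_div_iff₀ (by positivity)]; linarith)
      rw [← ENNReal.ofReal_pow hl, ← ENNReal.ofReal_mul (by positivity), ← ENNReal.ofReal_mul (by norm_num),
        ENNReal.ofReal_le_ofReal_iff] at this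
      · linarith
      · have : Real.log (η ^ 2) ≤ Real.log (C ^ 2 + η ^ 2) := Real.log_le_log (by positivity) (by nlinarith)
        have hp := Real.pi_pos
        have : 0 ≤ (Real.log (C ^ 2 + η ^ 2) / 2 - Real.log (η ^ 2) / 2) := by linarith
        positivity
    · rintro _ ⟨ζ, hζ, rfl⟩
      rw [mem_closedBall, dist_eq_norm]
      exact hC _ (hmem ζ hζ).1 (hmem ζ hζ).2
    · intro x hx
      have hx' : -x ∈ Ioo c d := ⟨by linarith [hx.2], by linarith [hx.1]⟩
      obtain ⟨t, ht, htc⟩ := hclose η hη (-x) hx'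
      have hl := len hu1 hu2 hUo hF (x := x) (c := 0) (d := 1) (fun y hy => by
        rw [hU, Complex.mem_reProdIm]; exact ⟨hx, hy⟩) (y1 := 1 / 2) (y2 := t) (by norm_num) ht
      refine le_trans ?_ hl
      have e : ∀ y : ℝ, -Complex.I * (⟨x, y⟩ : ℂ) = ⟨y, -x⟩ := fun y => by simp [Complex.ext_iff]
      rw [← ofReal_norm, e, e, Real.norm_eq_abs]
      refine ENNReal.ofReal_le_ofReal (le_trans ?_ (le_abs_self _))
      have g1 := hmid _ hx'
      have e1 : Real.log (m / (2 * η)) = Real.log (m ^ 2) / 2 - Real.log (4 * η ^ 2) / 2 := by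
        rw [Real.log_div hm.ne' (by positivity), Real.log_pow, show 4 * η ^ 2 = (2 * η) ^ 2 by ring, Real.log_pow]
        push_cast; ring
      rw [e1]
      have e2 : Real.log (m ^ 2) ≤ Real.log (‖Ψ ⟨1 / 2, -x⟩ - w0‖ ^ 2 + η ^ 2) :=
        Real.log_le_log (by positivity) (by nlinarith)
      have e3 : Real.log (‖Ψ ⟨t, -x⟩ - w0‖ ^ 2 + η ^ 2) ≤ Real.log (4 * η ^ 2) :=
        Real.log_le_log (by positivity) (by nlinarith [norm_nonneg (Ψ ⟨t, -x⟩ - w0)])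
      linarith
  have ev : ∀ T : ℝ, 0 < T → (Real.log (m / 2) + T) ^ 2 * (d - c) ≤
      2 * π * (Real.log (C ^ 2 + 1) / 2 + T) ∨ T ≤ Real.log 2 - Real.log m := by
    intro T hT
    by_cases h : T ≤ Real.log 2 - Real.log m
    · exact Or.inr h
    left
    have h1 := main (Real.exp (-T)) (Real.exp_pos _) (by
      rw [← Real.log_lt_log_iff (by positivity) hm, Real.log_mul two_ne_zero (Real.exp_pos _).ne', Real.log_exp]
      linarith)
    have e1 : Real.log (m / (2 * Real.exp (-T))) = Real.log (m / 2) + T := by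
      rw [← div_div, Real.log_div (by positivity) (Real.exp_pos _).ne', Real.log_exp]; ring
    have e2 : Real.log (Real.exp (-T) ^ 2) = -2 * T := by rw [Real.log_pow, Real.log_exp]; push_cast; ring
    rw [e1, e2] at h1
    refine h1.trans ?_
    have : Real.log (C ^ 2 + Real.exp (-T) ^ 2) ≤ Real.log (C ^ 2 + 1) := by
      refine Real.log_le_log (by positivity) ?_
      have : Real.exp (-T) ≤ 1 := by rw [Real.exp_le_one_iff]; linarith
      have := Real.exp_pos (-T)
      nlinarith
    have hp := Real.pi_pos
    nlinarith
  set a := Real.log (m / 2)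
  set b := Real.log (C ^ 2 + 1) / 2 with hb
  have hb0 : 0 ≤ b := by rw [hb]; have := Real.log_nonneg (show 1 ≤ C ^ 2 + 1 by nlinarith); linarith
  set T := |a| + |Real.log 2 - Real.log m| + 1 + |a| + (2 * π / (d - c)) * (1 + b + |a|)  with hT
  have hdc : 0 < d - c := by linarith
  have hq : 0 ≤ (2 * π / (d - c)) * (1 + b + |a|) := by
    have := Real.pi_pos; positivity
  rcases ev T (by positivity) with h | h
  · have ha := neg_abs_le a
    have h1 : (|a| + 1 + (2 * π / (d - c)) * (1 + b + |a|)) ≤ a + T := by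
      rw [hT]; linarith [abs_nonneg (Real.log 2 - Real.log m)]
    set S := a + T
    have hS1 : 1 ≤ S := by linarith [abs_nonneg a]
    have h2 : b + T ≤ (1 + b + |a|) * S - 0 := by
      have : T = S - a := by simp [S]
      have : T ≤ S + |a| := by linarith
      nlinarith [abs_nonneg a]
    have h3 : (2 * π) * (1 + b + |a|) < S * (d - c) := by
      have : (2 * π / (d - c)) * (1 + b + |a|) < S := by linarith [abs_nonneg a]
      rw [div_mul_eq_mul_div, div_lt_iff₀ hdc] at this
      exact this
    have hp := Real.pi_pos
    nlinarith
  · have := le_abs_self (Real.log 2 - Real.log m)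
    have := abs_nonneg a
    linarith

abbrev cSt (a b : ℝ) : Set ℂ := Complex.re ⁻¹' Icc a b
lemma cSt_closed (a b : ℝ) : IsClosed (cSt a b) := isClosed_Icc.preimage Complex.continuous_re
lemma closure_St {a b : ℝ} (h : a < b) : closure (St a b) = cSt a b := by
  rw [St, Complex.closure_preimage_re, closure_Ioo h.ne]
lemma St_sub (a b : ℝ) : St a b ⊆ cSt a b := preimage_mono Ioo_subset_Icc_self

/-- clamp the real part -/
def cl (a b : ℝ) (z : ℂ) : ℂ := ⟨max a (min b z.re), z.im⟩
lemma cl_cont (a b : ℝ) : Continuous (cl a b) := by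
  have : cl a b = fun z => ((max a (min b z.re) : ℝ) : ℂ) + vi z.im := by
    ext z; simp [cl, Complex.ext_iff]
  rw [this]; unfold vi; fun_prop
lemma cl_mem {a b : ℝ} (h : a ≤ b) (z : ℂ) : cl a b z ∈ cSt a b := by
  simp [cl, h]
lemma cl_eq {a b : ℝ} {z : ℂ} (h : z ∈ cSt a b) : cl a b z = z := by
  have := h.1; have := h.2
  simp [cl, Complex.ext_iff]; rw [min_eq_right h.2, max_eq_right h.1]
lemma cl_vi (a b : ℝ) (z : ℂ) (y : ℝ) : cl a b (z + vi y) = cl a b z + vi y := by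
  simp [cl, Complex.ext_iff]

lemma box_compact (a b c d : ℝ) : IsCompact (Icc a b ×ℂ Icc c d) := isCompact_Icc.reProdIm isCompact_Icc

lemma vper {f : ℂ → ℂ} {P Q : ℝ} (hp : ∀ z, f (z + vi P) = f z + vi Q) (n : ℤ) (z : ℂ) :
    f (z + vi (n * P)) = f z + vi (n * Q) := by
  have := (per_int (D := univ) (f := f) (p := vi P) (by simp) (fun z _ => hp z) n z (mem_univ _)).2
  simpa only [vi_int] using this

lemma shift {P : ℝ} (hP : 0 < P) (y : ℝ) : ∃ n : ℤ, y + n * P ∈ Icc 0 P := by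
  refine ⟨-⌊y / P⌋, ?_⟩
  have h1 := Int.floor_le (y / P); have h2 := Int.lt_floor_add_one (y / P)
  rw [le_div_iff₀ hP] at h1; rw [div_lt_iff₀ hP] at h2
  push_cast; constructor <;> linarith

lemma pbdd {g : ℂ → ℝ} (hc : Continuous g) {P : ℝ} (hP : 0 < P) (hp : ∀ z, g (z + vi P) = g z) (a b : ℝ) :
    ∃ C > 0, ∀ z ∈ cSt a b, |g z| ≤ C := by
  obtain ⟨C, hC⟩ := (box_compact a b 0 P).exists_bound_of_continuousOn hc.continuousOn
  refine ⟨|C| + 1, by positivity, fun z hz => ?_⟩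
  obtain ⟨n, hn⟩ := shift hP z.im
  have h1 := vper (f := fun z => (g z : ℂ)) (P := P) (Q := 0) (fun z => by rw [hp]; simp [vi]) n z
  have h2 : g (z + vi (n * P)) = g z := by
    have e : vi ((n : ℝ) * 0) = 0 := by simp [vi]
    rw [e, add_zero] at h1; exact_mod_cast h1
  rw [← h2, ← Real.norm_eq_abs]
  refine (hC _ ?_).trans (by linarith [le_abs_self C])
  rw [Complex.mem_reProdIm]; simpa using ⟨hz, hn⟩

lemma unif {f : ℂ → ℂ} (hc : Continuous f) {P Q : ℝ} (hP : 0 < P) (hp : ∀ z, f (z + vi P) = f z + vi Q)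
    (a b : ℝ) {ε : ℝ} (hε : 0 < ε) : ∃ δ > 0, ∀ p ∈ cSt a b, ∀ q ∈ cSt a b, ‖p - q‖ ≤ δ → ‖f p - f q‖ < ε := by
  have := (box_compact a b (-1) (P + 1)).uniformContinuousOn_of_continuous (hc.continuousOn (s := _))
  obtain ⟨δ, hδ, H⟩ := Metric.uniformContinuousOn_iff.1 this ε hε
  refine ⟨min (δ / 2) 1, by positivity, fun p hp' q hq hpq => ?_⟩
  obtain ⟨n, hn⟩ := shift hP p.im
  have h1 := H (p + vi (n * P)) ?_ (q + vi (n * P)) ?_ ?_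
  · rw [vper hp, vper hp, dist_eq_norm, add_sub_add_right_eq_sub] at h1; exact h1
  · rw [Complex.mem_reProdIm]; simp; exact ⟨hp', by linarith [hn.1], by linarith [hn.2]⟩
  · have := abs_le.1 ((Complex.abs_im_le_norm (p - q)).trans (hpq.trans (min_le_right _ _)))
    simp at this
    rw [Complex.mem_reProdIm]; simp; exact ⟨hq, by linarith [hn.1, this.2], by linarith [hn.2, this.1]⟩
  · rw [dist_eq_norm, add_sub_add_right_eq_sub]
    have := hpq.trans (min_le_left _ _); linarith

structure IsLift (φ : ℂ ≃ₜ ℂ) : Prop where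
  per : ∀ z, φ (z + TP) = φ z + TP
  top : ∀ M : ℝ, ∃ N : ℝ, ∀ z : ℂ, N ≤ z.re → M ≤ (φ z).re
  bot : ∀ M : ℝ, ∃ N : ℝ, ∀ z : ℂ, z.re ≤ N → (φ z).re ≤ M

lemma IsLift.per' (H : IsLift φ) (z : ℂ) : φ (z + vi (2 * π)) = φ z + vi (2 * π) := by
  have := H.per z; rwa [TP_eq] at this
lemma IsLift.sper (H : IsLift φ) (z : ℂ) : φ.symm (z + vi (2 * π)) = φ.symm z + vi (2 * π) := by
  apply φ.injective; rw [H.per']; simp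
lemma IsLift.bdd (H : IsLift φ) (r : ℝ) : ∃ R > 0, ∀ w ∈ cSt (-r) r, |(φ w).re| ≤ R :=
  pbdd (Complex.continuous_re.comp φ.continuous) Real.two_pi_pos (fun z => by simp [H.per']) _ _
lemma IsLift.mod (H : IsLift φ) (r : ℝ) {ε : ℝ} (hε : 0 < ε) : ∃ η > 0, ∀ p ∈ cSt (-r) r, ∀ q ∈ cSt (-r) r,
    ‖φ p - φ q‖ ≤ η → ‖p - q‖ ≤ ε := by
  obtain ⟨R, hR, hb⟩ := H.bdd r
  obtain ⟨η, hη, h⟩ := unif φ.symm.continuous Real.two_pi_pos H.sper (-R) R hε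
  refine ⟨η, hη, fun p hp q hq hpq => ?_⟩
  simpa using (h _ (abs_le.1 (hb p hp)) _ (abs_le.1 (hb q hq)) hpq).le

structure CU (φ : ℂ ≃ₜ ℂ) (r ℓ : ℝ) (K h : ℂ → ℂ) : Prop where
  r0 : 0 < r
  l0 : 0 < ℓ
  cK : Continuous K
  ch : Continuous h
  mK : MapsTo K (cSt 0 1) (cSt (-r) r)
  mh : MapsTo h (cSt (-r) r) (cSt 0 1)
  Kh : ∀ w ∈ cSt (-r) r, K (h w) = w
  hK : ∀ z ∈ cSt 0 1, h (K z) = z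
  per : ∀ z, K (z + vi ℓ) = K z + vi (2 * π)
  w0 : ∀ z : ℂ, z.re = 0 → (K z).re = -r
  w1 : ∀ z : ℂ, z.re = 1 → (K z).re = r
  hol : DifferentiableOn ℂ (fun z => φ (K z)) A ∨
    DifferentiableOn ℂ (fun z => φ (K ((starRingEnd ℂ) z))) A

lemma propseq {K : ℂ → ℂ} (hc : Continuous K) {ℓ P : ℝ} (hl : 0 < ℓ) (hP : P ≠ 0)
    (hp : ∀ z, K (z + vi ℓ) = K z + vi P) {z : ℕ → ℂ} (hz : ∀ n, z n ∈ cSt 0 1) {w : ℂ}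
    (hw : Tendsto (fun n => K (z n)) atTop (𝓝 w)) :
    ∃ z0 ∈ cSt 0 1, ∃ ψ : ℕ → ℕ, StrictMono ψ ∧ Tendsto (fun n => z (ψ n)) atTop (𝓝 z0) ∧ K z0 = w := by
  obtain ⟨C, hC, hCb⟩ := pbdd (g := fun z => (K z).im - P / ℓ * z.im) (by fun_prop) hl (fun z => by
    simp only [hp]; simp; field_simp; ring) 0 1
  obtain ⟨D, hD⟩ := (Metric.isBounded_range_of_tendsto _ hw).exists_norm_le
  have hzb : ∀ n, |(z n).im| ≤ (C + D) / |P / ℓ| := by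
    intro n
    have hq : 0 < |P / ℓ| := abs_pos.2 (div_ne_zero hP hl.ne')
    rw [le_div_iff₀ hq, mul_comm, ← abs_mul]
    have h1 := hCb _ (hz n)
    have h2 := (Complex.abs_im_le_norm _).trans (hD _ ⟨n, rfl⟩)
    rw [abs_le] at *
    constructor <;> linarith [h1.1, h1.2, h2.1, h2.2]
  obtain ⟨z0, hz0, ψ, hψ, hlim⟩ := (box_compact 0 1 (-((C + D) / |P / ℓ|)) ((C + D) / |P / ℓ|)).tendsto_subseq
    (x := z) (fun n => by rw [Complex.mem_reProdIm]; exact ⟨hz n, abs_le.1 (hzb n)⟩)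
  rw [Complex.mem_reProdIm] at hz0
  exact ⟨z0, hz0.1, ψ, hψ, hlim, tendsto_nhds_unique ((hc.tendsto z0).comp hlim) (hw.comp hψ.tendsto_atTop)⟩

lemma clA : closure A = cSt 0 1 := closure_St one_pos

lemma OU.extK (H : OU φ r ℓ s K h) (hφ : IsLift φ) : ∃ L : ℂ → ℂ, Continuous L ∧ (∀ z ∈ A, L z = K z) ∧
    (∀ z, L (z + vi ℓ) = L z + vi (s * (2 * π))) ∧ MapsTo L (cSt 0 1) (cSt (-r) r) ∧
    (∀ z ∈ cSt 0 1, L z ∈ St (-r) r → z ∈ A) ∧ SurjOn L (cSt 0 1) (cSt (-r) r) := by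
  have hrr : -r < r := by linarith [H.r0]
  obtain ⟨R, hR, hRb⟩ := hφ.bdd r
  have uc : ∀ ε > 0, ∃ δ > 0, ∀ z ∈ A, ∀ z' ∈ A, ‖z - z'‖ < δ → ‖K z - K z'‖ < ε := by
    intro ε hε
    obtain ⟨η, hη, hm⟩ := hφ.mod r (show 0 < ε / 5 by positivity)
    obtain ⟨δ, hδ, hE⟩ := EQ (ε := ε / 5) hR H.l0 hη
    exact ⟨δ, hδ, fun z hz z' hz' hd => (hE φ r ℓ s K h H le_rfl (fun w hw => hRb w (St_sub _ _ hw))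
      (fun p hp q hq => hm p (St_sub _ _ hp) q (St_sub _ _ hq)) z hz z' hz' hd).trans_lt (by linarith)⟩
  have hlim : ∀ x ∈ closure A, ∃ y, Tendsto K (𝓝[A] x) (𝓝 y) := by
    intro x hx
    have hne : (𝓝[A] x).NeBot := mem_closure_iff_nhdsWithin_neBot.1 hx
    refine CompleteSpace.complete (f := map K (𝓝[A] x)) (Metric.cauchy_iff.2 ⟨hne.map K, fun ε hε => ?_⟩)
    obtain ⟨δ, hδ, hu⟩ := uc ε hε
    refine ⟨K '' (A ∩ ball x (δ / 2)), image_mem_map (inter_mem self_mem_nhdsWithin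
      (mem_nhdsWithin_of_mem_nhds (ball_mem_nhds x (by positivity)))), ?_⟩
    rintro _ ⟨a, ha, rfl⟩ _ ⟨b, hb, rfl⟩
    rw [dist_eq_norm]
    refine hu a ha.1 b hb.1 ?_
    rw [← dist_eq_norm]
    have h1 := ha.2; have h2 := hb.2
    rw [mem_ball] at h1 h2
    linarith [dist_triangle_right a b x]
  set L0 := extendFrom A K
  have hL0c : ContinuousOn L0 (cSt 0 1) := by
    rw [← clA]; exact continuousOn_extendFrom le_rfl hlim
  have hL0e : ∀ z ∈ A, L0 z = K z := fun z hz =>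
    extendFrom_eq (subset_closure hz) (H.cK z hz)
  set L : ℂ → ℂ := fun z => L0 (cl 0 1 z) with hL
  have hLc : Continuous L := hL0c.comp_continuous (cl_cont 0 1) (cl_mem zero_le_one)
  have hLe : ∀ z ∈ A, L z = K z := fun z hz => by
    simp only [hL]; rw [cl_eq (St_sub _ _ hz), hL0e z hz]
  have hLp0 : ∀ z ∈ cSt 0 1, L (z + vi ℓ) = L z + vi (s * (2 * π)) := by
    have hcl : IsClosed {z | L (z + vi ℓ) = L z + vi (s * (2 * π))} :=
      isClosed_eq (by fun_prop) (by fun_prop)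
    rw [← clA]
    refine hcl.closure_subset_iff.2 fun z hz => ?_
    have hz' : z + vi ℓ ∈ A := by simpa using hz
    simp only [Set.mem_ofPred_eq]
    rw [hLe z hz, hLe _ hz', H.per z hz]
  have hLp : ∀ z, L (z + vi ℓ) = L z + vi (s * (2 * π)) := by
    intro z
    have e : ∀ z, L (cl 0 1 z) = L z := fun z => by simp only [hL]; rw [cl_eq (cl_mem zero_le_one z)]
    rw [← e, cl_vi, hLp0 _ (cl_mem zero_le_one z), e]
  have hLm : MapsTo L (cSt 0 1) (cSt (-r) r) := by
    rw [← clA, ← closure_St hrr]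
    have : MapsTo L A (St (-r) r) := fun z hz => by rw [hLe z hz]; exact H.mK hz
    exact this.closure hLc
  refine ⟨L, hLc, hLe, hLp, hLm, ?_, ?_⟩
  · intro z hz hw
    have hne : (𝓝[A] z).NeBot := mem_closure_iff_nhdsWithin_neBot.1 (by rw [clA]; exact hz)
    have h1 : Tendsto (fun z' => h (L z')) (𝓝[A] z) (𝓝 (h (L z))) :=
      ((H.ch.continuousAt ((St_open _ _).mem_nhds hw)).tendsto.comp (hLc.tendsto z)).mono_left nhdsWithin_le_nhds
    have h2 : Tendsto (fun z' => h (L z')) (𝓝[A] z) (𝓝 z) := by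
      refine (tendsto_id.mono_left nhdsWithin_le_nhds).congr' ?_
      filter_upwards [self_mem_nhdsWithin] with z' hz'
      rw [hLe z' hz', H.hK z' hz']; rfl
    rw [tendsto_nhds_unique h2 h1]; exact H.mh hw
  · intro w hw
    rw [← closure_St hrr, mem_closure_iff_seq_limit] at hw
    obtain ⟨x, hx, hxl⟩ := hw
    have hP : s * (2 * π) ≠ 0 := by
      rcases H.s1 with h | h <;> rw [h] <;> simp [Real.pi_ne_zero]
    obtain ⟨z0, hz0, ψ, -, -, hz⟩ := propseq hLc H.l0 hP hLp (z := fun n => h (x n))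
      (fun n => St_sub _ _ (H.mh (hx n))) (w := w) (hxl.congr fun n => by
        rw [hLe _ (H.mh (hx n)), H.Kh _ (hx n)])
    exact ⟨z0, hz0, hz⟩

lemma OU.INV (H : OU φ r ℓ s K h) {L : ℂ → ℂ} (hLc : Continuous L) (hLe : ∀ z ∈ A, L z = K z) {y1 y2 : ℝ}
    (h12 : y1 < y2) {q : ℂ} (hq : q ∉ St (-r) r) (h1 : L (vi y1) = q) (h2 : L (vi y2) = q) : False := by
  set c := y1 + (y2 - y1) / 4 with hc
  set d := y2 - (y2 - y1) / 4 with hd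
  have hcd : c < d := by rw [hc, hd]; linarith
  have hmidA : ∀ y : ℝ, (⟨1 / 2, y⟩ : ℂ) ∈ A := fun y => by constructor <;> norm_num
  have cv : Continuous fun y : ℝ => (⟨1 / 2, y⟩ : ℂ) := by
    have : (fun y : ℝ => (⟨1 / 2, y⟩ : ℂ)) = fun y : ℝ => 1 / 2 + (y : ℂ) * Complex.I := by
      ext y; simp [Complex.ext_iff]
    rw [this]; fun_prop
  obtain ⟨y0, hy0, hmin⟩ := isCompact_Icc.exists_isMinOn (nonempty_Icc.2 hcd.le)
    (f := fun y : ℝ => ‖φ (L ⟨1 / 2, y⟩) - φ q‖)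
    (((φ.continuous.comp (hLc.comp cv)).sub continuous_const).norm.continuousOn)
  obtain ⟨C, hC⟩ := (box_compact 0 1 c d).exists_bound_of_continuousOn (f := fun z => φ (L z) - φ q)
    (((φ.continuous.comp hLc).sub continuous_const).continuousOn)
  have mono : ∀ y ∈ Ioo c d, ∀ η > 0, ∃ x ∈ Ioo (0 : ℝ) 1, ‖φ (K ⟨x, y⟩) - φ q‖ ≤ η := by
    intro y hy η hη
    obtain ⟨ρ, hρ, hb⟩ := Metric.continuousAt_iff.1 (φ.continuous.continuousAt (x := q)) η hη
    have near : ∀ y' : ℝ, L (vi y') = q → ∀ κ > 0, ∃ a ∈ A, |a.im - y'| < κ ∧ K a ∈ ball q ρ := by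
      intro y' hy' κ hκ
      have hcl : vi y' ∈ closure A := by rw [clA]; simp
      have hn : L ⁻¹' ball q ρ ∩ ball (vi y') κ ∈ 𝓝 (vi y') :=
        inter_mem (hLc.continuousAt.preimage_mem_nhds (by rw [hy']; exact ball_mem_nhds q hρ)) (ball_mem_nhds _ hκ)
      obtain ⟨a, ha, haA⟩ := mem_closure_iff_nhds.1 hcl _ hn
      refine ⟨a, haA, ?_, by rw [← hLe a haA]; exact ha.1⟩
      have := ha.2; rw [mem_ball, dist_eq_norm] at this
      simpa using (Complex.abs_im_le_norm _).trans_lt this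
    obtain ⟨a, haA, ha1, ha2⟩ := near y1 h1 ((y2 - y1) / 4) (by linarith)
    obtain ⟨b, hbA, hb1, hb2⟩ := near y2 h2 ((y2 - y1) / 4) (by linarith)
    have hW : IsPreconnected (ball q ρ ∩ St (-r) r) := ((convex_ball q ρ).inter (St_convex _ _)).isPreconnected
    have := (hW.image (fun w => (h w).im) (Complex.continuous_im.comp_continuousOn
      (H.ch.mono inter_subset_right))).ordConnected.out ⟨K a, ⟨ha2, H.mK haA⟩, rfl⟩ ⟨K b, ⟨hb2, H.mK hbA⟩, rfl⟩
    simp only [H.hK a haA, H.hK b hbA] at this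
    rw [abs_lt] at ha1 hb1
    obtain ⟨w, hw, hwy⟩ := this (show y ∈ _ from ⟨by linarith [hy.1], by linarith [hy.2]⟩)
    refine ⟨(h w).re, H.mh hw.2, ?_⟩
    have e : (⟨(h w).re, y⟩ : ℂ) = h w := by simp only at hwy; rw [← hwy]
    rw [e, H.Kh w hw.2, ← dist_eq_norm]
    exact (hb hw.1).le
  refine inv_core H.hol (fun a ha b hb hab => H.inj ha hb (φ.injective hab)) hcd (w0 := φ q)
    (m := ‖φ (L ⟨1 / 2, y0⟩) - φ q‖) (C := |C| + 1) ?_ (by positivity) ?_ ?_ (fun η hη y hy => mono y hy η hη)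
  · rw [norm_pos_iff, sub_ne_zero]
    intro he
    have := φ.injective he
    apply hq; rw [← this, hLe _ (hmidA y0)]; exact H.mK (hmidA y0)
  · intro y hy
    have := hmin (Ioo_subset_Icc_self hy)
    simp only [Set.mem_ofPred_eq] at this
    rwa [hLe _ (hmidA y)] at this
  · intro z hz hzi
    rw [← hLe z hz]
    refine (hC z ?_).trans (by linarith [le_abs_self C])
    rw [Complex.mem_reProdIm]; exact ⟨St_sub _ _ hz, Ioo_subset_Icc_self hzi⟩

lemma OU.wconst (H : OU φ r ℓ s K h) {L : ℂ → ℂ} (hLc : Continuous L) (hLm : MapsTo L (cSt 0 1) (cSt (-r) r))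
    (hLw : ∀ z ∈ cSt 0 1, L z ∈ St (-r) r → z ∈ A) (x : ℝ) (hx : x = 0 ∨ x = 1) :
    (∀ z : ℂ, z.re = x → (L z).re = -r) ∨ (∀ z : ℂ, z.re = x → (L z).re = r) := by
  have key : ∀ z : ℂ, z.re = x → (L z).re = -r ∨ (L z).re = r := by
    intro z hz
    have hz1 : z ∈ cSt 0 1 := by rcases hx with h | h <;> simp [hz, h]
    have h1 := hLm hz1
    by_contra! hcon
    have := hLw z hz1 ⟨lt_of_le_of_ne h1.1 (Ne.symm hcon.1), lt_of_le_of_ne h1.2 hcon.2⟩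
    rcases hx with h | h <;> simp [hz, h] at this
  have hpre : IsPreconnected {z : ℂ | z.re = x} := (convex_hyperplane (f := Complex.re) ⟨by simp, by simp⟩ x).isPreconnected
  have hpi := (hpre.image (fun z => (L z).re) (by fun_prop)).ordConnected
  by_contra! hcon
  obtain ⟨⟨a, ha, ha'⟩, ⟨b, hb, hb'⟩⟩ := hcon
  have ha2 := (key a ha).resolve_left ha'
  have hb2 := (key b hb).resolve_right hb'
  have h0 : (0 : ℝ) ∈ Icc (L b).re (L a).re := by rw [ha2, hb2]; constructor <;> linarith [H.r0]
  obtain ⟨c, hc, hc0⟩ := hpi.out ⟨b, hb, rfl⟩ ⟨a, ha, rfl⟩ h0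
  have := H.r0
  simp only at hc0
  rcases key c hc with h | h <;> linarith

theorem OU.ext (H : OU φ r ℓ s K h) (hφ : IsLift φ) : ∃ K' h', CU φ r ℓ K' h' := by
  have hr := H.r0
  -- reduce to left wall mapping to left wall
  have main : ∀ (s : ℝ) (K h : ℂ → ℂ), OU φ r ℓ s K h → ∀ L : ℂ → ℂ, Continuous L → (∀ z ∈ A, L z = K z) →
    (∀ z, L (z + vi ℓ) = L z + vi (s * (2 * π))) → MapsTo L (cSt 0 1) (cSt (-r) r) →
    (∀ z ∈ cSt 0 1, L z ∈ St (-r) r → z ∈ A) → SurjOn L (cSt 0 1) (cSt (-r) r) →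
    (∀ z : ℂ, z.re = 0 → (L z).re = -r) → (∀ z : ℂ, z.re = 1 → (L z).re = r) → ∃ K' h', CU φ r ℓ K' h' := by
    intro s K h H L hLc hLe hLp hLm hLw hLs hw0 hw1
    have vre : ∀ z : ℂ, z.re = 0 → z = vi z.im := fun z hz => by simp [Complex.ext_iff, hz]
    have vre1 : ∀ z : ℂ, z.re = 1 → 1 - vi (-z.im) = z := fun z hz => by simp [Complex.ext_iff, hz]
    have inj0 : ∀ y1 y2 : ℝ, L (vi y1) = L (vi y2) → ¬ y1 < y2 := by
      intro y1 y2 he hlt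
      refine H.INV hLc hLe hlt (q := L (vi y1)) ?_ rfl he.symm
      intro hm; have := hm.1; rw [hw0 _ (by simp)] at this; linarith
    have inj1 : ∀ y1 y2 : ℝ, L (1 - vi y1) = L (1 - vi y2) → ¬ y1 < y2 := by
      intro y1 y2 he hlt
      refine H.flip.INV (L := fun z => L (1 - z)) (by fun_prop) (fun z hz => hLe _ ?_) hlt (q := L (1 - vi y1)) ?_ rfl he.symm
      · simp only [mem_preimage, mem_Ioo, Complex.sub_re, Complex.one_re] at hz ⊢
        constructor <;> linarith [hz.1, hz.2]
      · intro hm; have := hm.2; rw [hw1 _ (by simp)] at this; linarith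
    have tri : ∀ z ∈ cSt 0 1, z.re = 0 ∨ z.re = 1 ∨ z ∈ A := by
      intro z hz
      rcases eq_or_lt_of_le hz.1 with h | h
      · exact Or.inl h.symm
      rcases eq_or_lt_of_le hz.2 with h' | h'
      · exact Or.inr (Or.inl h')
      · exact Or.inr (Or.inr ⟨h, h'⟩)
    have hA : ∀ z ∈ A, -r < (L z).re ∧ (L z).re < r := fun z hz => by
      rw [hLe z hz]; exact H.mK hz
    have inj : InjOn L (cSt 0 1) := by
      intro a ha b hb hab
      rcases tri a ha with h1 | h1 | h1 <;> rcases tri b hb with h2 | h2 | h2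
      · rw [vre a h1, vre b h2] at hab ⊢
        rcases lt_trichotomy a.im b.im with h | h | h
        · exact absurd h (inj0 _ _ hab)
        · rw [h]
        · exact absurd h (inj0 _ _ hab.symm)
      · have := hw0 a h1; rw [hab, hw1 b h2] at this; linarith
      · have := (hA b h2).1; rw [← hab, hw0 a h1] at this; linarith
      · have := hw1 a h1; rw [hab, hw0 b h2] at this; linarith
      · rw [← vre1 a h1, ← vre1 b h2] at hab ⊢
        rcases lt_trichotomy (-a.im) (-b.im) with h | h | h
        · exact absurd h (inj1 _ _ hab)
        · rw [h]
        · exact absurd h (inj1 _ _ hab.symm)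
      · have := (hA b h2).2; rw [← hab, hw1 a h1] at this; linarith
      · have := (hA a h1).1; rw [hab, hw0 b h2] at this; linarith
      · have := (hA a h1).2; rw [hab, hw1 b h2] at this; linarith
      · rw [hLe a h1, hLe b h2] at hab; exact H.inj h1 h2 hab
    have hP : s * (2 * π) ≠ 0 := by
      rcases H.s1 with h | h <;> rw [h] <;> simp [Real.pi_ne_zero]
    set g := Function.invFunOn L (cSt 0 1)
    have hg1 : ∀ w ∈ cSt (-r) r, g w ∈ cSt 0 1 := fun w hw => Function.invFunOn_mem (hLs hw)
    have hg2 : ∀ w ∈ cSt (-r) r, L (g w) = w := fun w hw => Function.invFunOn_eq (hLs hw)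
    have hgc : ContinuousOn g (cSt (-r) r) := by
      rw [continuousOn_iff_continuous_restrict, continuous_iff_seqContinuous]
      intro x w hx
      refine tendsto_of_subseq_tendsto fun ns hns => ?_
      have h1 : Tendsto (fun n => L (g (x (ns n)))) atTop (𝓝 w) := by
        refine ((continuous_subtype_val.tendsto w).comp (hx.comp hns)).congr fun n => ?_
        rw [hg2 _ (x (ns n)).2]; rfl
      obtain ⟨z0, hz0, ψ, -, hψ, hz⟩ := propseq hLc H.l0 hP hLp (fun n => hg1 _ (x (ns n)).2) h1
      refine ⟨ψ, ?_⟩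
      have : g w = z0 := inj (hg1 _ w.2) hz0 (by rw [hg2 _ w.2, hz])
      simp only [restrict_apply, this]
      exact hψ
    set h' : ℂ → ℂ := fun w => g (cl (-r) r w)
    have hrr : -r ≤ r := by linarith
    have ch : Continuous h' := hgc.comp_continuous (cl_cont _ _) (cl_mem hrr)
    have he : ∀ w ∈ cSt (-r) r, h' w = g w := fun w hw => by simp only [h']; rw [cl_eq hw]
    have hK : ∀ z ∈ cSt 0 1, h' (L z) = z := fun z hz => by
      rw [he _ (hLm hz)]; exact inj (hg1 _ (hLm hz)) hz (hg2 _ (hLm hz))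
    have hol : DifferentiableOn ℂ (fun z => φ (L z)) A := H.hol.congr fun z hz => by rw [hLe z hz]
    have cj : ∀ z ∈ cSt 0 1, (starRingEnd ℂ) z ∈ cSt 0 1 := fun z hz => by simpa using hz
    have cc : Continuous (starRingEnd ℂ) := Complex.continuous_conj
    rcases H.s1 with hs | hs
    · refine ⟨L, h', hr, H.l0, hLc, ch, hLm, fun w hw => by rw [he w hw]; exact hg1 w hw,
        fun w hw => by rw [he w hw]; exact hg2 w hw, hK, fun z => by rw [hLp, hs, one_mul], hw0, hw1, Or.inl hol⟩
    · refine ⟨fun z => L ((starRingEnd ℂ) z), fun w => (starRingEnd ℂ) (h' w), hr, H.l0, hLc.comp cc, cc.comp ch,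
        fun z hz => hLm (cj z hz), fun w hw => cj _ (by rw [he w hw]; exact hg1 w hw),
        fun w hw => by show L ((starRingEnd ℂ) ((starRingEnd ℂ) (h' w))) = w; rw [Complex.conj_conj, he w hw]; exact hg2 w hw,
        fun z hz => by show (starRingEnd ℂ) (h' (L ((starRingEnd ℂ) z))) = z; rw [hK _ (cj z hz), Complex.conj_conj], fun z => ?_,
        fun z hz => hw0 _ (by simpa), fun z hz => hw1 _ (by simpa), Or.inr (by simpa using hol)⟩
      have e : (starRingEnd ℂ) (z + vi ℓ) + vi ℓ = (starRingEnd ℂ) z := by simp [vi]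
      have := hLp ((starRingEnd ℂ) (z + vi ℓ))
      rw [e, hs] at this
      simp only [this, vi]; push_cast; ring
  obtain ⟨L, hLc, hLe, hLp, hLm, hLw, hLs⟩ := H.extK hφ
  have surj : ∀ x : ℝ, (x = -r ∨ x = r) → (∀ z : ℂ, z.re = 0 → (L z).re ≠ x) → (∀ z : ℂ, z.re = 1 → (L z).re ≠ x) → False := by
    intro x hx h0 h1
    obtain ⟨z, hz, hzx⟩ := hLs (show (x : ℂ) ∈ cSt (-r) r by rcases hx with h | h <;> simp [h] <;> linarith)
    have hzr : (L z).re = x := by rw [hzx]; simp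
    by_cases hzA : z ∈ A
    · have := H.mK hzA
      rw [← hLe z hzA, mem_preimage, hzr] at this
      rcases hx with h | h <;> rw [h] at this
      · exact lt_irrefl _ this.1
      · exact lt_irrefl _ this.2
    · have h0' : z.re ≠ 0 := fun h => h0 z h hzr
      have h1' : z.re ≠ 1 := fun h => h1 z h hzr
      exact hzA ⟨lt_of_le_of_ne hz.1 (Ne.symm h0'), lt_of_le_of_ne hz.2 h1'⟩
  rcases H.wconst hLc hLm hLw 0 (Or.inl rfl) with h0 | h0 <;>
    rcases H.wconst hLc hLm hLw 1 (Or.inr rfl) with h1 | h1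
  · exact (surj r (Or.inr rfl) (fun z hz => by rw [h0 z hz]; linarith) (fun z hz => by rw [h1 z hz]; linarith)).elim
  · exact main s K h H L hLc hLe hLp hLm hLw hLs h0 h1
  · have m : ∀ z ∈ cSt 0 1, 1 - z ∈ cSt 0 1 := fun z hz => by
      simp only [mem_preimage, mem_Icc, Complex.sub_re, Complex.one_re] at hz ⊢
      constructor <;> linarith [hz.1, hz.2]
    have m' : ∀ z, 1 - z ∈ A → z ∈ A := fun z hz => by
      simp only [mem_preimage, mem_Ioo, Complex.sub_re, Complex.one_re] at hz ⊢
      constructor <;> linarith [hz.1, hz.2]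
    refine main (-s) _ _ H.flip (fun z => L (1 - z)) (by fun_prop) (fun z hz => hLe _ (m' _ (by simpa using hz))) ?_
      (fun z hz => hLm (m z hz)) (fun z hz hw => m' z (hLw _ (m z hz) hw)) ?_ (fun z hz => h1 _ (by simp [hz]))
      (fun z hz => h0 _ (by simp [hz]))
    · intro z
      have := hLp (1 - (z + vi ℓ))
      rw [show 1 - (z + vi ℓ) + vi ℓ = 1 - z by ring] at this
      simp only [this, vi]; push_cast; ring
    · intro w hw
      obtain ⟨z, hz, hzw⟩ := hLs hw
      exact ⟨1 - z, m z hz, by simpa using hzw⟩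
  · exact (surj (-r) (Or.inl rfl) (fun z hz => by rw [h0 z hz]; linarith) (fun z hz => by rw [h1 z hz]; linarith)).elim

lemma map_nhds {f : ℂ → ℂ} {U : Set ℂ} (hU : IsOpen U) (hf : DifferentiableOn ℂ f U) (hi : InjOn f U) {z : ℂ}
    (hz : z ∈ U) : 𝓝 (f z) ≤ map f (𝓝 z) := by
  have han := hf.analyticAt (hU.mem_nhds hz)
  refine han.eventually_constant_or_nhds_le_map_nhds.resolve_left fun hc => ?_
  obtain ⟨w, ⟨hw1, hw2⟩, hw3⟩ := (((hc.and (hU.mem_nhds hz)).filter_mono nhdsWithin_le_nhds).and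
    (self_mem_nhdsWithin (a := z) (s := {z}ᶜ))).exists
  exact hw3 (hi hw2 hz hw1)

lemma inv_hol {f g : ℂ → ℂ} {U : Set ℂ} (hU : IsOpen U) (hf : DifferentiableOn ℂ f U)
    (hg : ∀ z ∈ U, g (f z) = z) : IsOpen (f '' U) ∧ DifferentiableOn ℂ g (f '' U) := by
  have hi : InjOn f U := fun a ha b hb hab => by rw [← hg a ha, ← hg b hb, hab]
  have hm := fun z hz => map_nhds hU hf hi (z := z) hz
  have him : ∀ z ∈ U, ∀ V ∈ 𝓝 z, f '' V ∈ 𝓝 (f z) := fun z hz V hV => hm z hz (image_mem_map hV)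
  have hV : IsOpen (f '' U) := isOpen_iff_mem_nhds.2 (by
    rintro _ ⟨z, hz, rfl⟩; exact him z hz U (hU.mem_nhds hz))
  have gc : ∀ z ∈ U, ContinuousAt g (f z) := by
    intro z hz
    rw [ContinuousAt, hg z hz]
    intro V hV
    rw [mem_map]
    refine mem_of_superset (him z hz _ (inter_mem hV (hU.mem_nhds hz))) ?_
    rintro _ ⟨w, hw, rfl⟩
    rw [mem_preimage, hg w hw.2]; exact hw.1
  have gd : ∀ z ∈ U, deriv f z ≠ 0 → DifferentiableAt ℂ g (f z) := by
    intro z hz hd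
    have h1 : HasDerivAt f (deriv f z) (g (f z)) := by
      rw [hg z hz]; exact (hf.differentiableAt (hU.mem_nhds hz)).hasDerivAt
    refine (HasDerivAt.of_local_left_inverse (gc z hz) h1 hd ?_).differentiableAt
    filter_upwards [hV.mem_nhds (mem_image_of_mem f hz)] with w hw
    obtain ⟨u, hu, rfl⟩ := hw
    rw [hg u hu]
  refine ⟨hV, ?_⟩
  rintro _ ⟨z, hz, rfl⟩
  apply DifferentiableAt.differentiableWithinAt
  have han := hf.analyticAt (hU.mem_nhds hz)
  rcases han.deriv.eventually_eq_zero_or_eventually_ne_zero with h0 | h0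
  · exfalso
    obtain ⟨ε, hε, hb⟩ := Metric.eventually_nhds_iff_ball.1 (h0.and (hU.mem_nhds hz))
    have h1 : DifferentiableOn ℂ f (ball z ε) := hf.mono fun w hw => (hb w hw).2
    have h2 := fun {x y} => isOpen_ball.is_const_of_deriv_eq_zero (x := x) (y := y) (convex_ball z ε).isPreconnected h1 (fun w hw => (hb w hw).1)
    have h3 : z + (ε / 2 : ℝ) ∈ ball z ε := by simp [abs_of_pos hε]; linarith
    have h4 := hi (hb _ h3).2 hz (h2 h3 (mem_ball_self hε))
    simp at h4; linarith
  · refine (Complex.analyticAt_of_differentiable_on_punctured_nhds_of_continuousAt ?_ (gc z hz)).differentiableAt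
    have h1 : {w | w ≠ z → deriv f w ≠ 0} ∈ 𝓝 z := by rwa [eventually_nhdsWithin_iff] at h0
    have := him z hz _ (inter_mem h1 (hU.mem_nhds hz))
    rw [eventually_nhdsWithin_iff]
    filter_upwards [this] with w hw hne
    obtain ⟨u, ⟨hu, hu2⟩, rfl⟩ := hw
    exact gd u hu2 (hu fun h => hne (by rw [h]; rfl))

lemma strip_rigid {B : ℂ → ℂ} (hd : DifferentiableOn ℂ B A) (hc : Continuous B) (hm : MapsTo B (cSt 0 1) (cSt 0 1))
    (h0 : ∀ z : ℂ, z.re = 0 → (B z).re = 0) (h1 : ∀ z : ℂ, z.re = 1 → (B z).re = 1) :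
    ∃ d : ℝ, ∀ z ∈ cSt 0 1, B z = z + vi d := by
  have key : ∀ s : ℝ, (s = 1 ∨ s = -1) → ∀ z ∈ cSt 0 1, s * (B z - z).re ≤ 0 := by
    intro s hs z hz
    have e : ∀ z, ‖Complex.exp (s * (B z - z))‖ = Real.exp (s * (B z - z).re) := fun z => by
      rw [Complex.norm_exp]; simp
    have := PhragmenLindelof.vertical_strip (f := fun z => Complex.exp (s * (B z - z))) (a := 0) (b := 1) (C := 1)
      (z := z) ⟨((hd.sub differentiableOn_id).const_mul _).cexp, by fun_prop⟩ ⟨0, by simp; positivity, 0, ?_⟩ ?_ ?_ hz.1 hz.2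
    · simp only [e, Real.exp_le_one_iff] at this; exact this
    · refine Asymptotics.IsBigO.of_bound (Real.exp 1) ?_
      filter_upwards [mem_inf_of_right (mem_principal_self _)] with w hw
      rw [e]
      simp
      have := hm (St_sub _ _ hw); have hw := St_sub _ _ hw
      rcases hs with rfl | rfl <;> linarith [this.1, this.2, hw.1, hw.2]
    · intro z hz; rw [e]; simp [h0 z hz, hz]
    · intro z hz; rw [e]; simp [h1 z hz, hz]
  have hre : ∀ z ∈ cSt 0 1, (B z - z).re = 0 := fun z hz => by
    have a := key 1 (Or.inl rfl) z hz; have b := key (-1) (Or.inr rfl) z hz; linarith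
  have hA : IsConnected A := ⟨⟨1 / 2, by norm_num⟩, (St_convex _ _).isPreconnected⟩
  obtain ⟨c, hcc⟩ := AnalyticOnNhd.eq_const_of_re_eq_const (c₀ := 0)
    ((hd.sub differentiableOn_id).analyticOnNhd (St_open 0 1)) (fun z hz => hre z (St_sub _ _ hz)) (St_open _ _) hA
  have he : EqOn B (fun z => z + c) (cSt 0 1) := by
    rw [← closure_St one_pos]
    refine Set.EqOn.closure (fun z hz => ?_) hc (by fun_prop)
    show B z = z + c
    have : B z - z = c := hcc z hz
    linear_combination this
  have h2 : c = vi c.im := by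
    have := h0 0 rfl
    rw [he (x := 0) (by simp)] at this
    simp at this
    apply Complex.ext <;> simp [this]
  exact ⟨c.im, fun z hz => by rw [← h2]; exact he hz⟩

structure WU (φ : ℂ ≃ₜ ℂ) (r ℓ : ℝ) (K : ℂ → ℂ) : Prop where
  l0 : 0 < ℓ
  cK : Continuous K
  mK : MapsTo K (cSt 0 1) (cSt (-r) r)
  per : ∀ z, K (z + vi ℓ) = K z + vi (2 * π)
  w0 : ∀ z : ℂ, z.re = 0 → (K z).re = -r
  w1 : ∀ z : ℂ, z.re = 1 → (K z).re = r
  hol : DifferentiableOn ℂ (fun z => φ (K z)) A ∨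
    DifferentiableOn ℂ (fun z => φ (K ((starRingEnd ℂ) z))) A
lemma CU.toWU (H : CU φ r ℓ K h) : WU φ r ℓ K := ⟨H.l0, H.cK, H.mK, H.per, H.w0, H.w1, H.hol⟩

lemma surj_im {f : ℂ → ℂ} (hc : Continuous f) {P Q : ℝ} (hQ : Q ≠ 0) (hp : ∀ z, f (z + vi P) = f z + vi Q) (x y : ℝ) :
    ∃ t : ℝ, (f (x + vi t)).im = y := by
  have hcont : Continuous fun t : ℝ => (f (x + vi t)).im := by unfold vi; fun_prop
  have hs : ∀ n : ℤ, (f (x + vi (n * P))).im = (f x).im + n * Q := fun n => by rw [vper hp]; simp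
  obtain ⟨n, hn⟩ := exists_int_ge ((y - (f x).im) / Q)
  obtain ⟨m, hm⟩ := exists_int_le ((y - (f x).im) / Q)
  have : y ∈ uIcc (f (x + vi (n * P))).im (f (x + vi (m * P))).im := by
    rw [hs, hs]
    rcases hQ.lt_or_gt with h | h
    · rw [div_le_iff_of_neg h] at hn; rw [le_div_iff_of_neg h] at hm
      exact ⟨inf_le_left.trans (by linarith), le_sup_of_le_right (by linarith)⟩
    · rw [div_le_iff₀ h] at hn; rw [le_div_iff₀ h] at hm
      exact ⟨inf_le_right.trans (by linarith), le_sup_of_le_left (by linarith)⟩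
  obtain ⟨t, -, ht⟩ := intermediate_value_uIcc (hcont.continuousOn (s := uIcc ((n : ℝ) * P) (m * P))) this
  exact ⟨t, ht⟩

lemma CU.h0 (H : CU φ r ℓ K h) {w : ℂ} (hw : w.re = -r) : (h w).re = 0 := by
  obtain ⟨t, ht⟩ := surj_im H.cK (by positivity) H.per 0 w.im
  have e : w = K (((0 : ℝ) : ℂ) + vi t) := Complex.ext (by rw [hw, H.w0]; simp) ht.symm
  rw [e, H.hK _ (by simp)]; simp
lemma CU.h1 (H : CU φ r ℓ K h) {w : ℂ} (hw : w.re = r) : (h w).re = 1 := by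
  obtain ⟨t, ht⟩ := surj_im H.cK (by positivity) H.per 1 w.im
  have e : w = K (((1 : ℝ) : ℂ) + vi t) := Complex.ext (by rw [hw, H.w1]; simp) ht.symm
  rw [e, H.hK _ (by simp)]; simp

lemma CU.mA (H : CU φ r ℓ K h) {z : ℂ} (hz : z ∈ A) : K z ∈ St (-r) r := by
  have hz' := St_sub _ _ hz
  have h1 := H.mK hz'; have h2 := H.hK z hz'
  refine ⟨h1.1.lt_of_ne fun e => ?_, h1.2.lt_of_ne fun e => ?_⟩
  · have := H.h0 e.symm; rw [h2] at this; exact hz.1.ne' this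
  · have := H.h1 e; rw [h2] at this; exact hz.2.ne this
lemma CU.mS (H : CU φ r ℓ K h) {w : ℂ} (hw : w ∈ St (-r) r) : h w ∈ A := by
  have hw' := St_sub _ _ hw
  have h1 := H.mh hw'; have h2 := H.Kh w hw'
  refine ⟨h1.1.lt_of_ne fun e => ?_, h1.2.lt_of_ne fun e => ?_⟩
  · have := H.w0 _ e.symm; rw [h2] at this; exact hw.1.ne' this
  · have := H.w1 _ e; rw [h2] at this; exact hw.2.ne this

/-- conj if b -/
def cb (b : Bool) (z : ℂ) : ℂ := if b then (starRingEnd ℂ) z else z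
lemma cb_cont (b : Bool) : Continuous (cb b) := by
  cases b
  · exact continuous_id
  · exact Complex.continuous_conj
@[simp] lemma cb_re (b : Bool) (z : ℂ) : (cb b z).re = z.re := by cases b <;> simp [cb]
@[simp] lemma cb_cb (b : Bool) (z : ℂ) : cb b (cb b z) = z := by cases b <;> simp [cb]
@[simp] lemma cb_add (b : Bool) (z w : ℂ) : cb b (z + w) = cb b z + cb b w := by cases b <;> simp [cb]
@[simp] lemma cb_sub (b : Bool) (z w : ℂ) : cb b (z - w) = cb b z - cb b w := by cases b <;> simp [cb]
def sb (b : Bool) : ℝ := if b then -1 else 1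
lemma sb_s1 (b : Bool) : sb b = 1 ∨ sb b = -1 := by cases b <;> simp [sb]
@[simp] lemma sb_sb (b : Bool) : sb b * sb b = 1 := by cases b <;> simp [sb]
lemma cb_vi (b : Bool) (y : ℝ) : cb b (vi y) = vi (sb b * y) := by cases b <;> simp [cb, vi, sb]
lemma norm_cb (b : Bool) (z : ℂ) : ‖cb b z‖ = ‖z‖ := by cases b <;> simp [cb]
lemma per_sb {f : ℂ → ℂ} {P Q : ℝ} (hp : ∀ z, f (z + vi P) = f z + vi Q) (b : Bool) (z : ℂ) :
    f (z + vi (sb b * P)) = f z + vi (sb b * Q) := by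
  cases b
  · simpa [sb] using hp z
  · have := vper hp (-1) z; simpa [sb] using this
lemma cb_hol (h : DifferentiableOn ℂ (fun z => φ (K z)) A ∨
    DifferentiableOn ℂ (fun z => φ (K ((starRingEnd ℂ) z))) A) : ∃ b, DifferentiableOn ℂ (fun z => φ (K (cb b z))) A := by
  rcases h with h | h
  · exact ⟨false, h⟩
  · exact ⟨true, h⟩
lemma hol_cb {b : Bool} (h : DifferentiableOn ℂ (fun z => φ (K (cb b z))) A) : DifferentiableOn ℂ (fun z => φ (K z)) A ∨
    DifferentiableOn ℂ (fun z => φ (K ((starRingEnd ℂ) z))) A := by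
  cases b
  · exact Or.inl h
  · exact Or.inr h

lemma CU.toOU (H : CU φ r ℓ K h) (hφ : IsLift φ) {b : Bool} (hb : DifferentiableOn ℂ (fun z => φ (K (cb b z))) A) :
    OU φ r ℓ (sb b) (fun z => K (cb b z)) (fun w => cb b (h w)) where
  r0 := H.r0
  l0 := H.l0
  s1 := sb_s1 b
  mK z hz := H.mA (by simpa using hz)
  mh w hw := by have := H.mS hw; simpa using this
  Kh w hw := by simp [H.Kh w (St_sub _ _ hw)]
  hK z hz := by simp [H.hK (cb b z) (by simpa using St_sub _ _ hz)]
  cK := (H.cK.comp (cb_cont b)).continuousOn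
  ch := ((cb_cont b).comp H.ch).continuousOn
  per z hz := by rw [cb_add, cb_vi, per_sb H.per]
  hol := hb
  fp := hφ.per

/-- the global holomorphic inverse coordinate -/
lemma CU.ghol (H : CU φ r ℓ K h) {b : Bool} (hb : DifferentiableOn ℂ (fun z => φ (K (cb b z))) A) :
    φ '' St (-r) r = (fun z => φ (K (cb b z))) '' A ∧ IsOpen (φ '' St (-r) r) ∧
    DifferentiableOn ℂ (fun w => cb b (h (φ.symm w))) (φ '' St (-r) r) := by
  have e : φ '' St (-r) r = (fun z => φ (K (cb b z))) '' A := by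
    ext w; constructor
    · rintro ⟨w, hw, rfl⟩
      refine ⟨cb b (h w), by simpa using H.mS hw, by simp [H.Kh w (St_sub _ _ hw)]⟩
    · rintro ⟨z, hz, rfl⟩
      exact ⟨_, H.mA (by simpa using hz), rfl⟩
  rw [e]
  exact ⟨rfl, inv_hol (St_open 0 1) hb fun z hz => by simp [H.hK (cb b z) (by simpa using St_sub _ _ hz)]⟩

lemma CU.uniq {ℓ' : ℝ} {K' : ℂ → ℂ} (H : CU φ r ℓ K h) (W : WU φ r ℓ' K') :
    ℓ' = ℓ ∧ ∃ d : ℝ, ∀ z ∈ cSt 0 1, K' z = K (z + vi d) := by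
  obtain ⟨b, hb⟩ := cb_hol H.hol
  obtain ⟨c, hc⟩ := cb_hol W.hol
  obtain ⟨e, -, hg⟩ := H.ghol hb
  have hA : IsConnected A := ⟨⟨1 / 2, by norm_num⟩, (St_convex _ _).isPreconnected⟩
  have cbc : ∀ z ∈ cSt 0 1, cb c z ∈ cSt 0 1 := fun z hz => by simpa using hz
  have hop : ∀ z ∈ A, K' (cb c z) ∈ St (-r) r := by
    have : IsOpen ((fun z => φ (K' (cb c z))) '' A) := by
      rcases (hc.analyticOnNhd (St_open 0 1)).is_constant_or_isOpen hA.isPreconnected with ⟨w, hw⟩ | h'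
      · exfalso
        have h1 : Continuous fun z => φ (K' (cb c z)) := φ.continuous.comp (W.cK.comp (cb_cont c))
        have h2 : EqOn (fun z => φ (K' (cb c z))) (fun _ => w) (cSt 0 1) := by
          rw [← closure_St one_pos]; exact Set.EqOn.closure hw h1 continuous_const
        have h3 := φ.injective ((h2 (x := 0) (by simp)).trans (h2 (x := 1) (by simp)).symm)
        have h4 := congrArg Complex.re h3
        rw [W.w0 _ (by simp), W.w1 _ (by simp)] at h4
        linarith [H.r0]
      · exact h' A le_rfl (St_open 0 1)
    have h2 : IsOpen ((fun z => K' (cb c z)) '' A) := by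
      rw [← φ.isOpen_image, image_image]; exact this
    intro z hz
    have h3 : (fun z => K' (cb c z)) '' A ⊆ interior (cSt (-r) r) := interior_maximal (by
      rintro _ ⟨z, hz, rfl⟩; exact W.mK (cbc z (St_sub _ _ hz))) h2
    have := h3 ⟨z, hz, rfl⟩
    rwa [cSt, Complex.interior_preimage_re, interior_Icc] at this
  obtain ⟨d, hd⟩ := strip_rigid (B := fun z => cb b (h (K' (cb c z)))) (by
    refine (hg.comp hc fun z hz => ⟨_, hop z hz, rfl⟩).congr fun z hz => ?_
    simp) ((cb_cont b).comp (H.ch.comp (W.cK.comp (cb_cont c))))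
    (fun z hz => by have := H.mh (W.mK (cbc z hz)); simpa using this)
    (fun z hz => by rw [cb_re]; exact H.h0 (W.w0 _ (by simpa))) (fun z hz => by rw [cb_re]; exact H.h1 (W.w1 _ (by simpa)))
  have key : ∀ z ∈ cSt 0 1, K' z = K (cb b (cb c z) + vi (sb b * d)) := fun z hz => by
    have h1 := hd _ (cbc z hz)
    simp only [cb_cb] at h1
    have h2 := congrArg (cb b) h1
    rw [cb_cb, cb_add, cb_vi] at h2
    rw [← h2, H.Kh _ (W.mK hz)]
  have inj : ∀ a ∈ cSt 0 1, ∀ b ∈ cSt 0 1, K a = K b → a = b := fun a ha b hb hab => by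
    rw [← H.hK a ha, ← H.hK b hb, hab]
  have h1 := key 0 (by simp)
  have h2 := key (0 + vi ℓ') (by simp)
  rw [W.per, h1, ← H.per, cb_add, cb_vi, cb_add, cb_vi] at h2
  have h3 := congrArg Complex.im (inj _ (by simp) _ (by simp) h2)
  simp [cb] at h3
  have h0 := H.l0; have h0' := W.l0
  have hbc : sb b = sb c := by
    cases b <;> cases c <;> simp [sb] at h3 ⊢ <;> linarith
  rw [hbc, ← mul_assoc, sb_sb, one_mul] at h3
  refine ⟨by linarith, sb b * d, fun z hz => ?_⟩
  rw [key z hz]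
  have : b = c := by cases b <;> cases c <;> simp [sb] at hbc ⊢ <;> linarith
  rw [this, cb_cb]

lemma CU.lup (H : CU φ r ℓ K h) {d : ℝ} (hd : 0 < d) {N : ℕ} (h1 : ∀ y : ℝ, ball (φ (vi y)) d ⊆ φ '' St (-r) r)
    (h2 : ∀ k : ℕ, k < N → ‖φ (vi (2 * π * ((k + 1) / N))) - φ (vi (2 * π * (k / N)))‖ ≤ d / 2) (hN : N ≠ 0) : ℓ ≤ 4 * N := by
  obtain ⟨b, hb⟩ := cb_hol H.hol
  obtain ⟨e, -, hg⟩ := H.ghol hb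
  have step : ∀ k : ℕ, k ≤ N → ‖h (vi (2 * π * (k / N))) - h (vi 0)‖ ≤ 4 * k := by
    intro k
    induction k with
    | zero => intro _; simp [vi]
    | succ k ih =>
      intro hk
      have h3 := h2 k hk
      have h4 := bcl hd one_pos (hg.mono (h1 (2 * π * (k / N)))) (fun w hw => by
        obtain ⟨u, hu, rfl⟩ := h1 _ hw
        have := H.mS hu
        simp; rw [abs_le]; constructor <;> linarith [this.1, this.2]) h3
      simp only [φ.symm_apply_apply] at h4
      rw [← cb_sub, norm_cb] at h4
      have h5 : 8 * 1 / d * ‖φ (vi (2 * π * ((k + 1) / N))) - φ (vi (2 * π * (k / N)))‖ ≤ 4 := by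
        refine (mul_le_mul_of_nonneg_left h3 (by positivity)).trans (le_of_eq (by field_simp; norm_num))
      have h6 := ih (by omega)
      push_cast
      have := norm_sub_le_norm_sub_add_norm_sub (h (vi (2 * π * ((k + 1) / N)))) (h (vi (2 * π * (k / N)))) (h (vi 0))
      linarith
  have h3 := step N le_rfl
  rw [div_self (by exact_mod_cast hN), mul_one] at h3
  have h4 : h (vi (2 * π)) = h (vi 0) + vi ℓ := by
    have hr := H.r0
    have h5 : h (vi 0) ∈ cSt 0 1 := H.mh (by simp [hr.le])
    have : K (h (vi 0) + vi ℓ) = vi (2 * π) := by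
      rw [H.per, H.Kh _ (by simp [hr.le])]; simp [vi]
    rw [← this, H.hK _ (by simpa using h5)]
  rw [h4, add_sub_cancel_left, norm_vi] at h3
  exact (le_abs_self _).trans h3

lemma tlu {ι : Type*} {F : ι → ℂ → ℂ} {f : ℂ → ℂ} {l : Filter ι} [l.NeBot] {D : Set ℂ}
    (hb : ∀ z ∈ D, ∃ ε > 0, ∃ C > 0, ∀ᶠ n in l, DifferentiableOn ℂ (F n) (ball z ε) ∧ ∀ w ∈ ball z ε, |(F n w).re| ≤ C)
    (hl : ∀ z ∈ D, Tendsto (fun n => F n z) l (𝓝 (f z))) : TendstoLocallyUniformlyOn F f l D := by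
  rw [Metric.tendstoLocallyUniformlyOn_iff]
  intro e he z hz
  obtain ⟨ε, hε, C, hC, h⟩ := hb z hz
  set δ := min (ε / 2) (e * ε / (40 * C))
  have hδ : 0 < δ := by positivity
  have lip' : ∀ᶠ n in l, ∀ w ∈ ball z δ, ‖F n w - F n z‖ ≤ e / 5 := by
    filter_upwards [h] with n hn w hw
    have hw' : ‖w - z‖ < δ := by simpa [dist_eq_norm] using hw
    refine (bcl hε hC hn.1 hn.2 (hw'.le.trans (min_le_left _ _))).trans ?_
    refine (mul_le_mul_of_nonneg_left (hw'.le.trans (min_le_right _ _)) (by positivity)).trans (le_of_eq ?_)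
    field_simp; norm_num
  have lip : ∀ w ∈ ball z δ, ∀ᶠ n in l, ‖F n w - F n z‖ ≤ e / 5 := fun w hw => lip'.mono fun n h => h w hw
  refine ⟨ball z δ ∩ D, inter_mem (mem_nhdsWithin_of_mem_nhds (ball_mem_nhds z hδ)) self_mem_nhdsWithin, ?_⟩
  have h0 := Metric.tendsto_nhds.1 (hl z hz) (e / 5) (by positivity)
  filter_upwards [lip', h0] with n hn h0n w hw
  have hfw : ‖f w - f z‖ ≤ e / 5 :=
    le_of_tendsto ((hl w hw.2).sub (hl z hz)).norm (lip w hw.1)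
  have h1 := hn w hw.1
  rw [dist_eq_norm] at *
  have e1 : f w - F n w = (f w - f z) - (F n w - F n z) - (F n z - f z) := by ring
  rw [e1]
  have := norm_sub_le ((f w - f z) - (F n w - F n z)) (F n z - f z)
  have := norm_sub_le (f w - f z) (F n w - F n z)
  linarith

lemma ulim {ι : Type*} (U : Ultrafilter ι) {u : ι → ℂ} {C : ℝ} (h : ∀ᶠ n in U, ‖u n‖ ≤ C) : ∃ a, Tendsto u U (𝓝 a) := by
  obtain ⟨a, -, ha⟩ := (isCompact_closedBall (0 : ℂ) C).ultrafilter_le_nhds' (U.map u) (by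
    rw [Ultrafilter.mem_map]; exact mem_of_superset h fun n hn => by simpa using hn)
  exact ⟨a, ha⟩

lemma hurwitz {F : ℕ → ℂ → ℂ} {f : ℂ → ℂ} {l : Filter ℕ} [l.NeBot] {D : Set ℂ} (hD : IsOpen D) (hDc : IsPreconnected D)
    (hF : ∀ᶠ n in l, DifferentiableOn ℂ (F n) D ∧ InjOn (F n) D) (hl : TendstoLocallyUniformlyOn F f l D)
    {p q : ℂ} (hp : p ∈ D) (hq : q ∈ D) (hpq : f p ≠ f q) : InjOn f D := by
  have hf : DifferentiableOn ℂ f D := hl.differentiableOn (hF.mono fun n h => h.1) hD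
  have han := hf.analyticOnNhd hD
  intro a ha b hb hab
  by_contra hne
  have h1 : ∀ᶠ z in 𝓝[≠] a, f z ≠ f a := by
    by_contra h
    simp only [not_eventually, not_not] at h
    have := han.eqOn_of_preconnected_of_frequently_eq (analyticOnNhd_const (v := f a)) hDc ha h
    exact hpq ((this hp).trans (this hq).symm)
  rw [eventually_nhdsWithin_iff] at h1
  obtain ⟨ε, hε, hball⟩ := Metric.eventually_nhds_iff_ball.1 (h1.and (hD.mem_nhds ha))
  set ρ := min (ε / 2) (dist b a / 2)
  have hba : 0 < dist b a := dist_pos.2 (Ne.symm hne)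
  have hρ : 0 < ρ := by positivity
  have hcb : closedBall a ρ ⊆ ball a ε := closedBall_subset_ball ((min_le_left _ _).trans_lt (by linarith))
  have hcD : closedBall a ρ ⊆ D := fun z hz => (hball z (hcb hz)).2
  obtain ⟨z0, hz0, hmin⟩ := (isCompact_sphere a ρ).exists_isMinOn (NormedSpace.sphere_nonempty.2 hρ.le)
    (f := fun z => ‖f z - f a‖) (((hf.continuousOn.mono (sphere_subset_closedBall.trans hcD)).sub continuousOn_const).norm)
  set m := ‖f z0 - f a‖
  have hm : 0 < m := norm_pos_iff.2 (sub_ne_zero.2 ((hball z0 (hcb (sphere_subset_closedBall hz0))).1 (fun h => by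
    rw [h] at hz0; simp at hz0; exact hρ.ne hz0)))
  have hu := Metric.tendstoUniformlyOn_iff.1 ((tendstoLocallyUniformlyOn_iff_forall_isCompact hD).1 hl _ hcD
    (isCompact_closedBall a ρ)) (m / 8) (by positivity)
  have hub := Metric.tendsto_nhds.1 (hl.tendsto_at hb) (m / 8) (by positivity)
  obtain ⟨n, ⟨hn, hi⟩, hun, hbn⟩ := (hF.and (hu.and hub)).exists
  have hsa := hun a (mem_closedBall_self hρ.le)
  rw [dist_eq_norm] at hsa hbn
  have hdiff := hn.mono hcD
  have hsub := DiffContOnCl.ball_subset_image_closedBall (f := F n) (z₀ := a) (r := ρ) (ε := m / 2)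
    ((hn.mono (by rwa [closure_ball a hρ.ne'])).diffContOnCl) hρ (fun z hz => by
      have h2 := hun z (sphere_subset_closedBall hz)
      have h3 : m ≤ ‖f z - f a‖ := hmin hz
      rw [dist_eq_norm] at h2
      have e1 : f z - f a = (f z - F n z) + (F n z - F n a) - (f a - F n a) := by ring
      rw [e1] at h3
      have := norm_sub_le ((f z - F n z) + (F n z - F n a)) (f a - F n a)
      have := norm_add_le (f z - F n z) (F n z - F n a)
      linarith) (by
      have : ∃ᶠ z in 𝓝[≠] a, z ∈ D := Eventually.frequently (mem_nhdsWithin_of_mem_nhds (hD.mem_nhds ha))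
      exact ((this.and_eventually self_mem_nhdsWithin).filter_mono nhdsWithin_le_nhds).mono fun z hz h => hz.2 (hi hz.1 ha h))
  have hbm : F n b ∈ ball (F n a) (m / 2 / 2) := by
    rw [mem_ball, dist_eq_norm]
    have e1 : F n b - F n a = (F n b - f b) + (f a - F n a) := by rw [hab]; ring
    rw [e1]; have := norm_add_le (F n b - f b) (f a - F n a); linarith
  obtain ⟨a', ha', he⟩ := hsub hbm
  rw [hi (hcD ha') hb he, mem_closedBall] at ha'
  have : ρ ≤ dist b a / 2 := min_le_right _ _
  linarith

abbrev DD : Set ℂ := ball 0 1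
def mob (a z : ℂ) : ℂ := (z - a) / (1 - (starRingEnd ℂ) a * z)
lemma mob_den {a z : ℂ} (ha : a ∈ DD) (hz : ‖z‖ ≤ 1) : 1 - (starRingEnd ℂ) a * z ≠ 0 := by
  have ha' : ‖a‖ < 1 := by simpa using ha
  intro h
  have : ‖(starRingEnd ℂ) a * z‖ = 1 := by rw [← sub_eq_zero.1 h]; simp
  rw [norm_mul, RCLike.norm_conj] at this
  nlinarith [norm_nonneg a, norm_nonneg z]
lemma mob_id (a z : ℂ) : ‖1 - (starRingEnd ℂ) a * z‖ ^ 2 - ‖z - a‖ ^ 2 = (1 - ‖a‖ ^ 2) * (1 - ‖z‖ ^ 2) := by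
  simp only [← Complex.normSq_eq_norm_sq, Complex.normSq_apply]; simp; ring
lemma mob_mem {a z : ℂ} (ha : a ∈ DD) (hz : z ∈ DD) : mob a z ∈ DD := by
  have ha' : ‖a‖ < 1 := by simpa using ha
  have hz' : ‖z‖ < 1 := by simpa using hz
  have h1 := mob_id a z
  have h2 : 0 < ‖1 - (starRingEnd ℂ) a * z‖ := norm_pos_iff.2 (mob_den ha hz'.le)
  rw [DD, mem_ball_zero_iff, mob, norm_div, div_lt_one h2]
  have h3 : 0 < (1 - ‖a‖ ^ 2) * (1 - ‖z‖ ^ 2) := by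
    apply mul_pos <;> nlinarith [norm_nonneg a, norm_nonneg z]
  exact lt_of_pow_lt_pow_left₀ 2 h2.le (by linarith)
lemma neg_DD {a : ℂ} (ha : a ∈ DD) : -a ∈ DD := by simpa using ha
lemma mob_inv {a z : ℂ} (ha : a ∈ DD) (hz : z ∈ DD) : mob (-a) (mob a z) = z := by
  have hz' : ‖z‖ ≤ 1 := le_of_lt (by simpa using hz)
  have h1 := mob_den ha hz'
  have h2 := mob_den (neg_DD ha) (le_of_lt (by simpa using mob_mem ha hz) : ‖mob a z‖ ≤ 1)
  rw [mob, div_eq_iff h2]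
  have e : mob a z * (1 - (starRingEnd ℂ) a * z) = z - a := by rw [mob, div_mul_cancel₀ _ h1]
  have h3 : 1 - (starRingEnd ℂ) a * z ≠ 0 := h1
  apply mul_right_cancel₀ h3
  simp only [map_neg]
  linear_combination (1 - z * (starRingEnd ℂ) a) * e
lemma mob_diff {a : ℂ} (ha : a ∈ DD) : DifferentiableOn ℂ (mob a) DD := fun z hz => by
  have := mob_den ha (le_of_lt (by simpa using hz) : ‖z‖ ≤ 1)
  unfold mob
  exact DifferentiableAt.differentiableWithinAt (by fun_prop (disch := assumption))
lemma mob_self (a : ℂ) : mob a a = 0 := by simp [mob]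
lemma mob_inj {a : ℂ} (ha : a ∈ DD) : InjOn (mob a) DD := fun z hz w hw h => by
  rw [← mob_inv ha hz, ← mob_inv ha hw, h]


structure TF (U : Set ℂ) (z0 : ℂ) (f : ℂ → ℂ) : Prop where
  d : DifferentiableOn ℂ f U
  m : MapsTo f U DD
  i : InjOn f U
  z : f z0 = 0

lemma rmt_step {U : Set ℂ} (hU : IsOpen U) (hs : IsSimplyConnected U) {z0 z1 : ℂ} (h0 : z0 ∈ U) (h1 : z1 ∈ U) (h01 : z1 ≠ z0)
    {f : ℂ → ℂ} (hf : TF U z0 f) {w : ℂ} (hw : w ∈ DD) (hwf : w ∉ f '' U) : ∃ F, TF U z0 F ∧ ‖f z1‖ < ‖F z1‖ := by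
  have hd1 : DifferentiableOn ℂ (fun z => mob w (f z)) U := (mob_diff hw).comp hf.d hf.m
  have hn0 : ∀ z ∈ U, mob w (f z) ≠ 0 := fun z hz h => hwf ⟨z, hz, mob_inj hw (hf.m hz) hw (h.trans (mob_self w).symm)⟩
  obtain ⟨g, hgc, hg⟩ := Complex.exists_continuousOn_pow_eq hs hU hd1.continuousOn (by
    rintro ⟨z, hz, h⟩; exact hn0 z hz h) two_ne_zero
  have hg0 : ∀ z ∈ U, g z ≠ 0 := fun z hz h => hn0 z hz (by rw [← hg z, h]; simp)
  have gm : MapsTo g U DD := fun z hz => by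
    have := mob_mem hw (hf.m hz)
    rw [← hg z, DD, mem_ball_zero_iff, norm_pow] at this
    rw [DD, mem_ball_zero_iff]; by_contra! h; nlinarith [norm_nonneg (g z)]
  have gi : InjOn g U := fun a ha b hb hab =>
    hf.i ha hb (mob_inj hw (hf.m ha) (hf.m hb) (by rw [← hg, ← hg, hab]))
  have gd : DifferentiableOn ℂ g U := fun z hz => by
    apply DifferentiableAt.differentiableWithinAt
    have hcont := hgc.continuousAt (hU.mem_nhds hz)
    have hm : HasDerivAt (fun z => mob w (f z)) (deriv (fun z => mob w (f z)) z) z :=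
      (hd1.differentiableAt (hU.mem_nhds hz)).hasDerivAt
    have key : HasDerivAt g (deriv (fun z => mob w (f z)) z / (g z + g z)) z := by
      rw [hasDerivAt_iff_tendsto_slope] at hm ⊢
      have hs : Tendsto (fun x => g x + g z) (𝓝[≠] z) (𝓝 (g z + g z)) :=
        (hcont.tendsto.mono_left nhdsWithin_le_nhds).add tendsto_const_nhds
      have hne : g z + g z ≠ 0 := by rw [← two_mul]; exact mul_ne_zero two_ne_zero (hg0 z hz)
      refine (hm.div hs hne).congr' ?_
      filter_upwards [hs.eventually_ne hne] with x hx
      simp only [Pi.div_apply, slope_def_field, ← hg]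
      rw [div_div, mul_comm, ← div_div]
      congr 1
      rw [div_eq_iff hx]; ring
    exact key.differentiableAt
  set b := g z0
  have hb : b ∈ DD := gm h0
  refine ⟨fun z => mob b (g z), ⟨(mob_diff hb).comp gd gm, fun z hz => mob_mem hb (gm hz),
    fun x hx y hy h => gi hx hy (mob_inj hb (gm hx) (gm hy) h), mob_self b⟩, ?_⟩
  set s : ℂ → ℂ := fun u => mob (-w) (mob (-b) u ^ 2) with hsd
  have sqm : MapsTo (fun u : ℂ => mob (-b) u ^ 2) DD DD := fun u hu => by
    have := mob_mem (neg_DD hb) hu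
    rw [DD, mem_ball_zero_iff] at this ⊢
    rw [norm_pow]; nlinarith [norm_nonneg (mob (-b) u)]
  have sd : DifferentiableOn ℂ s DD := (mob_diff (neg_DD hw)).comp ((mob_diff (neg_DD hb)).pow 2) sqm
  have sm : MapsTo s DD DD := fun u hu => mob_mem (neg_DD hw) (sqm hu)
  have sf : ∀ z ∈ U, s (mob b (g z)) = f z := fun z hz => by
    simp only [hsd]; rw [mob_inv hb (gm hz), hg, mob_inv hw (hf.m hz)]
  have s0 : s 0 = 0 := by rw [← mob_self b, sf z0 h0, hf.z, mob_self]
  set u := mob b (g z1)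
  have hu : u ∈ DD := mob_mem hb (gm h1)
  have hu0 : u ≠ 0 := fun h => h01 (gi h1 h0 (mob_inj hb (gm h1) hb (h.trans (mob_self b).symm)))
  rw [← sf z1 h1]
  have hsm : MapsTo s (ball 0 1) (closedBall (s 0) 1) := fun x hx => by
    rw [s0]; exact ball_subset_closedBall (sm hx)
  have hle := Complex.dist_le_div_mul_dist_of_mapsTo_ball sd hsm hu
  simp only [s0, dist_zero_right, div_one, one_mul] at hle
  refine hle.lt_of_ne fun heq => ?_
  have hnd : ‖dslope s 0 u‖ = 1 / 1 := by
    rw [dslope_of_ne _ hu0, slope_def_field, s0, sub_zero, sub_zero, norm_div, heq]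
    simpa using hu0
  have haff := Complex.affine_of_mapsTo_ball_of_norm_dslope_eq_div sd hsm hu hnd
  have hc0 : dslope s 0 u ≠ 0 := fun h => by rw [h] at hnd; simp at hnd
  have si : InjOn s DD := fun x hx y hy h => by
    rw [haff hx, haff hy] at h; simpa [hc0] using h
  have q : ∀ c : ℂ, c ∈ DD → s (mob b c) = mob (-w) (c ^ 2) := fun c hc => by
    simp only [hsd]; rw [mob_inv hb hc]
  have p1 : (1 / 2 : ℂ) ∈ DD := by simp; norm_num
  have p2 := neg_DD p1
  have h3 : s (mob b (1 / 2)) = s (mob b (-(1 / 2))) := by rw [q _ p1, q _ p2]; simp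
  have h4 := mob_inj hb p1 p2 (si (mob_mem hb p1) (mob_mem hb p2) h3)
  norm_num at h4

theorem rmt {U : Set ℂ} (hU : IsOpen U) (hs : IsSimplyConnected U) {z0 z1 : ℂ} (h0 : z0 ∈ U) (h1 : z1 ∈ U) (h01 : z1 ≠ z0)
    {f0 : ℂ → ℂ} (hd0 : DifferentiableOn ℂ f0 U) (hm0 : MapsTo f0 U DD) (hi0 : InjOn f0 U) :
    ∃ F : ℂ → ℂ, DifferentiableOn ℂ F U ∧ InjOn F U ∧ F '' U = DD := by
  have hpc : IsPreconnected U := hs.isPathConnected.isConnected.isPreconnected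
  set f1 := fun z => mob (f0 z0) (f0 z)
  have ha := hm0 h0
  have hf1 : TF U z0 f1 := ⟨(mob_diff ha).comp hd0 hm0, fun z hz => mob_mem ha (hm0 hz),
    fun x hx y hy h => hi0 hx hy (mob_inj ha (hm0 hx) (hm0 hy) h), mob_self _⟩
  set V : Set ℝ := {t | ∃ f, TF U z0 f ∧ t = ‖f z1‖}
  have hVb : BddAbove V := ⟨1, by rintro _ ⟨f, hf, rfl⟩; have := hf.m h1; exact le_of_lt (by simpa using this)⟩
  have hVn : V.Nonempty := ⟨_, f1, hf1, rfl⟩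
  obtain ⟨t, -, htt, htV⟩ := exists_seq_tendsto_sSup hVn hVb
  choose f hf hft using htV
  set W : Ultrafilter ℕ := hyperfilter ℕ
  have hW : (W : Filter ℕ) ≤ atTop := Nat.hyperfilter_le_atTop
  have hbd : ∀ n, ∀ z ∈ U, ‖f n z‖ ≤ 1 := fun n z hz => le_of_lt (by simpa using (hf n).m hz)
  have hlim : ∀ z, ∃ a, z ∈ U → Tendsto (fun n => f n z) W (𝓝 a) := fun z => by
    by_cases hz : z ∈ U
    · obtain ⟨a, ha⟩ := ulim W (u := fun n => f n z) (C := 1) (Eventually.of_forall fun n => hbd n z hz)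
      exact ⟨a, fun _ => ha⟩
    · exact ⟨0, fun h => (hz h).elim⟩
  choose g hg using hlim
  have htl : TendstoLocallyUniformlyOn f g W U := tlu (fun z hz => by
    obtain ⟨ε, hε, hb⟩ := Metric.isOpen_iff.1 hU z hz
    exact ⟨ε, hε, 1, one_pos, Eventually.of_forall fun n => ⟨(hf n).d.mono hb, fun w hw =>
      (Complex.abs_re_le_norm _).trans (hbd n w (hb hw))⟩⟩) hg
  have hgd : DifferentiableOn ℂ g U := htl.differentiableOn (Eventually.of_forall fun n => (hf n).d) hU
  have g0 : g z0 = 0 := tendsto_nhds_unique (hg z0 h0) (by simp only [(hf _).z]; exact tendsto_const_nhds)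
  have g1 : ‖g z1‖ = sSup V := tendsto_nhds_unique (hg z1 h1).norm (by simp only [← hft]; exact htt.mono_left hW)
  have hpos : 0 < ‖g z1‖ := by
    rw [g1]
    refine lt_of_lt_of_le ?_ (le_csSup hVb ⟨f1, hf1, rfl⟩)
    exact norm_pos_iff.2 fun h => h01 (hf1.i h1 h0 (h.trans hf1.z.symm))
  have gi : InjOn g U := hurwitz hU hpc (Eventually.of_forall fun n => ⟨(hf n).d, (hf n).i⟩) htl h1 h0 (by
    rw [g0]; exact norm_pos_iff.1 hpos)
  have hgo : IsOpen (g '' U) := (inv_hol hU hgd fun z hz => gi.leftInvOn_invFunOn hz).1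
  have hgm : g '' U ⊆ DD := by
    have : g '' U ⊆ interior (closedBall 0 1) := interior_maximal (by
      rintro _ ⟨z, hz, rfl⟩
      simpa using le_of_tendsto (hg z hz).norm (Eventually.of_forall fun n => hbd n z hz)) hgo
    rwa [interior_closedBall _ one_ne_zero] at this
  have hgT : TF U z0 g := ⟨hgd, fun z hz => hgm ⟨z, hz, rfl⟩, gi, g0⟩
  refine ⟨g, hgd, gi, hgm.antisymm fun w hw => ?_⟩
  by_contra hwf
  obtain ⟨F, hF, hlt⟩ := rmt_step hU hs h0 h1 h01 hgT hw hwf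
  have := le_csSup hVb ⟨F, hF, rfl⟩
  linarith

lemma autD0 {f g : ℂ → ℂ} (hf : DifferentiableOn ℂ f DD) (hg : DifferentiableOn ℂ g DD) (mf : MapsTo f DD DD)
    (mg : MapsTo g DD DD) (gf : ∀ z ∈ DD, g (f z) = z) (f0 : f 0 = 0) : ∃ c : ℂ, ‖c‖ = 1 ∧ ∀ z ∈ DD, f z = c * z := by
  have z0 : (0 : ℂ) ∈ DD := by simp
  have g0 : g 0 = 0 := by have := gf 0 z0; rwa [f0] at this
  have b : ∀ {f : ℂ → ℂ}, DifferentiableOn ℂ f DD → MapsTo f DD DD → f 0 = 0 → ∀ z ∈ DD, ‖f z‖ ≤ ‖z‖ :=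
    fun hd hm h0 z hz => by
      have := Complex.dist_le_dist_of_mapsTo_ball hd (by rw [h0]; exact hm.mono_right ball_subset_closedBall) hz
      simpa [h0] using this
  have hh : (1 / 2 : ℂ) ∈ DD := by simp; norm_num
  have e : ‖f (1 / 2)‖ = ‖(1 / 2 : ℂ)‖ := (b hf mf f0 _ hh).antisymm (by
    have := b hg mg g0 _ (mf hh); rwa [gf _ hh] at this)
  have hnd : ‖dslope f 0 (1 / 2)‖ = 1 / 1 := by
    rw [dslope_of_ne _ (by norm_num), slope_def_field, f0, sub_zero, sub_zero, norm_div, e]; norm_num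
  have := Complex.affine_of_mapsTo_ball_of_norm_dslope_eq_div hf (by
    rw [f0]; exact mf.mono_right ball_subset_closedBall) hh hnd
  refine ⟨dslope f 0 (1 / 2), by simpa using hnd, fun z hz => ?_⟩
  rw [this hz, f0]; simp [mul_comm]

abbrev RH : Set ℂ := {z | 0 < z.re}

/-- a fixed point free automorphism of the disc is conjugate to an affine map -/
lemma deck {f g : ℂ → ℂ} (hf : DifferentiableOn ℂ f DD) (hg : DifferentiableOn ℂ g DD) (mf : MapsTo f DD DD)
    (mg : MapsTo g DD DD) (gf : ∀ z ∈ DD, g (f z) = z) (fg : ∀ z ∈ DD, f (g z) = z) (hfix : ∀ z ∈ DD, f z ≠ z) :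
    ∃ p : ℂ, ‖p‖ = 1 ∧ ∃ Λ ν : ℂ, Λ ≠ 0 ∧ ∀ z ∈ DD, (p + f z) / (p - f z) = Λ * ((p + z) / (p - z)) + ν := by
  have z0 : (0 : ℂ) ∈ DD := by simp
  set β := f 0
  have hβ : β ∈ DD := mf z0
  have hβ0 : β ≠ 0 := hfix 0 z0
  obtain ⟨c, hc, hcz⟩ := autD0 (f := fun z => mob β (f z)) (g := fun z => g (mob (-β) z)) ((mob_diff hβ).comp hf mf)
    (hg.comp (mob_diff (neg_DD hβ)) fun z hz => mob_mem (neg_DD hβ) hz) (fun z hz => mob_mem hβ (mf hz))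
    (fun z hz => mg (mob_mem (neg_DD hβ) hz)) (fun z hz => by rw [mob_inv hβ (mf hz), gf z hz]) (mob_self β)
  have hc0 : c ≠ 0 := by rintro rfl; simp at hc
  set β' := (starRingEnd ℂ) β
  have hβ'0 : β' ≠ 0 := by simpa [β'] using hβ0
  have czD : ∀ z ∈ DD, ‖c * z‖ ≤ 1 := fun z hz => by rw [norm_mul, hc, one_mul]; exact le_of_lt (by simpa using hz)
  have den : ∀ z : ℂ, ‖z‖ ≤ 1 → 1 + β' * (c * z) ≠ 0 := fun z hz => by
    have := mob_den (neg_DD hβ) (z := c * z) (by rwa [norm_mul, hc, one_mul])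
    simpa [β'] using this
  have fz : ∀ z ∈ DD, f z * (1 + β' * (c * z)) = c * z + β := fun z hz => by
    have h1 := congrArg (mob (-β)) (hcz z hz)
    rw [mob_inv hβ (mf hz)] at h1
    have h2 := den z (le_of_lt (by simpa using hz))
    rw [h1, mob, div_mul_eq_mul_div, div_eq_iff] <;> simp [β'] <;> simpa [β'] using h2
  obtain ⟨p, hp⟩ := exists_quadratic_eq_zero (a := β' * c) (b := 1 - c) (c := -β) (mul_ne_zero hβ'0 hc0)
    (by obtain ⟨s, hs⟩ := IsAlgClosed.exists_pow_nat_eq (discrim (β' * c) (1 - c) (-β)) two_pos; exact ⟨s, by rw [← hs]; ring⟩)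
  set q := -(1 - c) / (β' * c) - p with hqd
  have hbc : β' * c ≠ 0 := mul_ne_zero hβ'0 hc0
  have hq1 : β' * c * (q + p) = -(1 - c) := by rw [hqd]; field_simp; ring
  have hq : β' * c * (q * q) + (1 - c) * q + -β = 0 := by linear_combination hp + (q - p) * hq1
  have hpq : β' * c * (p * q) = -β := by linear_combination p * hq1 - hp
  have hnpq : ‖p‖ * ‖q‖ = 1 := by
    have := congrArg norm hpq
    simp only [norm_mul, norm_neg, hc, mul_one, β', RCLike.norm_conj] at this
    exact mul_left_cancel₀ (norm_ne_zero_iff.2 hβ0) (by rw [this, mul_one])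
  have root : ∀ u : ℂ, β' * c * (u * u) + (1 - c) * u + -β = 0 → 1 ≤ ‖u‖ := fun u hu => by
    by_contra! h
    have huD : u ∈ DD := by simpa using h
    have h1 := fz u huD
    refine hfix u huD (mul_right_cancel₀ (den u h.le) (h1.trans ?_))
    linear_combination -hu
  have hp1 := root p hp; have hq1' := root q hq
  have hpn : ‖p‖ = 1 := by nlinarith
  set N := 1 - β * β' with hN
  have hN0 : N ≠ 0 := by
    rw [hN, Complex.mul_conj]; intro h
    have h2 : Complex.normSq β = 1 := by exact_mod_cast (sub_eq_zero.1 h).symm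
    have h3 : ‖β‖ < 1 := by simpa using hβ
    rw [Complex.normSq_eq_norm_sq] at h2; nlinarith [norm_nonneg β]
  set E := 1 + β' * (c * p)
  have hE : E ≠ 0 := den p hpn.le
  refine ⟨p, hpn, E ^ 2 / (c * N), E ^ 2 / (c * N) - 1 - 2 * p * E * β' / N, div_ne_zero (pow_ne_zero _ hE) (mul_ne_zero hc0 hN0), fun z hz => ?_⟩
  have hz1 : ‖z‖ < 1 := by simpa using hz
  have hfz1 : ‖f z‖ < 1 := by simpa using mf hz
  have e1 : p - z ≠ 0 := fun h => by rw [← sub_eq_zero.1 h] at hz1; linarith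
  have e2 : p - f z ≠ 0 := fun h => by rw [← sub_eq_zero.1 h] at hfz1; linarith
  have h1 := fz z hz
  have e3 := den z hz1.le
  have h2 : (p - f z) * (E * (1 + β' * (c * z))) = c * N * (p - z) := by
    have hpE : p * E = c * p + β := by simp only [E]; linear_combination hp
    linear_combination (1 + β' * (c * z)) * hpE - E * h1
  have h3 : (p + f z) / (p - f z) = 2 * p / (p - f z) - 1 := by field_simp; ring
  have h4 : 1 / (p - f z) = E * (1 + β' * (c * z)) / (c * N * (p - z)) := by
    rw [div_eq_div_iff e2 (mul_ne_zero (mul_ne_zero hc0 hN0) e1), one_mul, ← h2]; ring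
  have h6 : 2 * p / (p - f z) = 2 * p * (1 / (p - f z)) := by ring
  rw [h3, h6, h4]
  have h5 : 1 + β' * (c * z) = E - β' * c * (p - z) := by simp only [E]; ring
  rw [h5]; field_simp; ring

lemma aff_RH {Λ ν : ℂ} (h0 : Λ ≠ 0) (h1 : ∀ z ∈ RH, Λ * z + ν ∈ RH) (h2 : ∀ z ∈ RH, (z - ν) / Λ ∈ RH) :
    0 < Λ.re ∧ Λ.im = 0 ∧ ν.re = 0 := by
  have key : ∀ a b e : ℝ, (∀ x y : ℝ, 0 < x → 0 < a * x - b * y + e) → b = 0 ∧ 0 ≤ a ∧ 0 ≤ e := by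
    intro a b e h
    have hb : b = 0 := by
      by_contra hb
      have := h 1 ((a + e) / b) one_pos
      rw [mul_div_cancel₀ _ hb] at this; linarith
    subst hb
    refine ⟨rfl, ?_, ?_⟩
    · by_contra! ha
      have := h ((|e| + 1) / -a) 0 (by have := neg_pos.2 ha; positivity)
      have e1 : a * ((|e| + 1) / -a) = -(|e| + 1) := by have := ha.ne; field_simp
      rw [e1] at this; linarith [le_abs_self e]
    · by_contra! he
      have := h (-e / (2 * (|a| + 1))) 0 (by have := neg_pos.2 he; positivity)
      have e1 : a * (-e / (2 * (|a| + 1))) ≤ |a| * (-e / (2 * (|a| + 1))) :=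
        mul_le_mul_of_nonneg_right (le_abs_self a) (by have := neg_pos.2 he; positivity)
      have e2 : |a| * (-e / (2 * (|a| + 1))) ≤ -e / 2 := by
        rw [← mul_div_assoc, div_le_div_iff₀ (by positivity) two_pos]
        nlinarith [abs_nonneg a]
      linarith
  obtain ⟨hb, ha, he⟩ := key Λ.re Λ.im ν.re fun x y hx => by
    have := h1 ⟨x, y⟩ hx; simpa [RH] using this
  have hre : 0 < Λ.re := ha.lt_of_ne fun h => h0 (Complex.ext h.symm hb)
  refine ⟨hre, hb, le_antisymm ?_ he⟩
  have hΛ : Λ = (Λ.re : ℂ) := Complex.ext rfl hb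
  obtain ⟨-, -, he'⟩ := key (1 / Λ.re) 0 (-ν.re / Λ.re) fun x y hx => by
    have := h2 ⟨x, y⟩ hx
    rw [hΛ] at this
    simp only [RH, Set.mem_ofPred_eq, Complex.div_ofReal_re, Complex.sub_re] at this
    have e : 1 / Λ.re * x - 0 * y + -ν.re / Λ.re = (x - ν.re) / Λ.re := by ring
    rwa [e]
  by_contra! h
  have := div_neg_of_neg_of_pos (neg_neg_of_pos h) hre
  linarith

lemma Mmap {p : ℂ} (hp : ‖p‖ = 1) : (∀ z ∈ DD, (p + z) / (p - z) ∈ RH) ∧ (∀ u ∈ RH, p * (u - 1) / (u + 1) ∈ DD) ∧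
    (∀ z ∈ DD, p - z ≠ 0) ∧ (∀ u ∈ RH, u + 1 ≠ 0) ∧ (∀ z ∈ DD, p * ((p + z) / (p - z) - 1) / ((p + z) / (p - z) + 1) = z) ∧
    (∀ u ∈ RH, (p + p * (u - 1) / (u + 1)) / (p - p * (u - 1) / (u + 1)) = u) := by
  have hp0 : p ≠ 0 := by rintro rfl; simp at hp
  have e1 : ∀ z ∈ DD, p - z ≠ 0 := fun z hz h => by
    rw [← sub_eq_zero.1 h] at hz; simp [hp] at hz
  have e2 : ∀ u ∈ RH, u + 1 ≠ 0 := fun u hu h => by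
    have := congrArg Complex.re h; simp [RH] at this hu; linarith
  refine ⟨fun z hz => ?_, fun u hu => ?_, e1, e2, fun z hz => ?_, fun u hu => ?_⟩
  · have h1 := Complex.normSq_pos.2 (e1 z hz)
    have hz1 : ‖z‖ < 1 := by simpa using hz
    have h3 : Complex.normSq z < 1 := by rw [Complex.normSq_eq_norm_sq]; nlinarith [norm_nonneg z]
    have h4 : Complex.normSq p = 1 := by rw [Complex.normSq_eq_norm_sq, hp]; norm_num
    simp only [RH, Set.mem_ofPred_eq, Complex.div_re, ← add_div]
    refine div_pos ?_ h1
    simp only [Complex.normSq_apply] at h3 h4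
    simp; nlinarith
  · have := norm_pos_iff.2 (e2 u hu)
    have hu' : 0 < u.re := hu
    rw [mem_ball_zero_iff, norm_div, norm_mul, hp, one_mul, div_lt_one this]
    refine lt_of_pow_lt_pow_left₀ 2 this.le ?_
    rw [← Complex.normSq_eq_norm_sq, ← Complex.normSq_eq_norm_sq, Complex.normSq_apply, Complex.normSq_apply]
    simp; nlinarith
  · have := e1 z hz; field_simp; ring_nf; field_simp
  · have := e2 u hu;
    have h2 : p - p * (u - 1) / (u + 1) = 2 * p / (u + 1) := by field_simp; ring
    rw [h2]; field_simp; ring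

lemma exist1 (hφ : IsLift φ) (hr : 0 < r) : ∃ H Φ : ℂ → ℂ, DifferentiableOn ℂ Φ RH ∧ MapsTo H (φ '' St (-r) r) RH ∧
    MapsTo Φ RH (φ '' St (-r) r) ∧ (∀ w ∈ φ '' St (-r) r, Φ (H w) = w) ∧ (∀ u ∈ RH, H (Φ u) = u) ∧
    ContinuousOn H (φ '' St (-r) r) ∧
    ∃ Λ ν : ℂ, Λ ≠ 0 ∧ ∀ w ∈ φ '' St (-r) r, H (w + TP) = Λ * H w + ν := by
  set Ω := φ '' St (-r) r
  have hU : IsOpen Ω := φ.isOpenMap _ (St_open _ _)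
  have hne : (St (-r) r).Nonempty := ⟨0, by simp [hr]⟩
  have hs : IsSimplyConnected Ω := by
    have : ContractibleSpace (St (-r) r) := (St_convex _ _).contractibleSpace hne
    have : ContractibleSpace Ω := (φ.image (St (-r) r)).symm.contractibleSpace
    have : SimplyConnectedSpace Ω := inferInstance
    exact this
  obtain ⟨R, hR, hb⟩ := hφ.bdd r
  have hbΩ : ∀ w ∈ Ω, |w.re| ≤ R := by rintro _ ⟨w, hw, rfl⟩; exact hb _ (St_sub _ _ hw)
  have hT : ∀ w, w + TP ∈ Ω ↔ w ∈ Ω := fun w => by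
    rw [TP_eq]; constructor
    · rintro ⟨v, hv, h⟩; refine ⟨v + vi (-(2 * π)), by simpa using hv, ?_⟩
      have := hφ.per' (v + vi (-(2 * π)))
      rw [add_assoc, ← vi_add] at this; simp [vi] at this
      rw [h] at this; simp [vi] at this ⊢; exact this.symm
    · rintro ⟨v, hv, rfl⟩; exact ⟨v + vi (2 * π), by simpa using hv, hφ.per' v⟩
  have hden : ∀ z ∈ Ω, 2 ≤ (z + (R + 2 : ℝ)).re := fun z hz => by
    have := neg_le_of_abs_le (hbΩ z hz); simp; linarith
  have hden0 : ∀ z ∈ Ω, z + (R + 2 : ℝ) ≠ 0 := fun z hz h => by have := hden z hz; rw [h] at this; norm_num at this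
  obtain ⟨F, hF, iF, sF⟩ := rmt hU hs (z0 := φ 0) (z1 := φ (r / 2 : ℝ)) ⟨0, by simp [hr], rfl⟩
    ⟨_, by simp only [mem_preimage, Complex.ofReal_re, mem_Ioo]; constructor <;> linarith, rfl⟩ (by simp [hr.ne']) (f0 := fun z => 1 / (z + (R + 2 : ℝ)))
    ((differentiableOn_const _).div (by fun_prop) hden0) (fun z hz => by
      have := (hden z hz).trans (Complex.re_le_norm _)
      rw [mem_ball_zero_iff, norm_div, norm_one, div_lt_one] <;> linarith)
    (fun a ha b hb hab => by
      have := hden0 a ha; have := hden0 b hb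
      have h : 1 / (a + (R + 2 : ℝ)) = 1 / (b + (R + 2 : ℝ)) := hab
      rw [one_div, one_div, inv_inj] at h; exact add_right_cancel h)
  set G := Function.invFunOn F Ω
  have hGF : ∀ z ∈ Ω, G (F z) = z := iF.leftInvOn_invFunOn
  obtain ⟨-, hG⟩ := inv_hol hU hF hGF
  rw [sF] at hG
  have mF : MapsTo F Ω DD := fun z hz => sF ▸ mem_image_of_mem _ hz
  have hGm : ∀ z ∈ DD, G z ∈ Ω ∧ F (G z) = z := fun z hz => by
    rw [← sF] at hz; exact ⟨Function.invFunOn_mem hz, Function.invFunOn_eq hz⟩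
  have hT' : ∀ w ∈ Ω, w - TP ∈ Ω := fun w hw => (hT _).1 (by simpa)
  obtain ⟨p, hp, Λ, ν, hΛ, hd⟩ := deck (f := fun z => F (G z + TP)) (g := fun z => F (G z - TP))
    (hF.comp (hG.add_const _) fun z hz => (hT _).2 (hGm z hz).1)
    (hF.comp (hG.sub_const _) fun z hz => hT' _ (hGm z hz).1)
    (fun z hz => mF ((hT _).2 (hGm z hz).1)) (fun z hz => mF (hT' _ (hGm z hz).1))
    (fun z hz => by rw [hGF _ ((hT _).2 (hGm z hz).1), add_sub_cancel_right, (hGm z hz).2])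
    (fun z hz => by rw [hGF _ (hT' _ (hGm z hz).1), sub_add_cancel, (hGm z hz).2])
    (fun z hz h => by
      have h1 := congrArg G h
      simp only [hGF _ ((hT _).2 (hGm z hz).1)] at h1
      have := congrArg Complex.im h1; simp [Real.pi_ne_zero] at this)
  obtain ⟨m1, m2, m3, m4, m5, m6⟩ := Mmap hp
  refine ⟨fun w => (p + F w) / (p - F w), fun u => G (p * (u - 1) / (u + 1)), hG.comp ?_ m2, fun w hw => m1 _ (mF hw),
    fun u hu => (hGm _ (m2 u hu)).1, fun w hw => by beta_reduce; rw [m5 _ (mF hw), hGF _ hw], fun u hu => by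
      beta_reduce; rw [(hGm _ (m2 u hu)).2, m6 u hu], ?_, Λ, ν, hΛ, fun w hw => ?_⟩
  · exact DifferentiableOn.div (by fun_prop) (by fun_prop) m4
  · exact ContinuousOn.div (continuousOn_const.add hF.continuousOn) (continuousOn_const.sub hF.continuousOn) fun w hw => m3 _ (mF hw)
  · have := hd _ (mF hw); rwa [hGF _ hw] at this

theorem exist (hφ : IsLift φ) (hr : 0 < r) : ∃ ℓ K h, CU φ r ℓ K h := by
  obtain ⟨H, Φ, dΦ, mH, mΦ, hΦH, hHΦ, cH, Λ, ν, hΛ, hp⟩ := exist1 hφ hr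
  have hT : ∀ w ∈ φ '' St (-r) r, w + TP ∈ φ '' St (-r) r ∧ w - TP ∈ φ '' St (-r) r := by
    rintro _ ⟨v, hv, rfl⟩; refine ⟨⟨v + TP, by simpa using hv, hφ.per v⟩, ⟨v - TP, by simpa using hv, ?_⟩⟩
    have := hφ.per (v - TP); rw [sub_add_cancel] at this; rw [this]; ring
  obtain ⟨hl, hl', hν⟩ := aff_RH hΛ (fun z hz => by
    have := mH (hT _ (mΦ hz)).1; rwa [hp _ (mΦ hz), hHΦ z hz] at this) (fun z hz => by
    have h1 := (hT _ (mΦ hz)).2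
    have h2 := hp _ h1
    rw [sub_add_cancel, hHΦ z hz] at h2
    have h3 : (z - ν) / Λ = H (Φ z - TP) := by rw [div_eq_iff hΛ]; linear_combination h2
    rw [h3]; exact mH h1)
  set l := Λ.re
  have el : Λ = (l : ℂ) := Complex.ext rfl hl'
  by_cases h1 : l = 1
  · exfalso
    rw [el, h1] at hp
    obtain ⟨R, hR, hb⟩ := hφ.bdd r
    set X := 8 * R * ‖ν‖ + 2 * ‖ν‖ + 1
    have hX : 0 < X := by positivity
    have hsub : ball (X : ℂ) X ⊆ RH := fun z hz => by
      have h2 := (Complex.abs_re_le_norm _).trans_lt (mem_ball_iff_norm.1 hz)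
      rw [abs_lt] at h2; simp at h2; exact h2.1
    have hXm : (X : ℂ) ∈ RH := hsub (mem_ball_self hX)
    have := bcl (w := X + ν) hX hR (dΦ.mono hsub) (fun w hw => by
      obtain ⟨v, hv, he⟩ := mΦ (hsub hw)
      rw [← he]; exact hb _ (St_sub _ _ hv)) (by
        simp only [X, add_sub_cancel_left]; nlinarith [norm_nonneg ν, mul_nonneg hR.le (norm_nonneg ν)])
    have h2 : Φ (X + ν) = Φ X + TP := by
      have h3 := hp _ (mΦ hXm)
      rw [hHΦ _ hXm] at h3
      rw [← hΦH _ (hT _ (mΦ hXm)).1, h3]; simp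
    rw [h2, add_sub_cancel_left, add_sub_cancel_left, TP_eq, norm_vi, div_mul_eq_mul_div, le_div_iff₀ hX,
      abs_of_pos Real.two_pi_pos] at this
    nlinarith [Real.pi_gt_three, norm_nonneg ν, mul_nonneg hR.le (norm_nonneg ν)]
  · have hl1 : (1 - l : ℂ) ≠ 0 := fun h => h1 (by exact_mod_cast (sub_eq_zero.1 h).symm)
    set κ : ℂ := ν / (1 - l)
    have hκ : κ.re = 0 := by
      have : κ = ν / ((1 - l : ℝ) : ℂ) := by simp [κ]
      rw [this, Complex.div_ofReal_re, hν, zero_div]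
    have hsl : ∀ u ∈ RH, u - κ ∈ Complex.slitPlane := fun u hu => Or.inl (by simpa [hκ] using hu)
    set g : ℂ → ℂ := fun w => Complex.I * Complex.log (H w - κ) / π + 1 / 2
    set E : ℂ → ℂ := fun z => Complex.exp (-Complex.I * π * (z - 1 / 2)) + κ
    have hpi := Real.pi_pos
    have hpc : (π : ℂ) ≠ 0 := by exact_mod_cast hpi.ne'
    have eim : ∀ z : ℂ, (-Complex.I * π * (z - 1 / 2)).im = -(π * (z.re - 1 / 2)) := fun z => by simp
    have mE : MapsTo E A RH := fun z hz => by
      simp only [mem_preimage, mem_Ioo] at hz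
      simp only [RH, E, Set.mem_ofPred_eq, Complex.add_re, hκ, add_zero, Complex.exp_re, eim]
      refine mul_pos (Real.exp_pos _) (Real.cos_pos_of_mem_Ioo ⟨?_, ?_⟩) <;> nlinarith
    have gm : ∀ w ∈ φ '' St (-r) r, g w ∈ A := fun w hw => by
      have h0 : 0 < (H w - κ).re := by simpa [hκ] using mH hw
      have h2 := Complex.abs_arg_lt_pi_div_two_iff.2 (Or.inl h0)
      rw [abs_lt] at h2
      have e : (g w).re = 1 / 2 - (H w - κ).arg / π := by
        have : g w = Complex.I * Complex.log (H w - κ) * ((1 / π : ℝ) : ℂ) + ((1 / 2 : ℝ) : ℂ) := by simp [g]; ring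
        rw [this]; simp [Complex.log_im]; ring
      have h3 : (H w - κ).arg / π < 1 / 2 := by rw [div_lt_iff₀ hpi]; linarith
      have h4 : -(1 / 2) < (H w - κ).arg / π := by rw [lt_div_iff₀ hpi]; linarith
      simp only [mem_preimage, mem_Ioo, e]; constructor <;> linarith
    have Eg : ∀ w ∈ φ '' St (-r) r, Φ (E (g w)) = w := fun w hw => by
      have e : -Complex.I * π * (g w - 1 / 2) = Complex.log (H w - κ) := by
        simp only [g]; field_simp; ring_nf; simp
      simp only [E, e]
      rw [Complex.exp_log (Complex.slitPlane_ne_zero (hsl _ (mH hw))), sub_add_cancel, hΦH w hw]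
    have gE : ∀ z ∈ A, g (Φ (E z)) = z := fun z hz => by
      simp only [g, hHΦ _ (mE hz)]
      simp only [E, add_sub_cancel_right]
      simp only [mem_preimage, mem_Ioo] at hz
      rw [Complex.log_exp]
      · field_simp; ring_nf; simp
      · rw [eim]; nlinarith
      · rw [eim]; nlinarith
    have gp : ∀ w ∈ φ '' St (-r) r, g (w + TP) = g w + vi (Real.log l / π) := fun w hw => by
      have e : H (w + TP) - κ = l * (H w - κ) := by
        rw [hp w hw, el]; simp only [κ]; field_simp; ring
      simp only [g, e]
      rw [Complex.log_ofReal_mul hl (Complex.slitPlane_ne_zero (hsl _ (mH hw)))]; simp [vi]; ring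
    have hll : Real.log l ≠ 0 := by
      intro h; rcases Real.log_eq_zero.1 h with h | h | h <;> first | exact h1 h | linarith
    refine ⟨|Real.log l| / π, OU.ext (s := SignType.sign (Real.log l)) (K := fun z => φ.symm (Φ (E z))) (h := fun w => g (φ w)) ?_ hφ⟩
    have mm : ∀ z ∈ A, φ.symm (Φ (E z)) ∈ St (-r) r := fun z hz => by
      obtain ⟨v, hv, e⟩ := mΦ (mE hz); rw [← e]; simpa using hv
    have dE : DifferentiableOn ℂ (fun z => Φ (E z)) A := dΦ.comp (by fun_prop) mE
    refine ⟨hr, by positivity, ?_, mm, fun w hw => gm _ ⟨w, hw, rfl⟩, fun w hw => ?_, fun z hz => by simpa using gE z hz,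
      φ.symm.continuous.comp_continuousOn dE.continuousOn, ?_, fun z hz => ?_, by simpa using dE, hφ.per⟩
    · rcases lt_or_gt_of_ne hll with h | h
      · right; simp [h]
      · left; simp [h]
    · simp only [Eg _ (mem_image_of_mem _ hw)]; simp
    · have : ContinuousOn g (φ '' St (-r) r) := by
        refine ((continuousOn_const.mul (ContinuousOn.clog (cH.sub continuousOn_const) fun w hw => hsl _ (mH hw))).div_const _).add continuousOn_const
      exact this.comp φ.continuous.continuousOn fun w hw => ⟨w, hw, rfl⟩
    · have hw := mΦ (mE hz); have ez := gE z hz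
      set w := Φ (E z)
      have gp1 := gp w hw; have gp2 := gp _ (hT w hw).2
      rw [sub_add_cancel, ez] at gp2
      rw [ez] at gp1
      rcases lt_or_gt_of_ne hll with h | h
      · have : z + vi (|Real.log l| / π) = g (w - TP) := by
          rw [gp2, abs_of_neg h]; simp [vi]; ring
        simp only [this, Eg _ (hT w hw).2]
        have h5 := hφ.sper (w - TP)
        rw [← TP_eq, sub_add_cancel] at h5
        rw [h5, TP_eq]; simp [h, vi]
      · have : z + vi (|Real.log l| / π) = g (w + TP) := by rw [gp1, abs_of_pos h]
        simp only [this, Eg _ (hT w hw).1]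
        rw [TP_eq, hφ.sper]; simp [h]

def Lw (c s : ℝ) : ℝ := c * s + (1 - c) * max 0 (4 * s - 3)
def mu (r c w a x : ℝ) : ℝ := max (Lw c ((r + x) / (2 * r))) (min (1 - Lw (1 - c) ((r - x) / (2 * r))) (c + (x - a) / w))
def cc (h : ℂ → ℂ) : ℝ := ((h 0).re + (h (vi π)).re) / 2
def mm (ℓ : ℝ) (h : ℂ → ℂ) : ℝ := ((h 0).im + (h (vi π)).im) / 2 - ℓ / 4
def l0 (r x : ℝ) : ℝ := max 0 (min 1 (r - 1 - |x|))
def wv (r : ℝ) (h : ℂ → ℂ) (x y : ℝ) : ℝ := (r - x) / (2 * r) * (h ((-r : ℝ) + vi y)).im + (r + x) / (2 * r) * (h ((r : ℝ) + vi y)).im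
def vv (r ℓ : ℝ) (h : ℂ → ℂ) (x y : ℝ) : ℝ := (1 - l0 r x) * wv r h x y + l0 r x * (ℓ / (2 * π) * y + mm ℓ h)
def aa (φ : ℂ ≃ₜ ℂ) : ℝ := ((φ 0).re + (φ (vi π)).re) / 2
def bb (φ : ℂ ≃ₜ ℂ) : ℝ := ((φ 0).im + (φ (vi π)).im) / 2 - π / 2
def q (r ℓ a : ℝ) (K h : ℂ → ℂ) (z : ℂ) : ℂ :=
  K ((mu r (cc h) (2 * π / ℓ) a (cl (-r) r z).re : ℝ) + vi (vv r ℓ h (cl (-r) r z).re z.im)) + (z - cl (-r) r z)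

lemma Lw_mono {c : ℝ} (h0 : 0 < c) (h1 : c < 1) : StrictMono (Lw c) := fun s t h => by
  have := max_le_max_left 0 (by linarith : 4 * s - 3 ≤ 4 * t - 3)
  unfold Lw; nlinarith
lemma Lw_le {c s : ℝ} (h0 : 0 < c) (h1 : c < 1) (h : 0 ≤ s) (h' : s ≤ 1) : Lw c s ≤ s := by
  have : max 0 (4 * s - 3) ≤ s := max_le h (by linarith)
  unfold Lw; nlinarith
lemma mu_mono {r c w a : ℝ} (hr : 0 < r) (hw : 0 < w) (h0 : 0 < c) (h1 : c < 1) : StrictMono (mu r c w a) := fun x y h => by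
  refine max_lt_max (Lw_mono h0 h1 (by gcongr)) (min_lt_min (sub_lt_sub_left (Lw_mono (by linarith) (by linarith) (by gcongr)) _) ?_)
  gcongr
lemma mu_cont {r c w a : ℝ} : Continuous (mu r c w a) := by unfold mu Lw; fun_prop
lemma mu_l {r c w a : ℝ} (hr : 0 < r) : mu r c w a (-r) = 0 := by
  have : (r - -r) / (2 * r) = 1 := by field_simp; ring
  have h1 : Lw c 0 = 0 := by simp [Lw]
  have h2 : 1 - Lw (1 - c) 1 = 0 := by simp only [Lw]; norm_num
  unfold mu; rw [add_neg_cancel, zero_div, this, h1, h2]; exact max_eq_left (min_le_left _ _)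
lemma mu_r {r c w a : ℝ} (hr : 0 < r) (h0 : 0 < c) : mu r c w a r = 1 := by
  have : (r + r) / (2 * r) = 1 := by field_simp; ring
  unfold mu; rw [sub_self, zero_div, this]; simp [Lw]; norm_num
lemma l0_mem (r x : ℝ) : 0 ≤ l0 r x ∧ l0 r x ≤ 1 := ⟨le_max_left _ _, max_le zero_le_one (min_le_left _ _)⟩
lemma l0_bd {r x : ℝ} (h : |x| = r) : l0 r x = 0 := by
  unfold l0; rw [h, max_eq_left]; exact (min_le_right _ _).trans (by linarith)

lemma CU.hper (H : CU φ r ℓ K h) {w : ℂ} (hw : w ∈ cSt (-r) r) : h (w + vi (2 * π)) = h w + vi ℓ := by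
  have h1 := H.mh hw
  rw [← H.hK (h w + vi ℓ) (by simpa using h1), H.per, H.Kh w hw]

lemma smono {f : ℝ → ℝ} (hc : Continuous f) (hi : Function.Injective f) {P Q : ℝ} (hP : 0 < P) (hQ : 0 < Q)
    (h : ∀ x, f (x + P) = f x + Q) : StrictMono f := by
  rcases hc.strictMono_of_inj hi with h1 | h1
  · exact h1
  · have := h1 (lt_add_of_pos_right 0 hP); rw [h] at this; linarith

lemma CU.cmem (H : CU φ r ℓ K h) {x : ℝ} (hx : |x| ≤ r) (y : ℝ) : (x : ℂ) + vi y ∈ cSt (-r) r := by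
  rw [abs_le] at hx; simpa using hx

lemma CU.tau (H : CU φ r ℓ K h) {x : ℝ} (hx : |x| = r) :
    StrictMono (fun y => (h (x + vi y)).im) ∧ ∀ y, (h (x + vi (y + 2 * π))).im = (h (x + vi y)).im + ℓ := by
  have hp : ∀ y, (h (x + vi (y + 2 * π))).im = (h (x + vi y)).im + ℓ := fun y => by
    rw [vi_add, ← add_assoc, H.hper (H.cmem hx.le y)]; simp
  refine ⟨smono (by have := H.ch; unfold vi; fun_prop) (fun y y' hy => ?_) Real.two_pi_pos H.l0 hp, hp⟩
  have h1 : h (x + vi y) = h (x + vi y') := Complex.ext (by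
    rcases eq_or_eq_neg_of_abs_eq hx with h | h
    · rw [H.h1 (by simp [h]), H.h1 (by simp [h])]
    · rw [H.h0 (by simp [h]), H.h0 (by simp [h])]) hy
  have h2 := congrArg Complex.im (congrArg K h1)
  rw [H.Kh _ (H.cmem hx.le _), H.Kh _ (H.cmem hx.le _)] at h2; simpa using h2

lemma CU.cc0 (H : CU φ r ℓ K h) : 0 < cc h ∧ cc h < 1 := by
  have h1 := H.mS (w := 0) (by simp [H.r0]); have h2 := H.mS (w := vi π) (by simp [H.r0])
  simp only [mem_preimage, mem_Ioo] at h1 h2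
  unfold cc; constructor <;> linarith

lemma cvx {a b : ℝ} (ha : 0 ≤ a) (hb : 0 ≤ b) (hab : 0 < a + b) {x x' y y' : ℝ} (h1 : x < x') (h2 : y < y') :
    a * x + b * y < a * x' + b * y' := by
  rcases ha.eq_or_lt with rfl | h
  · nlinarith
  · nlinarith [mul_pos h (sub_pos.2 h1), mul_nonneg hb (sub_pos.2 h2).le]

lemma CU.wv_mono (H : CU φ r ℓ K h) {x : ℝ} (hx : |x| ≤ r) : StrictMono (wv r h x) := by
  have hr := H.r0; have hx' := abs_le.1 hx
  intro y y' hy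
  refine cvx (div_nonneg (by linarith) (by linarith)) (div_nonneg (by linarith) (by linarith)) ?_
    ((H.tau (by simp [hr.le])).1 hy) ((H.tau (by simp [hr.le])).1 hy)
  rw [← add_div]; apply div_pos <;> linarith

lemma CU.vv_mono (H : CU φ r ℓ K h) {x : ℝ} (hx : |x| ≤ r) : StrictMono (vv r ℓ h x) := by
  intro y y' hy
  have := l0_mem r x; have := H.l0
  exact cvx (by linarith) (by linarith) (by linarith) (H.wv_mono hx hy) (by have := H.l0; gcongr)

lemma CU.vv_per (H : CU φ r ℓ K h) (x y : ℝ) : vv r ℓ h x (y + 2 * π) = vv r ℓ h x y + ℓ := by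
  have hr := H.r0
  unfold vv wv; rw [(H.tau (by simp [hr.le])).2, (H.tau (by simp [hr.le])).2]; field_simp; ring

lemma CU.wv_cont (H : CU φ r ℓ K h) : Continuous fun p : ℝ × ℝ => wv r h p.1 p.2 := by
  have := H.ch; unfold wv vi; fun_prop
lemma CU.vv_cont (H : CU φ r ℓ K h) : Continuous fun p : ℝ × ℝ => vv r ℓ h p.1 p.2 := by
  have := H.wv_cont; unfold vv HS.l0; fun_prop
lemma CU.vv_bd (H : CU φ r ℓ K h) (y : ℝ) : vv r ℓ h r y = (h ((r : ℝ) + vi y)).im ∧ vv r ℓ h (-r) y = (h ((-r : ℝ) + vi y)).im := by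
  have hr := H.r0
  have : (r + r) / (2 * r) = 1 := by field_simp; ring
  unfold vv wv; rw [l0_bd (abs_of_pos hr), l0_bd (by simp [hr.le])]; simp [this]

lemma CU.q_cont (H : CU φ r ℓ K h) (a : ℝ) : Continuous (q r ℓ a K h) := by
  have h1 := H.vv_cont; have h2 := H.cK; have h3 := cl_cont (-r) r
  have h5 : Continuous (mu r (cc h) (2 * π / ℓ) a) := mu_cont
  have h4 : Continuous fun z => vv r ℓ h (cl (-r) r z).re z.im :=
    h1.comp ((Complex.continuous_re.comp h3).prodMk Complex.continuous_im)
  unfold q vi; fun_prop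

lemma CU.q_per (H : CU φ r ℓ K h) (a : ℝ) (z : ℂ) : q r ℓ a K h (z + TP) = q r ℓ a K h z + TP := by
  unfold q
  rw [TP_eq, cl_vi, Complex.add_re, vi_re, add_zero, Complex.add_im, vi_im, H.vv_per, vi_add, ← add_assoc, H.per]; ring

lemma CU.mu_mem (H : CU φ r ℓ K h) (a : ℝ) {x : ℝ} (hx : |x| ≤ r) : mu r (cc h) (2 * π / ℓ) a x ∈ Icc 0 1 := by
  have hr := H.r0; have hl := H.l0; have hx' := abs_le.1 hx
  have hm := (mu_mono (a := a) (w := 2 * π / ℓ) hr (by positivity) H.cc0.1 H.cc0.2).monotone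
  rw [← mu_l hr, ← mu_r hr H.cc0.1]; exact ⟨hm hx'.1, hm hx'.2⟩

lemma q_in (a : ℝ) {z : ℂ} (hz : z ∈ cSt (-r) r) : q r ℓ a K h z =
    K ((mu r (cc h) (2 * π / ℓ) a z.re : ℝ) + vi (vv r ℓ h z.re z.im)) := by
  unfold q; rw [cl_eq hz, sub_self, add_zero]

lemma CU.q_mem (H : CU φ r ℓ K h) (a : ℝ) {z : ℂ} (hz : z ∈ cSt (-r) r) : q r ℓ a K h z ∈ cSt (-r) r := by
  rw [q_in a hz]; exact H.mK (by simpa using H.mu_mem a (abs_le.2 hz))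

lemma CU.q_out (H : CU φ r ℓ K h) (a : ℝ) {z : ℂ} (hz : r ≤ |z.re|) : q r ℓ a K h z = z := by
  have hr := H.r0
  unfold q
  rcases le_abs.1 hz with h1 | h1
  · have e : (cl (-r) r z).re = r := by simp [cl, h1]; linarith
    rw [e, mu_r hr H.cc0.1, (H.vv_bd _).1]
    have : ((1 : ℝ) : ℂ) + vi (h (r + vi z.im)).im = h (r + vi z.im) := by
      refine Complex.ext ?_ (by simp); rw [H.h1 (w := r + vi z.im) (by simp)]; simp
    rw [this, H.Kh _ (by simp [hr.le])]
    apply Complex.ext <;> simp [e]; simp [cl]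
  · have e : (cl (-r) r z).re = -r := by simp [cl]; right; linarith
    rw [e, mu_l hr, (H.vv_bd _).2]
    have : ((0 : ℝ) : ℂ) + vi (h ((-r : ℝ) + vi z.im)).im = h ((-r : ℝ) + vi z.im) := by
      refine Complex.ext ?_ (by simp); rw [H.h0 (w := (-r : ℝ) + vi z.im) (by simp)]; simp
    rw [this, H.Kh _ (by simp [hr.le])]
    apply Complex.ext <;> simp [e]; simp [cl]

lemma CU.q_bij (H : CU φ r ℓ K h) (a : ℝ) : Function.Bijective (q r ℓ a K h) := by
  have hr := H.r0; have hl := H.l0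
  have hm := (mu_mono (a := a) (w := 2 * π / ℓ) hr (by positivity) H.cc0.1 H.cc0.2)
  constructor
  · intro z z' e
    by_cases hz : z ∈ cSt (-r) r <;> by_cases hz' : z' ∈ cSt (-r) r
    · rw [q_in a hz, q_in a hz'] at e
      have := congrArg h e
      rw [H.hK _ (by simpa using H.mu_mem a (abs_le.2 hz)), H.hK _ (by simpa using H.mu_mem a (abs_le.2 hz'))] at this
      have h1 := congrArg Complex.re this; have h2 := congrArg Complex.im this
      simp at h1 h2
      have h3 := hm.injective h1
      rw [h3] at h2
      exact Complex.ext h3 ((H.vv_mono (abs_le.2 hz')).injective h2)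
    · exact absurd (by rw [← H.q_out a (z := z') (by by_contra! h; exact hz' (abs_le.1 h.le)), ← e]; exact H.q_mem a hz) hz'
    · exact absurd (by rw [← H.q_out a (z := z) (by by_contra! h; exact hz (abs_le.1 h.le)), e]; exact H.q_mem a hz') hz
    · rwa [H.q_out a (by by_contra! h; exact hz (abs_le.1 h.le)), H.q_out a (by by_contra! h; exact hz' (abs_le.1 h.le))] at e
  · intro p
    by_cases hp : p ∈ cSt (-r) r
    · have hhp := H.mh hp
      obtain ⟨x, hx, ex⟩ := intermediate_value_Icc (by linarith : -r ≤ r) (mu_cont (r := r) (c := cc h) (w := 2 * π / ℓ) (a := a)).continuousOn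
        (show (h p).re ∈ _ by rw [mu_l hr, mu_r hr H.cc0.1]; exact hhp)
      obtain ⟨y, hy⟩ := surj_im (f := fun z => vi (vv r ℓ h x z.im)) (P := 2 * π) (Q := ℓ) (by
        have := H.vv_cont.comp ((continuous_const (y := x)).prodMk Complex.continuous_im)
        unfold vi; exact (Complex.continuous_ofReal.comp this).mul continuous_const) hl.ne' (fun z => by
          simp [H.vv_per, vi_add]) 0 (h p).im
      simp at hy
      refine ⟨x + vi y, ?_⟩
      rw [q_in a (by simpa using hx)]
      simp only [Complex.add_re, Complex.ofReal_re, vi_re, add_zero, Complex.add_im, Complex.ofReal_im, vi_im, zero_add, ex, hy]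
      rw [show (((h p).re : ℝ) : ℂ) + vi (h p).im = h p from Complex.ext (by simp) (by simp), H.Kh p hp]
    · exact ⟨p, H.q_out a (by by_contra! h; exact hp (abs_le.1 h.le))⟩

variable {ι : Type} {U : Ultrafilter ι} {φi : ι → ℂ ≃ₜ ℂ} {ri ℓi : ι → ℝ} {Ki hi : ι → ℂ → ℂ}

structure Cv (U : Filter ι) (φi : ι → ℂ ≃ₜ ℂ) (φ : ℂ ≃ₜ ℂ) : Prop where
  uni : ∀ a ε : ℝ, 0 < ε → ∀ᶠ i in U, ∀ z ∈ cSt (-a) a, ‖φi i z - φ z‖ ≤ ε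
  top : ∀ M : ℝ, ∃ N : ℝ, ∀ᶠ i in U, ∀ z : ℂ, N ≤ z.re → M ≤ (φi i z).re
  bot : ∀ M : ℝ, ∃ N : ℝ, ∀ᶠ i in U, ∀ z : ℂ, z.re ≤ N → (φi i z).re ≤ M

lemma cSt_mono {a b : ℝ} (h : a ≤ b) : cSt (-a) a ⊆ cSt (-b) b := preimage_mono (Icc_subset_Icc (neg_le_neg h) h)

lemma Cv.bdd (C : Cv U φi φ) (hφ : IsLift φ) (a : ℝ) : ∃ R > 0, ∀ᶠ i in (U : Filter ι), ∀ z ∈ cSt (-a) a, |(φi i z).re| ≤ R := by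
  obtain ⟨R, hR, hb⟩ := hφ.bdd a
  refine ⟨R + 1, by linarith, (C.uni a 1 one_pos).mono fun i hi z hz => ?_⟩
  have h1 := (Complex.abs_re_le_norm _).trans (hi z hz)
  have h2 := hb z hz
  rw [Complex.sub_re] at h1; rw [abs_le] at *; constructor <;> linarith

lemma Cv.mod (C : Cv U φi φ) (hφ : IsLift φ) (a : ℝ) {ε : ℝ} (hε : 0 < ε) : ∃ η > 0, ∀ᶠ i in (U : Filter ι),
    ∀ p ∈ cSt (-a) a, ∀ q ∈ cSt (-a) a, ‖φi i p - φi i q‖ ≤ η → ‖p - q‖ ≤ ε := by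
  obtain ⟨η, hη, h⟩ := hφ.mod a hε
  refine ⟨η / 3, by positivity, (C.uni a (η / 3) (by positivity)).mono fun i hi p hp q hq hpq => h p hp q hq ?_⟩
  have h1 := hi p hp; have h2 := hi q hq
  have e : φ p - φ q = (φi i p - φi i q) - (φi i p - φ p) + (φi i q - φ q) := by ring
  rw [e]; refine (norm_add_le _ _).trans ?_
  linarith [norm_sub_le (φi i p - φi i q) (φi i p - φ p)]

lemma Cv.lim (C : Cv U φi φ) {wi : ι → ℂ} {w : ℂ} (hw : Tendsto wi U (𝓝 w)) : Tendsto (fun i => φi i (wi i)) U (𝓝 (φ w)) := by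
  have h1 := (φ.continuous.tendsto w).comp hw
  have h2 : Tendsto (fun i => φi i (wi i) - φ (wi i)) U (𝓝 0) := by
    rw [Metric.tendsto_nhds]; intro ε hε
    filter_upwards [C.uni (|w.re| + 1) (ε / 2) (by positivity), hw (ball_mem_nhds w one_pos)] with i h3 h4
    rw [dist_zero_right]
    refine (h3 _ (abs_le.1 ?_)).trans_lt (by linarith)
    have h5 := (Complex.abs_re_le_norm _).trans (mem_ball_iff_norm.1 h4).le
    have := abs_add_le (wi i - w).re w.re
    rw [Complex.sub_re] at *; simp at this; linarith
  simpa using h2.add h1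

lemma eqc (L : ∀ i, IsLift (φi i)) (hφ : IsLift φ) (C : Cv U φi φ) (H : ∀ i, CU (φi i) (ri i) (ℓi i) (Ki i) (hi i))
    (hr : Tendsto ri U (𝓝 r)) {ε : ℝ} (hε : 0 < ε) : ∃ δ > 0, ∀ᶠ i in (U : Filter ι), ∀ z ∈ cSt 0 1, ∀ z' ∈ cSt 0 1,
      ‖z - z'‖ < δ → ‖Ki i z - Ki i z'‖ ≤ ε := by
  obtain ⟨R, hR, hb⟩ := C.bdd hφ (r + 1)
  obtain ⟨η, hη, hm⟩ := C.mod hφ (r + 1) (ε := ε / 4) (by positivity)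
  have hpi := Real.pi_pos
  obtain ⟨δ, hδ, hE⟩ := EQ (ε := ε / 4) hR (lt_min (by norm_num) (by positivity) : 0 < min (1 / 4) (π / (8 * R))) hη
  refine ⟨δ, hδ, ?_⟩
  filter_upwards [hb, hm, hr.eventually_lt_const (lt_add_one r)] with i hb hm hri
  have hsub : St (-(ri i)) (ri i) ⊆ cSt (-(r + 1)) (r + 1) := (St_sub _ _).trans (cSt_mono hri.le)
  obtain ⟨b, hb'⟩ := cb_hol (H i).hol
  have O := (H i).toOU (L i) hb'
  have hR' : ∀ w ∈ St (-(ri i)) (ri i), |(φi i w).re| ≤ R := fun w hw => hb w (hsub hw)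
  have key := hE _ _ _ _ _ _ O (O.llow hR hR') hR' (fun p hp q hq => hm p (hsub hp) q (hsub hq))
  have keyA : ∀ z ∈ A, ∀ z' ∈ A, ‖z - z'‖ < δ → ‖Ki i z - Ki i z'‖ ≤ ε := fun z hz z' hz' hd => by
    have := key (cb b z) (by simpa using hz) (cb b z') (by simpa using hz') (by rwa [← cb_sub, norm_cb])
    rw [cb_cb, cb_cb] at this; linarith
  intro z hz z' hz' hd
  set S : ℂ → ℝ → ℂ := fun z s => (s : ℂ) * z + (1 - s) / 2
  have hS : ∀ z ∈ cSt 0 1, ∀ s ∈ Ioo (0 : ℝ) 1, S z s ∈ A := fun z hz s hs => by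
    have e : (S z s).re = s * z.re + (1 - s) / 2 := by
      have : S z s = (s : ℂ) * z + (((1 - s) / 2 : ℝ) : ℂ) := by simp [S]
      rw [this]; simp
    simp only [mem_preimage, mem_Ioo, mem_Icc, e] at *
    constructor <;> nlinarith [mul_nonneg hs.1.le hz.1, mul_nonneg hs.1.le (sub_nonneg.2 hz.2)]
  have hSt : ∀ z, Tendsto (fun s => Ki i (S z s)) (𝓝[<] 1) (𝓝 (Ki i z)) := fun z => by
    have hc : Continuous fun s => Ki i (S z s) := (H i).cK.comp (by fun_prop)
    have := hc.tendsto 1; simp only [S] at this; simp at this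
    exact this.mono_left nhdsWithin_le_nhds
  refine le_of_tendsto ((hSt z).sub (hSt z')).norm ?_
  filter_upwards [Ioo_mem_nhdsLT zero_lt_one] with s hs
  refine keyA _ (hS z hz s hs) _ (hS z' hz' s hs) ?_
  have : S z s - S z' s = (s : ℂ) * (z - z') := by simp only [S]; ring
  rw [this, norm_mul, Complex.norm_real, Real.norm_of_nonneg hs.1.le]
  nlinarith [norm_nonneg (z - z'), hs.1, hs.2]

lemma chain {f : ℂ → ℂ} {δ : ℝ} (hf : ∀ z ∈ cSt 0 1, ∀ z' ∈ cSt 0 1, ‖z - z'‖ < δ → ‖f z - f z'‖ ≤ 1)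
    {z : ℂ} (hz : z ∈ cSt 0 1) {N : ℕ} (hN0 : 0 < N) (hN : ‖z‖ / N < δ) : ‖f z - f 0‖ ≤ N := by
  have hN' : (0 : ℝ) < N := by exact_mod_cast hN0
  have key : ∀ k : ℕ, k ≤ N → ‖f (((k / N : ℝ) : ℂ) * z) - f 0‖ ≤ k := by
    intro k; induction k with
    | zero => simp
    | succ k ih =>
      intro hk
      have hm : ∀ j : ℕ, j ≤ N → ((j / N : ℝ) : ℂ) * z ∈ cSt 0 1 := fun j hj => by
        have h1 : (j / N : ℝ) ≤ 1 := by rw [div_le_one hN']; exact_mod_cast hj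
        have h2 : 0 ≤ (j / N : ℝ) := by positivity
        simp only [mem_preimage, Complex.re_ofReal_mul, mem_Icc] at *
        constructor <;> nlinarith [hz.1, hz.2]
      have h1 := hf _ (hm (k + 1) hk) _ (hm k (by omega)) (by
        rw [← sub_mul, ← Complex.ofReal_sub, norm_mul, Complex.norm_real, ← sub_div]; push_cast
        rw [add_sub_cancel_left, Real.norm_of_nonneg (by positivity), one_div_mul_eq_div]; exact hN)
      calc _ = ‖(f ((((k + 1 : ℕ) / N : ℝ) : ℂ) * z) - f (((k / N : ℝ) : ℂ) * z)) + (f (((k / N : ℝ) : ℂ) * z) - f 0)‖ := by ring_nf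
        _ ≤ _ := (norm_add_le _ _).trans (by push_cast at *; linarith [ih (by omega)])
  have := key N le_rfl
  rwa [div_self hN'.ne', Complex.ofReal_one, one_mul] at this

lemma comp (L : ∀ i, IsLift (φi i)) (hφ : IsLift φ) (C : Cv U φi φ) (H : ∀ i, CU (φi i) (ri i) (ℓi i) (Ki i) (hi i))
    (hr : Tendsto ri U (𝓝 r)) {M : ℝ} (hM : ∀ᶠ i in (U : Filter ι), ‖Ki i 0‖ ≤ M) : ∃ k : ℂ → ℂ, Continuous k ∧
    (∀ (zi : ι → ℂ) (z : ℂ), (∀ i, zi i ∈ cSt 0 1) → Tendsto zi U (𝓝 z) → Tendsto (fun i => Ki i (zi i)) U (𝓝 (k z))) ∧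
    (∀ z, k (cl 0 1 z) = k z) ∧ ∃ b, DifferentiableOn ℂ (fun z => φ (k (cb b z))) A := by
  have hc : ∀ z, cl 0 1 z ∈ cSt 0 1 := cl_mem zero_le_one
  have lim : ∀ z, ∃ a, Tendsto (fun i => Ki i (cl 0 1 z)) U (𝓝 a) := fun z => by
    obtain ⟨δ, hδ, h⟩ := eqc L hφ C H hr one_pos
    obtain ⟨N, hN⟩ := exists_nat_gt (‖cl 0 1 z‖ / δ)
    have hN0 : (0 : ℝ) < N := lt_of_le_of_lt (by positivity) hN
    refine ulim U (C := N + M) ?_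
    filter_upwards [h, hM] with i h1 h2
    have := chain h1 (hc z) (by exact_mod_cast hN0) (by rwa [div_lt_comm₀ hN0 hδ])
    have := norm_add_le (Ki i (cl 0 1 z) - Ki i 0) (Ki i 0)
    rw [sub_add_cancel] at this; linarith
  choose k hk using lim
  have close : ∀ (zi : ι → ℂ) (z : ℂ), (∀ i, zi i ∈ cSt 0 1) → Tendsto zi U (𝓝 z) → Tendsto (fun i => Ki i (zi i)) U (𝓝 (k z)) := by
    intro zi z hzi hz
    have h2 : Tendsto (fun i => Ki i (zi i) - Ki i (cl 0 1 z)) U (𝓝 0) := by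
      rw [Metric.tendsto_nhds]; intro ε hε
      obtain ⟨δ, hδ, h⟩ := eqc L hφ C H hr (half_pos hε)
      have hzc : z ∈ cSt 0 1 := (cSt_closed 0 1).mem_of_tendsto hz (Eventually.of_forall hzi)
      filter_upwards [h, hz (ball_mem_nhds z hδ)] with i h1 h2
      rw [dist_zero_right]
      refine (h1 _ (hzi i) _ (hc z) ?_).trans_lt (by linarith)
      rw [cl_eq hzc]; exact mem_ball_iff_norm.1 h2
    simpa using h2.add (hk z)
  have kc : ∀ z, k (cl 0 1 z) = k z := fun z => by
    refine tendsto_nhds_unique (hk (cl 0 1 z)) ?_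
    rw [cl_eq (hc z)]; exact hk z
  have hcont : Continuous k := by
    have : ContinuousOn k (cSt 0 1) := by
      rw [Metric.continuousOn_iff]; intro z hz ε hε
      obtain ⟨δ, hδ, h⟩ := eqc L hφ C H hr (half_pos hε)
      refine ⟨δ, hδ, fun w hw hd => ?_⟩
      have h1 : ‖k w - k z‖ ≤ ε / 2 := le_of_tendsto ((hk w).sub (hk z)).norm (h.mono fun i hi => hi _ (hc w) _ (hc z) (by
        rw [cl_eq hw, cl_eq hz]; rwa [dist_eq_norm] at hd))
      rw [dist_eq_norm]; linarith
    have h2 : k = k ∘ cl 0 1 := funext fun z => (kc z).symm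
    rw [h2]; exact this.comp_continuous (cl_cont 0 1) hc
  refine ⟨k, hcont, close, kc, ?_⟩
  have hb : ∃ b, ∀ᶠ i in (U : Filter ι), DifferentiableOn ℂ (fun z => φi i (Ki i (cb b z))) A := by
    have : ∀ᶠ i in (U : Filter ι), DifferentiableOn ℂ (fun z => φi i (Ki i (cb true z))) A ∨ DifferentiableOn ℂ (fun z => φi i (Ki i (cb false z))) A :=
      Eventually.of_forall fun i => by
        obtain ⟨b, hb⟩ := cb_hol (H i).hol
        cases b
        · exact Or.inr hb
        · exact Or.inl hb
    rcases Ultrafilter.eventually_or.1 this with h | h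
    exacts [⟨_, h⟩, ⟨_, h⟩]
  obtain ⟨b, hb⟩ := hb
  have hbA : ∀ z ∈ A, cb b z ∈ cSt 0 1 := fun z hz => by simpa using St_sub _ _ hz
  obtain ⟨R, hR, hbd⟩ := C.bdd hφ (r + 1)
  refine ⟨b, TendstoLocallyUniformlyOn.differentiableOn (tlu (l := (U : Filter ι)) (F := fun i z => φi i (Ki i (cb b z))) (fun z hz => ?_) fun z hz => ?_) hb (St_open 0 1)⟩
  · obtain ⟨ε, hε, hsub⟩ := Metric.isOpen_iff.1 (St_open 0 1) z hz
    refine ⟨ε, hε, R, hR, ?_⟩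
    filter_upwards [hb, hbd, hr.eventually_lt_const (lt_add_one r)] with i h1 h2 h3
    exact ⟨h1.mono hsub, fun w hw => h2 _ (cSt_mono h3.le ((H i).mK (hbA w (hsub hw))))⟩
  · exact C.lim (close _ _ (fun i => hbA z hz) tendsto_const_nhds)

lemma CU.shift (H : CU φ r ℓ K h) (c : ℝ) : CU φ r ℓ (fun z => K (z + vi c)) (fun w => h w + vi (-c)) where
  r0 := H.r0
  l0 := H.l0
  cK := H.cK.comp (by fun_prop)
  ch := H.ch.add continuous_const
  mK z hz := H.mK (by simpa using hz)
  mh w hw := by simpa using H.mh hw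
  Kh w hw := by rw [add_assoc, ← vi_add, neg_add_cancel]; simpa [vi] using H.Kh w hw
  hK z hz := by rw [H.hK _ (by simpa using hz), add_assoc, ← vi_add, add_neg_cancel]; simp [vi]
  per z := by rw [add_right_comm, H.per]
  w0 z hz := H.w0 _ (by simpa using hz)
  w1 z hz := H.w1 _ (by simpa using hz)
  hol := by
    have e : ∀ c, MapsTo (fun z => z + vi c) A A := fun c z hz => by simpa using hz
    rcases H.hol with h | h
    · exact Or.inl (h.comp (by fun_prop) (e c))
    · refine Or.inr ((h.comp (by fun_prop) (e (-c))).congr fun z hz => ?_)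
      simp [vi]

lemma q_shift {a : ℝ} (hr : 0 < r) (c : ℝ) (z : ℂ) : q r ℓ a (fun z => K (z + vi c)) (fun w => h w + vi (-c)) z = q r ℓ a K h z := by
  have e1 : cc (fun w => h w + vi (-c)) = cc h := by simp [cc]
  have e2 : ∀ x y, vv r ℓ (fun w => h w + vi (-c)) x y = vv r ℓ h x y - c := fun x y => by
    simp only [vv, wv, mm, Complex.add_im, vi_im]; field_simp; ring
  simp only [q, e1, e2]; rw [add_assoc, ← vi_add, sub_add_cancel]

lemma CU.norm0 (H : CU φ r ℓ K h) : ∃ c, K (vi c) = (-r : ℝ) := by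
  obtain ⟨c, hc⟩ := surj_im H.cK (by positivity) H.per 0 0
  refine ⟨c, ?_⟩
  simp at hc
  exact Complex.ext (by rw [H.w0 _ (by simp)]; simp) (by simpa using hc)

lemma ball_in {a η : ℝ} (ha : 0 < a) {y : ℝ} (hm : ∀ p ∈ cSt (-a) a, ∀ q ∈ cSt (-a) a, ‖φ p - φ q‖ ≤ η → ‖p - q‖ ≤ a / 2)
    (hη : 0 < η) : ball (φ (vi y)) η ⊆ φ '' St (-a) a := by
  have hs : closedBall (vi y) (3 * a / 4) ⊆ St (-a) a := fun z hz => by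
    have := (Complex.abs_re_le_norm _).trans (mem_closedBall_iff_norm.1 hz)
    rw [Complex.sub_re, vi_re, sub_zero, abs_le] at this
    simp only [mem_preimage, mem_Ioo]; constructor <;> linarith
  have hsub : ball (φ (vi y)) η ⊆ φ '' ball (vi y) (3 * a / 4) := by
    refine IsPreconnected.subset_left_of_subset_union (φ.isOpenMap _ isOpen_ball) (φ.isClosedMap _ (isClosed_closedBall (x := vi y) (ε := 3 * a / 4))).isOpen_compl ?_ ?_
      ⟨φ (vi y), mem_ball_self hη, _, mem_ball_self (by positivity), rfl⟩ (isConnected_ball hη).isPreconnected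
    · rw [disjoint_compl_right_iff_subset]; exact image_mono ball_subset_closedBall
    · intro w hw
      obtain ⟨z, rfl⟩ := φ.surjective w
      rcases lt_trichotomy (dist z (vi y)) (3 * a / 4) with h | h | h
      · exact Or.inl ⟨z, h, rfl⟩
      · have := hm z (St_sub _ _ (hs h.le)) (vi y) (by simp [ha.le]) (mem_ball_iff_norm.1 hw).le
        rw [dist_eq_norm] at h; linarith
      · right; rintro ⟨z', hz', e⟩
        rw [φ.injective e] at hz'; exact absurd h (not_lt.2 hz')
  exact hsub.trans (image_mono (ball_subset_closedBall.trans hs))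

lemma rlim (U : Ultrafilter ι) {u : ι → ℝ} {C : ℝ} (h : ∀ᶠ n in (U : Filter ι), |u n| ≤ C) : ∃ a, Tendsto u U (𝓝 a) := by
  obtain ⟨a, ha⟩ := ulim U (u := fun n => (u n : ℂ)) (C := C) (by simpa using h)
  exact ⟨a.re, (Complex.continuous_re.tendsto a).comp ha⟩

lemma ell_up (hφ : IsLift φ) (C : Cv U φi φ) (H : ∀ i, CU (φi i) (ri i) (ℓi i) (Ki i) (hi i))
    (hr : Tendsto ri U (𝓝 r)) (hr0 : 0 < r) : ∃ M : ℝ, ∀ᶠ i in (U : Filter ι), ℓi i ≤ M := by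
  obtain ⟨η, hη, hm⟩ := C.mod hφ (r / 2) (ε := r / 2 / 2) (by positivity)
  obtain ⟨δ, hδ, hu⟩ := unif φ.continuous Real.two_pi_pos hφ.per' 0 0 (ε := η / 6) (by positivity)
  obtain ⟨N, hN⟩ := exists_nat_gt (2 * π / δ)
  have hN0 : (0 : ℝ) < N := lt_of_le_of_lt (by have := Real.pi_pos; positivity) hN
  refine ⟨4 * N, ?_⟩
  filter_upwards [hm, C.uni 0 (η / 6) (by positivity), hr.eventually_const_lt (half_lt_self hr0)] with i h1 h2 h3
  refine (H i).lup hη (fun y => (ball_in (half_pos hr0) h1 hη).trans (image_mono fun z hz => ?_)) (fun k _ => ?_) (by exact_mod_cast hN0.ne')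
  · simp only [mem_preimage, mem_Ioo] at *; constructor <;> linarith [hz.1, hz.2]
  · set p := vi (2 * π * ((k + 1) / N)); set p' := vi (2 * π * (k / N))
    have e1 := h2 p (by simp [p]); have e2 := h2 p' (by simp [p'])
    have e3 := hu p (by simp [p]) p' (by simp [p']) (by
      have : p - p' = vi (2 * π / N) := by simp only [p, p', vi]; push_cast; ring
      rw [this, norm_vi, abs_of_pos (by have := Real.pi_pos; positivity)]
      rw [div_lt_iff₀ hδ] at hN; rw [div_le_iff₀ hN0]; linarith)
    have e : φi i p - φi i p' = (φi i p - φ p) - (φi i p' - φ p') + (φ p - φ p') := by ring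
    rw [e]; refine (norm_add_le _ _).trans ?_
    linarith [norm_sub_le (φi i p - φ p) (φi i p' - φ p')]

lemma ell_lo (L : ∀ i, IsLift (φi i)) (hφ : IsLift φ) (C : Cv U φi φ) (H : ∀ i, CU (φi i) (ri i) (ℓi i) (Ki i) (hi i))
    (hr : Tendsto ri U (𝓝 r)) : ∃ m > 0, ∀ᶠ i in (U : Filter ι), m ≤ ℓi i := by
  obtain ⟨R, hR, hb⟩ := C.bdd hφ (r + 1)
  refine ⟨min (1 / 4) (π / (8 * R)), lt_min (by norm_num) (by have := Real.pi_pos; positivity), ?_⟩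
  filter_upwards [hb, hr.eventually_lt_const (lt_add_one r)] with i hb hri
  obtain ⟨b, hb'⟩ := cb_hol (H i).hol
  exact ((H i).toOU (L i) hb').llow hR fun w hw => hb w (cSt_mono hri.le (St_sub _ _ hw))

lemma limK (L : ∀ i, IsLift (φi i)) (hφ : IsLift φ) (C : Cv U φi φ) (H : ∀ i, CU (φi i) (ri i) (ℓi i) (Ki i) (hi i))
    (hr : Tendsto ri U (𝓝 r)) (H0 : CU φ r ℓ K h) (hK0 : ∀ i, Ki i 0 = (-(ri i) : ℝ)) (hK : K 0 = (-r : ℝ)) :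
    Tendsto ℓi U (𝓝 ℓ) ∧
    ∀ (zi : ι → ℂ) (z : ℂ), (∀ i, zi i ∈ cSt 0 1) → Tendsto zi U (𝓝 z) → Tendsto (fun i => Ki i (zi i)) U (𝓝 (K z)) := by
  obtain ⟨M, hM⟩ := ell_up hφ C H hr H0.r0
  obtain ⟨m, hm, hml⟩ := ell_lo L hφ C H hr
  obtain ⟨ℓ', hl'⟩ := rlim U (u := ℓi) (C := M) (by
    filter_upwards [hM] with i h1; rwa [abs_of_pos (H i).l0])
  obtain ⟨k, ck, hk, kc, b, hb⟩ := comp L hφ C H hr (M := r + 1) (by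
    filter_upwards [hr.eventually_lt_const (lt_add_one r)] with i h1
    rw [hK0, Complex.norm_real, norm_neg, Real.norm_of_nonneg (H i).r0.le]; exact h1.le)
  have hc : ∀ z, cl 0 1 z ∈ cSt 0 1 := cl_mem zero_le_one
  have lk : ∀ z, Tendsto (fun i => Ki i (cl 0 1 z)) U (𝓝 (k z)) := fun z => by
    rw [← kc]; exact hk _ _ (fun _ => hc z) tendsto_const_nhds
  have reK := fun z => (Complex.continuous_re.tendsto _).comp (lk z)
  have W : WU φ r ℓ' k := by
    refine ⟨hm.trans_le (ge_of_tendsto hl' hml), ck, fun z hz => ?_, fun z => ?_, fun z hz => ?_, fun z hz => ?_, hol_cb hb⟩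
    · exact ⟨le_of_tendsto_of_tendsto hr.neg (reK z) (Eventually.of_forall fun i => ((H i).mK (hc z)).1),
        le_of_tendsto_of_tendsto (reK z) hr (Eventually.of_forall fun i => ((H i).mK (hc z)).2)⟩
    · have h1 := hk (fun i => cl 0 1 z + vi (ℓi i)) (cl 0 1 z + vi ℓ') (fun i => by simpa using hc z) (by
        refine tendsto_const_nhds.add ?_
        exact ((Complex.continuous_ofReal.tendsto _).comp hl').mul_const _)
      simp only [(H _).per] at h1
      rw [← cl_vi, kc] at h1
      exact tendsto_nhds_unique h1 ((lk z).add_const _)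
    · refine tendsto_nhds_unique (reK z) (hr.neg.congr fun i => ?_)
      exact ((H i).w0 _ (by simp [cl, hz])).symm
    · refine tendsto_nhds_unique (reK z) (hr.congr fun i => ?_)
      exact ((H i).w1 _ (by simp [cl, hz])).symm
  obtain ⟨e, d, hd⟩ := H0.uniq W
  have h0 : (0 : ℂ) ∈ cSt 0 1 := by simp
  have k0 : k 0 = K 0 := by
    have h1 := lk 0; rw [cl_eq h0] at h1
    rw [hK]; refine tendsto_nhds_unique h1 ?_
    simp only [hK0]; exact (Complex.continuous_ofReal.tendsto _).comp hr.neg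
  have d0 : vi d = 0 := by
    have h1 := congrArg h (hd 0 h0)
    rw [k0, H0.hK _ h0, H0.hK _ (by simp)] at h1; simpa using h1.symm
  refine ⟨e ▸ hl', fun zi z hzi hz => ?_⟩
  have hzc : z ∈ cSt 0 1 := (cSt_closed 0 1).mem_of_tendsto hz (Eventually.of_forall hzi)
  have := hd z hzc; rw [d0, add_zero] at this
  rw [← this]; exact hk zi z hzi hz

lemma tvi {u : ι → ℝ} {l : Filter ι} {x : ℝ} (hu : Tendsto u l (𝓝 x)) : Tendsto (fun i => vi (u i)) l (𝓝 (vi x)) :=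
  ((Complex.continuous_ofReal.tendsto _).comp hu).mul_const _
lemma tof {u : ι → ℝ} {l : Filter ι} {x : ℝ} (hu : Tendsto u l (𝓝 x)) : Tendsto (fun i => (u i : ℂ)) l (𝓝 (x : ℂ)) :=
  (Complex.continuous_ofReal.tendsto _).comp hu
lemma tre {u : ι → ℂ} {l : Filter ι} {x : ℂ} (hu : Tendsto u l (𝓝 x)) : Tendsto (fun i => (u i).re) l (𝓝 x.re) :=
  (Complex.continuous_re.tendsto _).comp hu
lemma tim {u : ι → ℂ} {l : Filter ι} {x : ℂ} (hu : Tendsto u l (𝓝 x)) : Tendsto (fun i => (u i).im) l (𝓝 x.im) :=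
  (Complex.continuous_im.tendsto _).comp hu

lemma limh (H : ∀ i, CU (φi i) (ri i) (ℓi i) (Ki i) (hi i)) (hr : Tendsto ri U (𝓝 r)) (H0 : CU φ r ℓ K h) (hl : Tendsto ℓi U (𝓝 ℓ))
    (hK : ∀ (zi : ι → ℂ) (z : ℂ), (∀ i, zi i ∈ cSt 0 1) → Tendsto zi U (𝓝 z) → Tendsto (fun i => Ki i (zi i)) U (𝓝 (K z)))
    {wi : ι → ℂ} {w : ℂ} (hwi : ∀ i, wi i ∈ cSt (-(ri i)) (ri i)) (hw : Tendsto wi U (𝓝 w)) :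
    Tendsto (fun i => hi i (wi i)) U (𝓝 (h w)) := by
  have hex : ∀ i, ∃ n : ℤ, (hi i (wi i)).im + n * ℓi i ∈ Icc 0 (ℓi i) := fun i => HS.shift (H i).l0 _
  choose n hn using hex
  set ζ : ι → ℂ := fun i => hi i (wi i) + vi (n i * ℓi i)
  have hζ : ∀ i, ζ i ∈ cSt 0 1 := fun i => by simpa [ζ] using (H i).mh (hwi i)
  obtain ⟨ζ0, hζ0⟩ := ulim U (u := ζ) (C := 1 + (ℓ + 1)) (by
    filter_upwards [hl.eventually_lt_const (lt_add_one ℓ)] with i h1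
    refine (Complex.norm_le_abs_re_add_abs_im _).trans (add_le_add ?_ ?_)
    · exact abs_le.2 ⟨by linarith [(hζ i).1], (hζ i).2⟩
    · have : (ζ i).im = (hi i (wi i)).im + n i * ℓi i := by simp [ζ]
      rw [this, abs_of_nonneg (hn i).1]; linarith [(hn i).2])
  have h1 := hK ζ ζ0 hζ hζ0
  have e : ∀ i, Ki i (ζ i) = wi i + vi (n i * (2 * π)) := fun i => by
    simp only [ζ]; rw [vper (H i).per, (H i).Kh _ (hwi i)]
  simp only [e] at h1
  have h2 := h1.sub hw
  simp only [add_sub_cancel_left] at h2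
  have h3 := (tim h2).mul_const (1 / (2 * π))
  simp only [vi_im] at h3
  have h4 : Tendsto (fun i => (n i : ℝ) * ℓi i) U (𝓝 ((K ζ0 - w).im * (1 / (2 * π)) * ℓ)) := by
    refine (h3.mul hl).congr fun i => ?_
    have := Real.pi_ne_zero; field_simp
  have h5 := hζ0.sub (tvi h4)
  simp only [ζ, add_sub_cancel_right] at h5
  have h6 := hK _ _ (fun i => (H i).mh (hwi i)) h5
  simp only [(H _).Kh _ (hwi _)] at h6
  have h7 := tendsto_nhds_unique h6 hw
  have h8 := (cSt_closed 0 1).mem_of_tendsto h5 (Eventually.of_forall fun i => (H i).mh (hwi i))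
  rw [← h7, H0.hK _ h8]; exact h5

theorem limq (L : ∀ i, IsLift (φi i)) (hφ : IsLift φ) (C : Cv U φi φ) (H : ∀ i, CU (φi i) (ri i) (ℓi i) (Ki i) (hi i))
    (hr : Tendsto ri U (𝓝 r)) (H0 : CU φ r ℓ K h) {ai : ι → ℝ} {a : ℝ} (ha : Tendsto ai U (𝓝 a)) {zi : ι → ℂ} {z : ℂ} (hz : Tendsto zi U (𝓝 z)) :
    Tendsto (fun i => q (ri i) (ℓi i) (ai i) (Ki i) (hi i) (zi i)) U (𝓝 (q r ℓ a K h z)) := by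
  wlog hK0 : (∀ i, Ki i 0 = (-(ri i) : ℝ)) ∧ K 0 = (-r : ℝ) generalizing Ki hi K h
  · choose c hc using fun i => (H i).norm0
    obtain ⟨d, hd⟩ := H0.norm0
    have := this (fun i => (H i).shift (c i)) (H0.shift d) ⟨fun i => by simpa using hc i, by simpa using hd⟩
    rw [q_shift H0.r0] at this
    exact this.congr fun i => q_shift (H i).r0 _ _
  obtain ⟨hl, hK⟩ := limK L hφ C H hr H0 hK0.1 hK0.2
  have hh := fun wi w => limh (wi := wi) (w := w) H hr H0 hl hK
  have r0 := H0.r0; have l0 := H0.l0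
  have cl1 : Tendsto (fun i => (cl (-(ri i)) (ri i) (zi i)).re) U (𝓝 (cl (-r) r z).re) := hr.neg.max (hr.min (tre hz))
  have cl2 : Tendsto (fun i => cl (-(ri i)) (ri i) (zi i)) U (𝓝 (cl (-r) r z)) := by
    have := (tof cl1).add (tvi (tim hz))
    convert this using 2
    · exact Complex.ext (by simp) (by simp [cl])
    · congr 1; exact Complex.ext (by simp) (by simp [cl])
  have h00 := hh (fun _ => 0) 0 (fun i => by simp [(H i).r0.le]) tendsto_const_nhds
  have h01 := hh (fun _ => vi π) (vi π) (fun i => by simp [(H i).r0.le]) tendsto_const_nhds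
  have hcc : Tendsto (fun i => cc (hi i)) U (𝓝 (cc h)) := ((tre h00).add (tre h01)).div_const 2
  have hmm : Tendsto (fun i => mm (ℓi i) (hi i)) U (𝓝 (mm ℓ h)) := (((tim h00).add (tim h01)).div_const 2).sub (hl.div_const 4)
  have hw1 := tim (hh (fun i => ((-(ri i) : ℝ) : ℂ) + vi (zi i).im) _ (fun i => by simp [(H i).r0.le]) ((tof hr.neg).add (tvi (tim hz))))
  have hw2 := tim (hh (fun i => (ri i : ℂ) + vi (zi i).im) _ (fun i => by simp [(H i).r0.le]) ((tof hr).add (tvi (tim hz))))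
  have h2r : Tendsto (fun i => 2 * ri i) U (𝓝 (2 * r)) := hr.const_mul 2
  have n2 : 2 * r ≠ 0 := by positivity
  have hl0 : Tendsto (fun i => HS.l0 (ri i) (cl (-(ri i)) (ri i) (zi i)).re) U (𝓝 (HS.l0 r (cl (-r) r z).re)) :=
    tendsto_const_nhds.max (tendsto_const_nhds.min ((hr.sub_const 1).sub cl1.abs))
  have hv : Tendsto (fun i => vv (ri i) (ℓi i) (hi i) (cl (-(ri i)) (ri i) (zi i)).re (zi i).im) U (𝓝 (vv r ℓ h (cl (-r) r z).re z.im)) :=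
    ((hl0.const_sub 1).mul ((((hr.sub cl1).div h2r n2).mul hw1).add (((hr.add cl1).div h2r n2).mul hw2))).add
      (hl0.mul (((hl.div_const _).mul (tim hz)).add hmm))
  have hLw : ∀ {c s : ι → ℝ} {c0 s0 : ℝ}, Tendsto c U (𝓝 c0) → Tendsto s U (𝓝 s0) → Tendsto (fun i => Lw (c i) (s i)) U (𝓝 (Lw c0 s0)) :=
    fun hc hs => (hc.mul hs).add ((hc.const_sub 1).mul (tendsto_const_nhds.max ((hs.const_mul 4).sub_const 3)))
  have hμ : Tendsto (fun i => mu (ri i) (cc (hi i)) (2 * π / ℓi i) (ai i) (cl (-(ri i)) (ri i) (zi i)).re) U (𝓝 (mu r (cc h) (2 * π / ℓ) a (cl (-r) r z).re)) :=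
    (hLw hcc ((hr.add cl1).div h2r n2)).max (((hLw (hcc.const_sub 1) ((hr.sub cl1).div h2r n2)).const_sub 1).min
      (hcc.add ((cl1.sub ha).div (tendsto_const_nhds.div hl l0.ne') (by have := Real.pi_pos; positivity))))
  refine (hK _ _ (fun i => ?_) ((tof hμ).add (tvi hv))).add (hz.sub cl2)
  simpa using (H i).mu_mem (ai i) (abs_le.2 (cl_mem (by linarith [(H i).r0]) _))

lemma kconst {k : ℂ → ℂ} (hc : Continuous k) (hre : ∀ z ∈ cSt 0 1, (k z).re = 0) {b : Bool}
    (hd : DifferentiableOn ℂ (fun z => φ (k (cb b z))) A) : ∀ z ∈ cSt 0 1, k z = k 0 := by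
  have cbA : ∀ z, z ∈ A → cb b z ∈ A := fun z hz => by cases b <;> simpa [cb, A] using hz
  have cb2 : ∀ z, cb b (cb b z) = z := fun z => by cases b <;> simp [cb]
  have key : ∃ w, ∀ z ∈ A, φ (k (cb b z)) = w := by
    refine ((hd.analyticOnNhd (St_open 0 1)).is_constant_or_isOpen (St_convex 0 1).isPreconnected).resolve_right fun h => ?_
    have hA : ((1 / 2 : ℝ) : ℂ) ∈ A := by constructor <;> simp <;> norm_num
    have ho := (h A le_rfl (St_open 0 1)).preimage φ.continuous
    obtain ⟨δ, hδ, hb⟩ := Metric.isOpen_iff.1 ho _ (mem_preimage.2 (mem_image_of_mem (fun z => φ (k (cb b z))) hA))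
    have hm : k (cb b ((1 / 2 : ℝ) : ℂ)) + ((δ / 2 : ℝ) : ℂ) ∈ ball (k (cb b ((1 / 2 : ℝ) : ℂ))) δ := by
      rw [mem_ball_iff_norm, add_sub_cancel_left, Complex.norm_real, Real.norm_of_nonneg (by positivity)]; linarith
    obtain ⟨z', hz', e⟩ := hb hm
    have e2 := congrArg Complex.re (φ.injective e)
    rw [Complex.add_re, Complex.ofReal_re, hre _ (St_sub _ _ (cbA _ hz')), hre _ (St_sub _ _ (cbA _ hA))] at e2
    linarith
  obtain ⟨w, hw⟩ := key
  have h2 : EqOn k (fun _ => φ.symm w) (cSt 0 1) := by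
    rw [← closure_St one_pos]
    refine EqOn.closure (fun z hz => ?_) hc continuous_const
    rw [← hw _ (cbA z hz), cb2]; simp
  intro z hz
  rw [h2 hz, h2 (by simp : (0 : ℂ) ∈ _)]

lemma osc (L : ∀ i, IsLift (φi i)) (hφ : IsLift φ) (C : Cv U φi φ) (H : ∀ i, CU (φi i) (ri i) (ℓi i) (Ki i) (hi i))
    (hr : Tendsto ri U (𝓝 0)) {xi xi' : ι → ℝ} (yi : ι → ℝ) (hx : ∀ i, xi i ∈ Icc 0 1) (hx' : ∀ i, xi' i ∈ Icc 0 1) :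
    Tendsto (fun i => Ki i (xi i + vi (yi i)) - Ki i (xi' i + vi (yi i))) U (𝓝 0) := by
  choose n hn using fun i => shift Real.two_pi_pos (Ki i (vi (yi i))).im
  have e : ∀ i z, Ki i (z + vi (yi i + n i * ℓi i)) = Ki i (z + vi (yi i)) + vi (n i * (2 * π)) := fun i z => by
    rw [vi_add, ← add_assoc, vper (H i).per]
  obtain ⟨k, ck, hk, -, b, hb⟩ := comp L hφ C (fun i => (H i).shift (yi i + n i * ℓi i)) hr (M := 1 + 2 * π) (by
    filter_upwards [hr.eventually_lt_const one_pos] with i h1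
    rw [e, zero_add]
    refine (Complex.norm_le_abs_re_add_abs_im _).trans ?_
    have h2 := abs_le.2 ((H i).mK (by simp : vi (yi i) ∈ cSt 0 1))
    rw [Complex.add_im, vi_im, Complex.add_re, vi_re, add_zero, abs_of_nonneg (hn i).1]
    linarith [(hn i).2])
  have hre : ∀ z ∈ cSt 0 1, (k z).re = 0 := fun z hz => by
    refine tendsto_nhds_unique (tre (hk (fun _ => z) z (fun _ => hz) tendsto_const_nhds))
      (squeeze_zero_norm (fun i => ?_) hr)
    exact abs_le.2 ((H i).mK (by simpa using hz))
  have kc := kconst ck hre hb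
  obtain ⟨x, h1⟩ := rlim U (u := xi) (C := 1) (.of_forall fun i => abs_le.2 ⟨by linarith [(hx i).1], (hx i).2⟩)
  obtain ⟨x', h2⟩ := rlim U (u := xi') (C := 1) (.of_forall fun i => abs_le.2 ⟨by linarith [(hx' i).1], (hx' i).2⟩)
  have m1 : x ∈ Icc 0 1 := isClosed_Icc.mem_of_tendsto h1 (.of_forall hx)
  have m2 : x' ∈ Icc 0 1 := isClosed_Icc.mem_of_tendsto h2 (.of_forall hx')
  have := (hk _ _ (fun i => by simpa using hx i) (tof h1)).sub (hk _ _ (fun i => by simpa using hx' i) (tof h2))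
  rw [kc x (by simpa using m1), kc x' (by simpa using m2), sub_self] at this
  refine this.congr fun i => ?_
  rw [e, e]; ring

lemma CU.wall0 (H : CU φ r ℓ K h) (v : ℝ) : (h ((-r : ℝ) + vi (K (vi v)).im)).im = v := by
  have : ((-r : ℝ) : ℂ) + vi (K (vi v)).im = K (vi v) := Complex.ext (by rw [H.w0 _ (by simp)]; simp) (by simp)
  rw [this, H.hK _ (by simp)]; simp
lemma CU.wall1 (H : CU φ r ℓ K h) (v : ℝ) : (h ((r : ℝ) + vi (K (1 + vi v)).im)).im = v := by
  have : ((r : ℝ) : ℂ) + vi (K (1 + vi v)).im = K (1 + vi v) := Complex.ext (by rw [H.w1 _ (by simp)]; simp) (by simp)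
  rw [this, H.hK _ (by simp)]; simp

lemma cv2 {a b x y : ℝ} (ha : 0 ≤ a) (hb : 0 ≤ b) (h : a + b = 1) (hx : x ≤ y) : x ≤ a * x + b * y ∧ a * x + b * y ≤ y := by
  obtain rfl : a = 1 - b := by linarith
  constructor <;> nlinarith

lemma CU.wbd (H : CU φ r ℓ K h) {x : ℝ} (hx : |x| ≤ r) (y e : ℝ) (z : ℂ)
    (h1 : ‖z - K (vi (wv r h x y))‖ ≤ e) (h2 : ‖z - K (1 + vi (wv r h x y))‖ ≤ e) : |z.im - y| ≤ e := by
  have hr := H.r0; have hx' := abs_le.1 hx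
  set v := wv r h x y with hv
  have m0 := (H.tau (x := -r) (by simp [hr.le])).1
  have m1 := (H.tau (x := r) (by simp [hr.le])).1
  have a1 := H.wall0 v; have a2 := H.wall1 v
  have b1 := abs_le.1 ((Complex.abs_im_le_norm _).trans h1)
  have b2 := abs_le.1 ((Complex.abs_im_le_norm _).trans h2)
  rw [Complex.sub_im] at b1 b2
  set y' := (K (vi v)).im; set y'' := (K (1 + vi v)).im
  have c1 : 0 ≤ (r - x) / (2 * r) := div_nonneg (by linarith) (by linarith)
  have c2 : 0 ≤ (r + x) / (2 * r) := div_nonneg (by linarith) (by linarith)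
  have c3 : (r - x) / (2 * r) + (r + x) / (2 * r) = 1 := by field_simp; ring
  have ev : v = (r - x) / (2 * r) * (h ((-r : ℝ) + vi y)).im + (r + x) / (2 * r) * (h ((r : ℝ) + vi y)).im := rfl
  rw [abs_le]
  rcases le_total ((h ((-r : ℝ) + vi y)).im) ((h ((r : ℝ) + vi y)).im) with g | g
  · have t := cv2 c1 c2 c3 g
    have p1 : y ≤ y' := m0.le_iff_le.1 (by simp only [a1]; rw [ev]; exact t.1)
    have p2 : y'' ≤ y := m1.le_iff_le.1 (by simp only [a2]; rw [ev]; exact t.2)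
    constructor <;> linarith
  · have t := cv2 c2 c1 (by linarith) g
    have p1 : y' ≤ y := m0.le_iff_le.1 (by simp only [a1]; rw [ev]; linarith [t.2])
    have p2 : y ≤ y'' := m1.le_iff_le.1 (by simp only [a2]; rw [ev]; linarith [t.1])
    constructor <;> linarith

theorem lim0 (L : ∀ i, IsLift (φi i)) (hφ : IsLift φ) (C : Cv U φi φ) (H : ∀ i, CU (φi i) (ri i) (ℓi i) (Ki i) (hi i))
    (hr : Tendsto ri U (𝓝 0)) (ai : ι → ℝ) {zi : ι → ℂ} {z : ℂ} (hz : Tendsto zi U (𝓝 z)) :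
    Tendsto (fun i => q (ri i) (ℓi i) (ai i) (Ki i) (hi i) (zi i)) U (𝓝 z) := by
  set X := fun i => (cl (-(ri i)) (ri i) (zi i)).re with hX
  have hXr : ∀ i, |X i| ≤ ri i := fun i => abs_le.2 (cl_mem (by linarith [(H i).r0]) (zi i))
  have hmu := fun i => (H i).mu_mem (ai i) (hXr i)
  set m := fun i => mu (ri i) (cc (hi i)) (2 * π / ℓi i) (ai i) (X i) with hm
  set v := fun i => vv (ri i) (ℓi i) (hi i) (X i) (zi i).im with hv
  have o0 := osc L hφ C H hr (xi := m) (xi' := fun _ => 0) v hmu (by simp)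
  have o1 := osc L hφ C H hr (xi := m) (xi' := fun _ => 1) v hmu (by simp)
  have X0 : Tendsto X U (𝓝 0) := squeeze_zero_norm hXr hr
  have k0 : Tendsto (fun i => (Ki i (m i + vi (v i))).re) U (𝓝 0) := squeeze_zero_norm
    (fun i => abs_le.2 ((H i).mK (by simpa using hmu i))) hr
  have k1 : Tendsto (fun i => (Ki i (m i + vi (v i))).im - (zi i).im) U (𝓝 0) := by
    have := o0.norm.add o1.norm
    simp only [norm_zero, add_zero] at this
    refine squeeze_zero_norm' ?_ this
    filter_upwards [hr.eventually_lt_const one_pos] with i h1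
    have e : v i = wv (ri i) (hi i) (X i) (zi i).im := by
      have : HS.l0 (ri i) (X i) = 0 := by
        unfold HS.l0; rw [max_eq_left]; exact (min_le_right _ _).trans (by have := abs_nonneg (X i); linarith)
      simp only [hv, vv, this]; ring
    refine (H i).wbd (hXr i) (zi i).im _ _ ?_ ?_
    · rw [← e]; simp
    · rw [← e]; simp
  have := (((tof k0).sub (tof X0)).add (tof (tre hz))).add (tvi (k1.add (tim hz)))
  have e0 : ((0 : ℝ) : ℂ) - ((0 : ℝ) : ℂ) + z.re + vi (0 + z.im) = z := Complex.ext (by simp) (by simp)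
  rw [e0] at this
  refine this.congr fun i => ?_
  apply Complex.ext
  · simp [q, hX, hm, hv]; ring
  · simp [q, hX, hm, hv, cl]

lemma sq_hol {g p : ℂ → ℂ} {U : Set ℂ} (hU : IsOpen U) (hc : ContinuousOn g U) (hp : DifferentiableOn ℂ p U) (h0 : ∀ z ∈ U, g z ≠ 0)
    (hg : ∀ z, g z ^ 2 = p z) : DifferentiableOn ℂ g U := fun z hz => by
  apply DifferentiableAt.differentiableWithinAt
  have hcont := hc.continuousAt (hU.mem_nhds hz)
  have hm := (hp.differentiableAt (hU.mem_nhds hz)).hasDerivAt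
  have key : HasDerivAt g (deriv p z / (g z + g z)) z := by
    rw [hasDerivAt_iff_tendsto_slope] at hm ⊢
    have hs : Tendsto (fun x => g x + g z) (𝓝[≠] z) (𝓝 (g z + g z)) :=
      (hcont.tendsto.mono_left nhdsWithin_le_nhds).add tendsto_const_nhds
    have hne : g z + g z ≠ 0 := by rw [← two_mul]; exact mul_ne_zero two_ne_zero (h0 z hz)
    refine (hm.div hs hne).congr' ?_
    filter_upwards [hs.eventually_ne hne] with x hx
    simp only [Pi.div_apply, slope_def_field, ← hg]
    rw [div_div, mul_comm, ← div_div]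
    congr 1
    rw [div_eq_iff hx]; ring
  exact key.differentiableAt

lemma koebe {F : ℂ → ℂ} {z : ℂ} {R : ℝ} (hR : 0 < R) (hF : DifferentiableOn ℂ F (ball z R)) (hi : InjOn F (ball z R))
    (ho : ∃ a, a ∉ F '' ball z R) {w : ℂ} (hw : ‖w - z‖ ≤ R / 32) :
    ‖F w - F z - deriv F z * (w - z)‖ ≤ 1088 * ‖deriv F z‖ * ‖w - z‖ ^ 2 / R := by
  set G := Function.invFunOn F (ball z R)
  have hG : ∀ x ∈ ball z R, G (F x) = x := fun x hx => hi.leftInvOn_invFunOn hx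
  obtain ⟨oΩ, dG⟩ := inv_hol isOpen_ball hF hG
  set Ω := F '' ball z R with hΩ
  have hz : z ∈ ball z R := mem_ball_self hR
  obtain ⟨a, ha, hd⟩ := (oΩ.isClosed_compl).exists_infDist_eq_dist (s := Ωᶜ) ho (F z)
  have hb : ball (F z) (infDist (F z) Ωᶜ) ⊆ Ω := ball_infDist_compl_subset
  set d := infDist (F z) Ωᶜ
  have hd0 : 0 < d := by rw [hd, dist_pos]; rintro rfl; exact ha ⟨z, hz, rfl⟩
  have Gm : ∀ y ∈ Ω, G y ∈ ball z R ∧ F (G y) = y := by rintro _ ⟨x, hx, rfl⟩; rw [hG x hx]; exact ⟨hx, rfl⟩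
  have dFz := (hF.differentiableAt (isOpen_ball.mem_nhds hz)).hasDerivAt
  have hdR : d ≤ R * ‖deriv F z‖ := by
    have h1 := Complex.norm_deriv_le_div_of_mapsTo_ball (f := G) (c := F z) (R₁ := d) (R₂ := R) (dG.mono hb)
      (fun y hy => by rw [hG z hz]; exact ball_subset_closedBall (Gm y (hb hy)).1) hd0
    have h2 : HasDerivAt G (deriv G (F z)) (F z) := (dG.differentiableAt (oΩ.mem_nhds ⟨z, hz, rfl⟩)).hasDerivAt
    have h3 := (h2.comp z dFz).congr_of_eventuallyEq (f₁ := id)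
      (by filter_upwards [isOpen_ball.mem_nhds hz] with x hx; exact (hG x hx).symm)
    have h4 := congrArg norm (h3.unique (hasDerivAt_id z))
    rw [norm_mul, norm_one] at h4
    rw [le_div_iff₀ hd0] at h1
    calc d = ‖deriv G (F z)‖ * d * ‖deriv F z‖ := by rw [mul_right_comm, h4, one_mul]
      _ ≤ _ := by gcongr
  set B := a - F z with hB
  have hBd : ‖B‖ = d := by rw [hd, dist_comm, dist_eq_norm]
  have hB0 : B ≠ 0 := by rw [← norm_pos_iff, hBd]; exact hd0
  set p : ℂ → ℂ := fun x => 1 - (F x - F z) / B with hp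
  have dp : DifferentiableOn ℂ p (ball z R) := by
    have := hF; simp only [hp]; fun_prop
  have p0 : ∀ x ∈ ball z R, p x ≠ 0 := fun x hx e => ha ⟨x, hx, by
    simp only [hp, sub_eq_zero, eq_div_iff hB0] at e; linear_combination -e⟩
  obtain ⟨g, gc, hg, gz⟩ : ∃ g, ContinuousOn g (ball z R) ∧ (∀ x, g x ^ 2 = p x) ∧ g z = 1 := by
    have hs : IsSimplyConnected (ball z R) := by
      have : ContractibleSpace (ball z R) := (convex_ball z R).contractibleSpace ⟨z, hz⟩
      exact inferInstanceAs (SimplyConnectedSpace (ball z R))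
    obtain ⟨g, gc, hg⟩ := Complex.exists_continuousOn_pow_eq hs isOpen_ball dp.continuousOn
      (by rintro ⟨x, hx, e⟩; exact p0 x hx e) two_ne_zero
    have : g z ^ 2 = 1 := by rw [hg]; simp [hp]
    rcases sq_eq_one_iff.1 this with h | h
    · exact ⟨g, gc, hg, h⟩
    · exact ⟨fun x => - g x, gc.neg, fun x => by rw [neg_sq, hg], by simp [h]⟩
  have g0 : ∀ x ∈ ball z R, g x ≠ 0 := fun x hx e => p0 x hx (by rw [← hg, e]; simp)
  have dg := sq_hol isOpen_ball gc dp g0 hg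
  have pb : ∀ x, ‖p x - 1‖ < 1 ↔ F x ∈ ball (F z) d := fun x => by
    rw [mem_ball_iff_norm, ← hBd]; simp only [hp]
    rw [show 1 - (F x - F z) / B - 1 = -((F x - F z) / B) by ring, norm_neg, norm_div, div_lt_one (by rw [hBd]; exact hd0)]
  have gpos : ∀ x ∈ ball z R, ‖p x - 1‖ < 1 → 0 < (g x).re := by
    have hpre : IsPreconnected ((fun y => (g (G y)).re) '' ball (F z) d) := by
      refine (convex_ball _ _).isPreconnected.image _ (Complex.continuous_re.comp_continuousOn ?_)
      exact gc.comp (dG.mono hb).continuousOn fun y hy => (Gm y (hb hy)).1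
    intro x hx hpx
    by_contra! hneg
    have := hpre.ordConnected.out ⟨F x, (pb x).1 hpx, by beta_reduce; rw [hG x hx]⟩ ⟨F z, mem_ball_self hd0, by beta_reduce; rw [hG z hz, gz]⟩
    obtain ⟨y, hy, e⟩ := this ⟨hneg, by simp⟩
    obtain ⟨h1, h2⟩ := Gm y (hb hy)
    have h3 := (pb (G y)).2 (by rwa [h2])
    have h4 := (abs_lt.1 ((Complex.abs_re_le_norm _).trans_lt h3)).1
    rw [← hg, Complex.sub_re, Complex.one_re, pow_two, Complex.mul_re] at h4
    beta_reduce at e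
    rw [e] at h4; nlinarith
  have gom : ∀ x ∈ ball z R, 1 / 3 ≤ ‖g x + 1‖ := fun x hx => by
    by_contra! h
    have h1 : ‖g x - 1‖ ≤ 7 / 3 := by
      have : g x - 1 = (g x + 1) - 2 := by ring
      rw [this]; refine (norm_sub_le _ _).trans ?_; norm_num; linarith
    have h2 : ‖p x - 1‖ < 1 := by
      rw [← hg, show g x ^ 2 - 1 = (g x - 1) * (g x + 1) by ring, norm_mul]
      nlinarith [norm_nonneg (g x - 1), norm_nonneg (g x + 1)]
    have h3 := gpos x hx h2
    have h4 := (abs_lt.1 ((Complex.abs_re_le_norm _).trans_lt h)).2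
    simp at h4; linarith
  have gn : ∀ x ∈ ball z R, g x + 1 ≠ 0 := fun x hx e => by
    have := gom x hx; rw [e, norm_zero] at this; linarith
  set m : ℂ → ℂ := fun x => (g x + 1)⁻¹ with hm
  have mz : m z = 1 / 2 := by simp only [hm, gz]; norm_num
  have dm : DifferentiableOn ℂ m (ball z R) := (dg.add_const 1).inv gn
  have mb : ∀ x ∈ ball z R, ‖m x‖ ≤ 3 := fun x hx => by
    simp only [hm]; rw [norm_inv]
    exact (inv_anti₀ (by norm_num) (gom x hx)).trans (by norm_num)
  have mm : MapsTo m (ball z R) (closedBall (m z) 4) := fun x hx => by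
    rw [mem_closedBall_iff_norm, mz]
    refine (norm_sub_le _ _).trans ?_
    have := mb x hx; norm_num; linarith
  have Fm : ∀ x ∈ ball z R, F x = F z + B * (8 * (m x - 1 / 2) / (1 + 2 * (m x - 1 / 2)) ^ 2) := fun x hx => by
    have e1 : F x - F z = B * (1 - g x ^ 2) := by rw [hg]; simp only [hp]; field_simp; ring
    have e2 := gn x hx
    have e3 : 8 * (m x - 1 / 2) / (1 + 2 * (m x - 1 / 2)) ^ 2 = 1 - g x ^ 2 := by
      have : 1 + 2 * (m x - 1 / 2) = 2 * m x := by ring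
      rw [this]; simp only [hm]; field_simp; ring
    rw [e3]; linear_combination e1
  have hwR : w ∈ ball z R := by rw [mem_ball_iff_norm]; linarith
  have F' : deriv F z = 8 * B * deriv m z := by
    have h1 := (dm.differentiableAt (isOpen_ball.mem_nhds hz)).hasDerivAt
    have h2 := ((((h1.sub_const (1 / 2)).const_mul 8).div ((((h1.sub_const (1 / 2)).const_mul 2).const_add 1).pow 2)
      (by simp [mz])).const_mul B).const_add (F z)
    have h3 := h2.congr_of_eventuallyEq (f₁ := F) (by filter_upwards [isOpen_ball.mem_nhds hz] with x hx; exact Fm x hx)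
    rw [dFz.unique h3]; simp [mz]; ring
  have s1 : ‖m w - 1 / 2‖ ≤ 4 / R * ‖w - z‖ := by
    have := Complex.dist_le_div_mul_dist_of_mapsTo_ball dm mm hwR
    rwa [mz, dist_eq_norm, dist_eq_norm] at this
  have s2 : ‖m w - 1 / 2 - deriv m z * (w - z)‖ ≤ 8 / R / R * ‖w - z‖ * ‖w - z‖ := by
    have h1 : ∀ x ∈ ball z R, ‖dslope m z x‖ ≤ 4 / R := fun x hx => Complex.norm_dslope_le_div_of_mapsTo_ball dm mm hx
    have h2 := Complex.dist_le_div_mul_dist_of_mapsTo_ball (f := dslope m z) (R₂ := 8 / R)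
      ((Complex.differentiableOn_dslope (isOpen_ball.mem_nhds hz)).2 dm) (fun x hx => by
        rw [mem_closedBall_iff_norm]; refine (norm_sub_le _ _).trans ((add_le_add (h1 x hx) (h1 z hz)).trans_eq (by ring))) hwR
    rw [dslope_same, dist_eq_norm, dist_eq_norm] at h2
    have h3 : m w - 1 / 2 = dslope m z w * (w - z) := by
      have := sub_smul_dslope m z w; rw [mz, smul_eq_mul] at this; rw [← this]; ring
    rw [h3, ← sub_mul, norm_mul]; gcongr
  set η := ‖w - z‖ / R with hη
  have hη1 : η ≤ 1 / 32 := by rw [hη, div_le_iff₀ hR]; linarith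
  have hη0 : 0 ≤ η := by positivity
  set δ := m w - 1 / 2 with hδ
  have t1 : ‖δ‖ ≤ 4 * η := s1.trans_eq (by rw [hη]; ring)
  have t2 : ‖δ - deriv m z * (w - z)‖ ≤ 8 * η ^ 2 := s2.trans_eq (by rw [hη]; ring)
  have t3 : 3 / 4 ≤ ‖1 + 2 * δ‖ := by
    have := norm_sub_norm_le (1 : ℂ) (-(2 * δ)); rw [sub_neg_eq_add, norm_neg, norm_mul, norm_one] at this
    norm_num at this; linarith
  have t4 : 1 + 2 * δ ≠ 0 := fun e => by rw [e, norm_zero] at t3; linarith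
  have t5 : ‖δ / (1 + 2 * δ) ^ 2 - δ‖ ≤ 128 * η ^ 2 := by
    have e : δ / (1 + 2 * δ) ^ 2 - δ = -(4 * δ * δ * (1 + δ)) / (1 + 2 * δ) ^ 2 := by
      rw [eq_div_iff (pow_ne_zero 2 t4), sub_mul, div_mul_cancel₀ _ (pow_ne_zero 2 t4)]; ring
    rw [e, norm_div, norm_neg, norm_mul, norm_mul, norm_mul, norm_pow, div_le_iff₀ (by positivity)]
    have h1 : ‖1 + δ‖ ≤ 9 / 8 := (norm_add_le _ _).trans (by rw [norm_one]; linarith)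
    have h4 : ‖(4 : ℂ)‖ = 4 := by norm_num
    rw [h4]
    calc 4 * ‖δ‖ * ‖δ‖ * ‖1 + δ‖ ≤ 4 * (4 * η) * (4 * η) * (9 / 8) := by gcongr
      _ = 128 * η ^ 2 * (3 / 4) ^ 2 := by ring
      _ ≤ _ := by gcongr
  have e : F w - F z - deriv F z * (w - z) = 8 * B * ((δ / (1 + 2 * δ) ^ 2 - δ) + (δ - deriv m z * (w - z))) := by
    rw [Fm w hwR, F']; ring
  rw [e, norm_mul, norm_mul, hBd]
  have h8 : ‖(8 : ℂ)‖ = 8 := by norm_num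
  rw [h8]
  calc 8 * d * _ ≤ 8 * (R * ‖deriv F z‖) * (128 * η ^ 2 + 8 * η ^ 2) := by
        gcongr; exact (norm_add_le _ _).trans (add_le_add t5 t2)
    _ = _ := by rw [hη]; field_simp; ring

lemma CU.orient (H : CU φ r ℓ K h) (hφ : IsLift φ) (h1 : ∀ z : ℂ, z.re = -r → (φ z).re ≤ -1)
    (h2 : ∀ z : ℂ, z.re = r → 1 ≤ (φ z).re) : DifferentiableOn ℂ (fun z => φ (K z)) A := by
  refine H.hol.resolve_right fun hb => ?_
  have hl := H.l0
  set f : ℂ → ℂ := fun z => φ (K ((starRingEnd ℂ) z)) + (2 * π / ℓ : ℝ) * z with hf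
  have cf : Continuous f := by have := H.cK; have := Complex.continuous_conj; have := φ.continuous; fun_prop
  have hp : ∀ x : ℝ, f (x + (ℓ : ℝ) * Complex.I) = f (x + ((0 : ℝ) : ℂ) * Complex.I) := fun x => by
    have e1 : (starRingEnd ℂ) ((x : ℂ) + ((0 : ℝ) : ℂ) * Complex.I) = (starRingEnd ℂ) ((x : ℂ) + (ℓ : ℝ) * Complex.I) + vi ℓ := by simp [vi]
    have e2 : ((2 * π / ℓ : ℝ) : ℂ) * ((ℓ : ℂ) * Complex.I) = vi (2 * π) := by
      rw [← mul_assoc, ← Complex.ofReal_mul, div_mul_cancel₀ _ hl.ne']; rfl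
    simp only [hf]; rw [e1, H.per, hφ.per', ← e2]; simp; ring
  have key := Complex.integral_boundary_rect_eq_zero_of_continuousOn_of_differentiableOn f 0 (1 + vi ℓ) cf.continuousOn (by
    refine DifferentiableOn.add (hb.mono fun z hz => ?_) (by fun_prop)
    have := hz.1; simpa [A, St] using this)
  simp only [Complex.zero_re, Complex.zero_im, Complex.add_re, Complex.one_re, vi_re, add_zero, Complex.add_im, Complex.one_im, vi_im, zero_add, hp,
    sub_self, ← smul_sub, smul_eq_zero, Complex.I_ne_zero, false_or, sub_eq_zero] at key
  have ci : ∀ x : ℝ, IntervalIntegrable (fun y : ℝ => f (x + y * Complex.I)) volume 0 ℓ := fun x =>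
    Continuous.intervalIntegrable (by fun_prop) _ _
  have kre := congrArg Complex.re key
  have er : ∀ x : ℝ, (∫ y in (0:ℝ)..ℓ, f (x + y * Complex.I)).re = ∫ y in (0:ℝ)..ℓ, (f (x + y * Complex.I)).re := fun x =>
    (Complex.reCLM.intervalIntegral_comp_comm (ci x)).symm
  rw [er, er] at kre
  have m1 : ∫ y in (0:ℝ)..ℓ, (f ((0 : ℝ) + y * Complex.I)).re ≤ ∫ y in (0:ℝ)..ℓ, (-1 : ℝ) :=
    intervalIntegral.integral_mono_on hl.le (Continuous.intervalIntegrable (by fun_prop) _ _) (by simp) fun y _ => by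
      have := h1 (K ((starRingEnd ℂ) ((0 : ℝ) + y * Complex.I))) (H.w0 _ (by simp)); simpa [hf] using this
  have m2 : ∫ y in (0:ℝ)..ℓ, (1 : ℝ) ≤ ∫ y in (0:ℝ)..ℓ, (f ((1 : ℝ) + y * Complex.I)).re :=
    intervalIntegral.integral_mono_on hl.le (by simp) (Continuous.intervalIntegrable (by fun_prop) _ _) fun y _ => by
      have := h2 (K ((starRingEnd ℂ) ((1 : ℝ) + y * Complex.I))) (H.w1 _ (by simp))
      have h3 : 0 ≤ 2 * π / ℓ := by have := Real.pi_pos; positivity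
      simp only [hf, Complex.add_re, Complex.mul_re, Complex.ofReal_re, Complex.ofReal_im]; simp; simp at this h3; linarith
  rw [kre] at m2
  simp at m1 m2; linarith

lemma CU.glin (H : CU φ r ℓ K h) (hφ : IsLift φ) (hb : DifferentiableOn ℂ (fun z => φ (K z)) A) {R : ℝ} (hS : St (-R) R ⊆ φ '' St (-r) r)
    (hR : 1088 * 8 * π ≤ R) {z w : ℂ} (hz : |z.re| ≤ R / 2) {D : ℝ} (hw : ‖w - z‖ ≤ D) (hD : D ≤ R / 64) :
    ‖h (φ.symm w) - h (φ.symm z) - (ℓ / (2 * π) : ℝ) * (w - z)‖ ≤ ℓ / (2 * π) * (4352 * D * (2 * π + D) / R) := by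
  have hl := H.l0; have hpi := Real.pi_pos
  obtain ⟨-, -, hd⟩ := H.ghol (b := false) (by simpa [cb] using hb)
  have hR0 : 0 < R := by nlinarith
  set g : ℂ → ℂ := fun w => h (φ.symm w)
  have hd' : DifferentiableOn ℂ g (φ '' St (-r) r) := by simpa [cb] using hd
  have hbs : ball z (R / 2) ⊆ φ '' St (-r) r := fun x hx => hS (by
    have h1 := abs_lt.1 ((Complex.abs_re_le_norm _).trans_lt (mem_ball_iff_norm.1 hx))
    have h2 := abs_le.1 hz; rw [Complex.sub_re] at h1
    constructor <;> linarith)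
  have gi : InjOn g (ball z (R / 2)) := fun x hx y hy e => by
    obtain ⟨x, hx', rfl⟩ := hbs hx; obtain ⟨y, hy', rfl⟩ := hbs hy
    simp only [g, Homeomorph.symm_apply_apply] at e
    rw [← H.Kh x (St_sub _ _ hx'), e, H.Kh y (St_sub _ _ hy')]
  have go : ∃ a, a ∉ g '' ball z (R / 2) := ⟨2, by
    rintro ⟨x, hx, e⟩; obtain ⟨x, hx', rfl⟩ := hbs hx
    have := (H.mS hx').2
    simp only [g, Homeomorph.symm_apply_apply] at e; rw [e] at this; norm_num at this⟩
  have kb := fun w hw => koebe (F := g) (z := z) (w := w) (half_pos hR0) (hd'.mono hbs) gi go hw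
  set t := ℓ / (2 * π) with ht
  have ht0 : 0 < t := by positivity
  have e1 : g (z + vi (2 * π)) - g z = (t : ℂ) * vi (2 * π) := by
    obtain ⟨x, hx, e⟩ := hbs (mem_ball_self (half_pos hR0))
    simp only [g]; rw [← e, ← hφ.per']; simp only [Homeomorph.symm_apply_apply]
    rw [H.hper (St_sub _ _ hx), add_sub_cancel_left, vi, vi, ← mul_assoc, ← Complex.ofReal_mul, ht, div_mul_cancel₀ _ (by positivity)]
  have k1 := kb (z + vi (2 * π)) (by rw [add_sub_cancel_left, norm_vi, abs_of_pos (by positivity)]; linarith)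
  rw [add_sub_cancel_left, e1, ← sub_mul, norm_mul, norm_vi, abs_of_pos (by positivity : 0 < 2 * π)] at k1
  set d := deriv g z
  have k2 : ‖(t : ℂ) - d‖ ≤ ‖d‖ * (4352 * π / R) := by
    have e : 1088 * ‖d‖ * (2 * π) ^ 2 / (R / 2) = ‖d‖ * (4352 * π / R) * (2 * π) := by field_simp; ring
    rw [e] at k1; exact le_of_mul_le_mul_right k1 (by positivity)
  have k3 : 4352 * π / R ≤ 1 / 2 := by rw [div_le_iff₀ hR0]; linarith
  have k4 : ‖d‖ ≤ 2 * t := by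
    have := norm_sub_norm_le d t
    rw [norm_sub_rev, Complex.norm_real, Real.norm_of_nonneg ht0.le] at this
    nlinarith [norm_nonneg d]
  have k5 := kb w (hw.trans (by linarith))
  have e : g w - g z - t * (w - z) = (g w - g z - d * (w - z)) - ((t : ℂ) - d) * (w - z) := by ring
  have hD0 := (norm_nonneg _).trans hw
  rw [e]; refine (norm_sub_le _ _).trans ?_
  rw [norm_mul]
  calc _ ≤ 1088 * (2 * t) * D ^ 2 / (R / 2) + 2 * t * (4352 * π / R) * D := by
        refine add_le_add (k5.trans ?_) ?_
        · gcongr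
        · gcongr; exact k2.trans (by gcongr)
    _ = t * (4352 * D * (2 * π + D) / R) := by field_simp; ring

lemma evS (C : Cv U φi φ) (hr : Tendsto ri U atTop) (R : ℝ) : ∀ᶠ i in (U : Filter ι), St (-R) R ⊆ φi i '' St (-(ri i)) (ri i) := by
  obtain ⟨N, hN⟩ := C.top R; obtain ⟨N', hN'⟩ := C.bot (-R)
  filter_upwards [hN, hN', hr.eventually_gt_atTop N, hr.eventually_gt_atTop (-N')] with i h1 h2 h3 h4 w hw
  refine ⟨(φi i).symm w, ⟨?_, ?_⟩, by simp⟩ <;> by_contra! h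
  · have := h2 ((φi i).symm w) (by linarith)
    simp at this; linarith [hw.1]
  · have := h1 ((φi i).symm w) (by linarith)
    simp at this; linarith [hw.2]

lemma evO (L : ∀ i, IsLift (φi i)) (C : Cv U φi φ) (H : ∀ i, CU (φi i) (ri i) (ℓi i) (Ki i) (hi i))
    (hr : Tendsto ri U atTop) : ∀ᶠ i in (U : Filter ι), DifferentiableOn ℂ (fun z => φi i (Ki i z)) A := by
  obtain ⟨N, hN⟩ := C.top 1; obtain ⟨N', hN'⟩ := C.bot (-1)
  filter_upwards [hN, hN', hr.eventually_gt_atTop N, hr.eventually_gt_atTop (-N')] with i h1 h2 h3 h4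
  exact (H i).orient (L i) (fun z hz => h2 z (by linarith)) fun z hz => h1 z (by linarith)

lemma star (L : ∀ i, IsLift (φi i)) (C : Cv U φi φ) (H : ∀ i, CU (φi i) (ri i) (ℓi i) (Ki i) (hi i))
    (hr : Tendsto ri U atTop) (D : ℝ) {ε : ℝ} (hε : 0 < ε) : ∀ᶠ i in (U : Filter ι), ∀ w : ℂ, ‖w‖ ≤ D →
    ‖hi i ((φi i).symm w) - (cc (hi i) + vi (mm (ℓi i) (hi i))) - (ℓi i / (2 * π) : ℝ) * (w - (aa (φi i) + vi (bb (φi i))))‖ ≤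
      ℓi i / (2 * π) * ε := by
  have hpi := Real.pi_pos
  have l0 := (C.lim (wi := fun _ => 0) (w := 0) tendsto_const_nhds).norm.eventually_le_const (lt_add_one _)
  have l1 := (C.lim (wi := fun _ => vi π) (w := vi π) tendsto_const_nhds).norm.eventually_le_const (lt_add_one _)
  set D' := ‖φ 0‖ + 1 + (‖φ (vi π)‖ + 1) + |D|
  have hD' : 0 < D' := by positivity
  set R := 1088 * 8 * π + 64 * (2 * D') + 4352 * (2 * D') * (2 * π + 2 * D') / ε with hR
  have hq : 0 < 4352 * (2 * D') * (2 * π + 2 * D') / ε := by positivity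
  filter_upwards [l0, l1, evS C hr R, evO L C H hr] with i h0 h1 h2 h3 w hw
  have hl := (H i).l0
  have b0 : ‖φi i 0‖ ≤ D' := by simp only [D']; linarith [norm_nonneg (φ (vi π)), abs_nonneg D]
  have b1 : ‖φi i (vi π)‖ ≤ D' := by simp only [D']; linarith [norm_nonneg (φ 0), abs_nonneg D]
  have b2 : ‖w‖ ≤ D' := by simp only [D']; linarith [norm_nonneg (φ 0), norm_nonneg (φ (vi π)), le_abs_self D]
  have hR1 : 1088 * 8 * π ≤ R := by rw [hR]; linarith
  have key : ∀ z, ‖z‖ ≤ D' → ‖hi i ((φi i).symm w) - hi i ((φi i).symm z) - (ℓi i / (2 * π) : ℝ) * (w - z)‖ ≤ ℓi i / (2 * π) * ε := fun z hz => by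
    have := (H i).glin (L i) h3 h2 hR1 (z := z) (w := w) ((Complex.abs_re_le_norm z).trans (by linarith))
      (D := 2 * D') ((norm_sub_le _ _).trans (by linarith)) (by linarith)
    refine this.trans (mul_le_mul_of_nonneg_left ?_ (by positivity))
    have hR0 : 0 < R := by linarith
    rw [div_le_iff₀ hR0, mul_comm ε, ← div_le_iff₀ hε, hR]; linarith
  have k0 := key _ b0; have k1 := key _ b1
  simp only [Homeomorph.symm_apply_apply] at k0 k1
  set u := hi i ((φi i).symm w)
  have e1 : (hi i 0 + hi i (vi π)) / 2 = cc (hi i) + vi (mm (ℓi i) (hi i)) + vi (ℓi i / 4) := by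
    apply Complex.ext <;> simp [cc, mm]
  have e2 : (φi i 0 + φi i (vi π)) / 2 = aa (φi i) + vi (bb (φi i)) + vi (π / 2) := by
    apply Complex.ext <;> simp [aa, bb]
  have e3 : ((ℓi i / (2 * π) : ℝ) : ℂ) * vi (π / 2) = vi (ℓi i / 4) := by
    rw [vi, vi, ← mul_assoc, ← Complex.ofReal_mul]; congr 2; field_simp; norm_num
  have e : u - (cc (hi i) + vi (mm (ℓi i) (hi i))) - (ℓi i / (2 * π) : ℝ) * (w - (aa (φi i) + vi (bb (φi i)))) =
      ((u - hi i 0 - (ℓi i / (2 * π) : ℝ) * (w - φi i 0)) + (u - hi i (vi π) - (ℓi i / (2 * π) : ℝ) * (w - φi i (vi π)))) / 2 := by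
    linear_combination e1 - ((ℓi i / (2 * π) : ℝ) : ℂ) * e2 - e3
  rw [e, norm_div]
  have := norm_add_le (u - hi i 0 - (ℓi i / (2 * π) : ℝ) * (w - φi i 0)) (u - hi i (vi π) - (ℓi i / (2 * π) : ℝ) * (w - φi i (vi π)))
  norm_num at *; linarith

lemma Cv.aa (C : Cv U φi φ) : Tendsto (fun i => aa (φi i)) U (𝓝 (aa φ)) :=
  (((Complex.continuous_re.tendsto _).comp (C.lim (wi := fun _ => 0) tendsto_const_nhds)).add
    ((Complex.continuous_re.tendsto _).comp (C.lim (wi := fun _ => vi π) tendsto_const_nhds))).div_const 2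
lemma Cv.bb (C : Cv U φi φ) : Tendsto (fun i => bb (φi i)) U (𝓝 (bb φ)) :=
  ((((Complex.continuous_im.tendsto _).comp (C.lim (wi := fun _ => 0) tendsto_const_nhds)).add
    ((Complex.continuous_im.tendsto _).comp (C.lim (wi := fun _ => vi π) tendsto_const_nhds))).div_const 2).sub_const _

theorem limInf (L : ∀ i, IsLift (φi i)) (C : Cv U φi φ) (H : ∀ i, CU (φi i) (ri i) (ℓi i) (Ki i) (hi i))
    (hr : Tendsto ri U atTop) {zi : ι → ℂ} {z : ℂ} (hz : Tendsto zi U (𝓝 z)) :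
    Tendsto (fun i => φi i (q (ri i) (ℓi i) (aa (φi i)) (Ki i) (hi i) (zi i))) U (𝓝 (z + vi (bb φ))) := by
  have hpi := Real.pi_pos
  have la := C.aa; have lb := C.bb
  set W := z + vi (bb φ) with hW
  have lw : Tendsto (fun i => W - zi i - vi (bb (φi i))) U (𝓝 0) := by
    have := (tendsto_const_nhds (x := W)).sub hz |>.sub ((by unfold vi; fun_prop : Continuous vi).tendsto _ |>.comp lb)
    simpa [hW] using this
  rw [Metric.tendsto_nhds]; intro ε' hε'
  obtain ⟨ε, hε, hε1⟩ := exists_between hε'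
  set X := |z.re| + 1
  set A0 := |aa φ| + 1
  set B := 6 * (A0 + X + 1) with hB
  set D := ‖W‖ + ε + B with hD
  have hA0 : 1 ≤ A0 := by simp [A0]
  have hX1 : 1 ≤ X := by simp [X]
  have hW0 := norm_nonneg W
  filter_upwards [star L C H hr D (ε := min (ε / 16) 1) (by positivity), evS C hr (D + 1), evO L C H hr,
    la.abs.eventually_lt_const (lt_add_one _), ((Complex.continuous_re.tendsto _).comp hz).abs.eventually_lt_const (lt_add_one _),
    hr.eventually_ge_atTop (2 * X + 2), (tendsto_zero_iff_norm_tendsto_zero.1 lw).eventually_lt_const (by positivity : 0 < ε / 16)] with i hs hS ho ha hx hri hw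
  have hl := (H i).l0; have H' := H i
  have hx : |(zi i).re| ≤ X := hx.le
  have ha : |aa (φi i)| ≤ A0 := ha.le
  set t := ℓi i / (2 * π) with ht
  have ht0 : 0 < t := by positivity
  set c := cc (hi i); set a := aa (φi i); set m := mm (ℓi i) (hi i); set u : ℂ → ℂ := fun w => hi i ((φi i).symm w)
  have mem : ∀ w : ℂ, ‖w‖ ≤ D → w ∈ φi i '' St (-(ri i)) (ri i) := fun w hw => hS (abs_lt.1 ((Complex.abs_re_le_norm w).trans_lt (by linarith)))
  have mem' : ∀ w : ℂ, ‖w‖ ≤ D → (φi i).symm w ∈ St (-(ri i)) (ri i) := fun w hw => by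
    obtain ⟨x, hx, rfl⟩ := mem w hw; simpa using hx
  have B1 : ∀ s : ℝ, |s| = B → |(u s).re - c - t * (s - a)| ≤ t := fun s hs' => by
    have h1 := hs s (by rw [Complex.norm_real, Real.norm_eq_abs, hs']; linarith)
    have h2 := (Complex.abs_re_le_norm _).trans (h1.trans (mul_le_mul_of_nonneg_left (min_le_right _ _) ht0.le))
    simpa [← sub_sub] using h2
  have hBp : 0 < B := by linarith
  have u0 : ∀ s : ℝ, |s| = B → 0 ≤ (u s).re ∧ (u s).re ≤ 1 := fun s hs =>
    H'.mh (St_sub _ _ (mem' s (by rw [Complex.norm_real, Real.norm_eq_abs, hs]; linarith)))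
  have p1 := abs_le.1 (B1 (-B) (by rw [abs_neg, abs_of_pos hBp])); have p2 := abs_le.1 (B1 B (abs_of_pos hBp))
  have p3 := u0 (-B) (by rw [abs_neg, abs_of_pos hBp]); have p4 := u0 B (abs_of_pos hBp)
  have hx' := abs_le.1 hx; have ha' := abs_le.1 ha
  have q1 : 4 * t * (A0 + X) ≤ c := by
    have := mul_le_mul_of_nonneg_left (by linarith : 4 * (A0 + X) ≤ B + a - 1) ht0.le
    linarith [p1.2, p3.1]
  have q2 : 4 * t * (A0 + X) ≤ 1 - c := by
    have := mul_le_mul_of_nonneg_left (by linarith : 4 * (A0 + X) ≤ B - a - 1) ht0.le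
    linarith [p2.1, p4.2]
  have hr0 : 0 < ri i := by linarith
  have Lq : ∀ c s : ℝ, s ≤ 3 / 4 → Lw c s = c * s := fun c s h => by unfold Lw; rw [max_eq_left (by linarith)]; ring
  have s1 : (ri i + (zi i).re) / (2 * ri i) ≤ 3 / 4 := by rw [div_le_iff₀ (by linarith)]; linarith
  have s2 : (ri i - (zi i).re) / (2 * ri i) ≤ 3 / 4 := by rw [div_le_iff₀ (by linarith)]; linarith
  have em : mu (ri i) c (2 * π / ℓi i) a (zi i).re = c + t * ((zi i).re - a) := by
    have e : ((zi i).re - a) / (2 * π / ℓi i) = t * ((zi i).re - a) := by rw [ht]; field_simp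
    have cp : 0 ≤ c := le_trans (by positivity) q1
    have cp' : 0 ≤ 1 - c := le_trans (by positivity) q2
    have n1 := mul_le_mul_of_nonneg_left s1 cp; have n2 := mul_le_mul_of_nonneg_left s2 cp'
    have n3 := mul_le_mul_of_nonneg_left (by linarith : (zi i).re - a ≤ A0 + X) ht0.le
    have n4 := mul_le_mul_of_nonneg_left (by linarith : -(A0 + X) ≤ (zi i).re - a) ht0.le
    unfold mu; rw [Lq _ _ s1, Lq _ _ s2, e, min_eq_right, max_eq_right] <;> linarith
  have ev : vv (ri i) (ℓi i) (hi i) (zi i).re (zi i).im = t * (zi i).im + m := by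
    have : HS.l0 (ri i) (zi i).re = 1 := by unfold HS.l0; rw [min_eq_left, max_eq_right] <;> linarith
    unfold vv; rw [this]; ring
  have hzc : zi i ∈ cSt (-(ri i)) (ri i) := abs_le.1 (by linarith)
  rw [q_in _ hzc, em, ev]
  set p : ℂ := ((c + t * ((zi i).re - a) : ℝ) : ℂ) + vi (t * (zi i).im + m) with hp
  have ep : p = c + vi m + t * (zi i - a) := by apply Complex.ext <;> simp [hp]; ring
  have dW : ∀ w ∈ closedBall W ε, ‖w‖ ≤ D := fun w hw => by
    have := norm_le_norm_add_norm_sub' w W; rw [mem_closedBall_iff_norm] at hw; linarith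
  have WW := mem_closedBall_self (x := W) hε.le
  have hs' : ∀ w ∈ closedBall W ε, ‖u w - (c + vi m) - t * (w - (a + vi (bb (φi i))))‖ ≤ t * (ε / 16) := fun w hw =>
    (hs w (dW w hw)).trans (mul_le_mul_of_nonneg_left (min_le_left _ _) ht0.le)
  have nt : ‖(t : ℂ)‖ = t := by rw [Complex.norm_real, Real.norm_of_nonneg ht0.le]
  have inj : ∀ w, ‖w‖ ≤ D → ∀ y, u w = y → φi i (Ki i y) = w := fun w hw y e => by
    rw [← e]; simp only [u]; rw [H'.Kh _ (St_sub _ _ (mem' w hw))]; simp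
  obtain ⟨-, -, hd⟩ := H'.ghol (b := false) (by simpa [cb] using ho)
  have hd' : DifferentiableOn ℂ u (φi i '' St (-(ri i)) (ri i)) := by simpa [cb] using hd
  have key := DiffContOnCl.ball_subset_image_closedBall (f := u) (z₀ := W) (r := ε) (ε := t * (3 * ε / 4))
    (hd'.diffContOnCl_ball fun w hw => mem w (dW w hw)) hε (fun w hw => ?_) ?_
  · obtain ⟨w, hw, e⟩ := key (a := p) (by
      rw [mem_ball_iff_norm, ep]
      have e : (c : ℂ) + vi m + t * (zi i - a) - u W = -(u W - (c + vi m) - t * (W - (a + vi (bb (φi i))))) - t * (W - zi i - vi (bb (φi i))) := by ring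
      rw [e]; refine (norm_sub_le _ _).trans_lt ?_
      rw [norm_neg, norm_mul, nt]; have h1 := hs' W WW; have h2 := mul_lt_mul_of_pos_left hw ht0; have h3 := mul_pos ht0 hε; linarith)
    rw [inj w (dW w hw) p e]; exact (mem_closedBall.1 hw).trans_lt hε1
  · have e : u w - u W = (u w - (c + vi m) - t * (w - (a + vi (bb (φi i))))) - (u W - (c + vi m) - t * (W - (a + vi (bb (φi i))))) + t * (w - W) := by ring
    have h1 := hs' w (sphere_subset_closedBall hw); have h2 := hs' W WW
    have h3 : ‖(t : ℂ) * (w - W)‖ = t * ε := by rw [norm_mul, nt, mem_sphere_iff_norm.1 hw]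
    have h4 := norm_sub_le (u w - (c + vi m) - t * (w - (a + vi (bb (φi i))))) (u W - (c + vi m) - t * (W - (a + vi (bb (φi i)))))
    have h5 := norm_sub_le_norm_add (t * (w - W)) ((u w - (c + vi m) - t * (w - (a + vi (bb (φi i))))) - (u W - (c + vi m) - t * (W - (a + vi (bb (φi i))))))
    have h6 := mul_pos ht0 hε; rw [add_comm _ ((t : ℂ) * (w - W))] at e; rw [e]; linarith
  · refine Frequently.filter_mono (f := 𝓝[≠] W) (Eventually.frequently ?_) nhdsWithin_le_nhds
    filter_upwards [self_mem_nhdsWithin, nhdsWithin_le_nhds (closedBall_mem_nhds W hε)] with w h1 h2 e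
    exact h1 ((inj w (dW w h2) _ e).symm.trans (inj W (dW W WW) _ rfl))

lemma CU.qhomeo (H : CU φ r ℓ K h) (a : ℝ) : ∃ Q : ℂ ≃ₜ ℂ, (∀ z, Q z = q r ℓ a K h z) ∧ IsLift Q := by
  have hc := H.q_cont a
  obtain ⟨C, hC, hb⟩ := pbdd (g := fun z => ‖q r ℓ a K h z - z‖) (by fun_prop) Real.two_pi_pos
    (fun z => by rw [← TP_eq, H.q_per]; simp) (-r) r
  have hb' : ∀ z, ‖q r ℓ a K h z - z‖ ≤ C := fun z => by
    rcases le_total |z.re| r with h1 | h1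
    · simpa using hb z (abs_le.1 h1)
    · rw [H.q_out a h1]; simpa using hC.le
  have hre := fun z => abs_le.1 ((Complex.abs_re_le_norm _).trans (hb' z))
  have hp : IsProperMap (q r ℓ a K h) := isProperMap_iff_tendsto_cocompact.2 ⟨hc, by
    rw [← Metric.cobounded_eq_cocompact, ← tendsto_norm_atTop_iff_cobounded]
    refine tendsto_atTop_mono (f := fun z => ‖z‖ + -C) (fun z => ?_) (tendsto_atTop_add_const_right _ _ tendsto_norm_cobounded_atTop)
    have := norm_sub_norm_le z (q r ℓ a K h z); rw [norm_sub_rev] at this; linarith [hb' z]⟩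
  refine ⟨(Equiv.ofBijective _ (H.q_bij a)).toHomeomorphOfContinuousClosed hc hp.isClosedMap, fun z => rfl, fun z => H.q_per a z,
    fun M => ⟨M + C, fun z hz => ?_⟩, fun M => ⟨M - C, fun z hz => ?_⟩⟩
  · have := (hre z).1; rw [Complex.sub_re] at this; change M ≤ (q r ℓ a K h z).re; linarith
  · have := (hre z).2; rw [Complex.sub_re] at this; change (q r ℓ a K h z).re ≤ M; linarith

lemma IsLift.trans {ψ : ℂ ≃ₜ ℂ} (h1 : IsLift φ) (h2 : IsLift ψ) : IsLift (φ.trans ψ) where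
  per z := by simp [h1.per, h2.per]
  top M := by
    obtain ⟨N, h⟩ := h2.top M; obtain ⟨N', h'⟩ := h1.top N
    exact ⟨N', fun z hz => h _ (h' z hz)⟩
  bot M := by
    obtain ⟨N, h⟩ := h2.bot M; obtain ⟨N', h'⟩ := h1.bot N
    exact ⟨N', fun z hz => h _ (h' z hz)⟩

lemma IsLift.septop (H : IsLift φ) {M N : ℝ} (h : ∀ z : ℂ, z.re = N → M ≤ (φ z).re) {z : ℂ} (hz : N ≤ z.re) : M ≤ (φ z).re := by
  by_contra! hM
  obtain ⟨N', h'⟩ := H.top 0; obtain ⟨R, hR, hb⟩ := H.bdd (|N| + |N'|)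
  have hlow : ∀ p : ℂ, N ≤ p.re → -R ≤ (φ p).re := fun p hp => by
    rcases le_total N' p.re with h1 | h1
    · linarith [h' p h1]
    · exact (abs_le.1 (hb p ⟨by linarith [neg_abs_le N, abs_nonneg N'], by linarith [le_abs_self N', abs_nonneg N]⟩)).1
  have hlz := hlow z hz
  have hc : ContinuousOn (fun s : ℝ => (φ.symm (φ z - s)).re) (Icc 0 ((φ z).re + R + 1)) := by
    have := φ.symm.continuous; fun_prop
  have hN : (φ.symm (φ z - ((φ z).re + R + 1 : ℝ))).re ≤ N := by
    by_contra! h1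
    have := hlow _ h1.le; simp at this; linarith
  obtain ⟨s, hs, e⟩ := intermediate_value_Icc' (by linarith) hc ⟨hN, by simpa using hz⟩
  have := h _ e; simp at this; linarith [hs.1]

lemma IsLift.sepbot (H : IsLift φ) {M N : ℝ} (h : ∀ z : ℂ, z.re = N → (φ z).re ≤ M) {z : ℂ} (hz : z.re ≤ N) : (φ z).re ≤ M := by
  have e : ∀ w, ((Homeomorph.neg ℂ).trans (φ.trans (Homeomorph.neg ℂ))) w = -φ (-w) := fun w => rfl
  have := IsLift.septop (φ := (Homeomorph.neg ℂ).trans (φ.trans (Homeomorph.neg ℂ))) (M := -M) (N := -N) (z := -z)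
    ⟨fun z => ?_, fun M => ?_, fun M => ?_⟩ (fun w hw => ?_) (by simpa)
  · rw [e] at this; simpa using this
  · have := H.per (-(z + TP)); rw [neg_add, neg_add_cancel_right] at this; rw [e, e, neg_add, this]; ring
  · obtain ⟨N, h⟩ := H.bot (-M); exact ⟨-N, fun z hz => by have := h (-z) (by simp; linarith); rw [e]; simp; linarith⟩
  · obtain ⟨N, h⟩ := H.top (-M); exact ⟨-N, fun z hz => by have := h (-z) (by simp; linarith); rw [e]; simp; linarith⟩
  · have := h (-w) (by simp [hw]); rw [e]; simpa using this

lemma Cv.of_lim (L : ∀ i, IsLift (φi i)) (hφ : IsLift φ) (hl : ∀ (zi : ι → ℂ) z, Tendsto zi U (𝓝 z) → Tendsto (fun i => φi i (zi i)) U (𝓝 (φ z))) :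
    Cv U φi φ := by
  have uni : ∀ a ε : ℝ, 0 < ε → ∀ᶠ i in (U : Filter ι), ∀ z ∈ cSt (-a) a, ‖φi i z - φ z‖ ≤ ε := fun a ε hε => by
    by_contra hn
    rw [← Ultrafilter.eventually_not] at hn
    have : ∀ i, ∃ z : ℂ, ‖z‖ ≤ |a| + 2 * π ∧ ((¬ ∀ z ∈ cSt (-a) a, ‖φi i z - φ z‖ ≤ ε) → ε < ‖φi i z - φ z‖) := fun i => by
      by_cases h : ∀ z ∈ cSt (-a) a, ‖φi i z - φ z‖ ≤ ε
      · exact ⟨0, by simp; positivity, fun h' => absurd h h'⟩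
      · push Not at h
        obtain ⟨z, hz, he⟩ := h
        obtain ⟨n, hn⟩ := shift Real.two_pi_pos z.im
        refine ⟨z + vi (n * (2 * π)), (Complex.norm_le_abs_re_add_abs_im _).trans (add_le_add ?_ ?_), fun _ => ?_⟩
        · simpa using (abs_le.2 hz).trans (le_abs_self a)
        · rw [Complex.add_im, vi_im, abs_of_nonneg hn.1]; exact hn.2
        · rw [vper (L i).per', vper hφ.per']; simpa using he
    choose zi h1 h2 using this
    obtain ⟨z, hz⟩ := ulim U (Eventually.of_forall h1)
    have := ((hl zi z hz).sub ((φ.continuous.tendsto z).comp hz)).norm.eventually_lt_const (by simpa using hε)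
    obtain ⟨i, h3, h4⟩ := (hn.and this).exists
    exact absurd (h2 i h3) (not_lt.2 h4.le)
  refine ⟨uni, fun M => ?_, fun M => ?_⟩
  · obtain ⟨N, h⟩ := hφ.top (M + 1)
    refine ⟨N, (uni |N| 1 one_pos).mono fun i hi z hz => (L i).septop (fun w hw => ?_) hz⟩
    have h1 := (abs_le.1 ((Complex.abs_re_le_norm _).trans (hi w (abs_le.1 (by rw [hw]))))).1
    rw [Complex.sub_re] at h1; linarith [h w hw.ge]
  · obtain ⟨N, h⟩ := hφ.bot (M - 1)
    refine ⟨N, (uni |N| 1 one_pos).mono fun i hi z hz => (L i).sepbot (fun w hw => ?_) hz⟩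
    have h1 := (abs_le.1 ((Complex.abs_re_le_norm _).trans (hi w (abs_le.1 (by rw [hw]))))).2
    rw [Complex.sub_re] at h1; linarith [h w hw.le]

def Tr (φ : ℂ ≃ₜ ℂ) (t : ℝ) (Θ : ℂ ≃ₜ ℂ) : Prop := (t = 0 ∧ Θ = φ) ∨ (t = 1 ∧ ∀ z, Θ z = z + vi (bb φ)) ∨
  (t ∈ Ioo 0 1 ∧ ∃ ℓ K h, CU φ (t / (1 - t)) ℓ K h ∧ ∀ z, Θ z = φ (q (t / (1 - t)) ℓ (aa φ) K h z))

lemma vsh (b : ℝ) : IsLift (Homeomorph.addRight (vi b)) := ⟨fun z => by simp; ring, fun M => ⟨M, fun z hz => by simpa⟩, fun M => ⟨M, fun z hz => by simpa⟩⟩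

lemma Tr_ex (hφ : IsLift φ) {t : ℝ} (ht : t ∈ Icc 0 1) : ∃ Θ, IsLift Θ ∧ Tr φ t Θ := by
  rcases ht.1.eq_or_lt with h0 | h0
  · exact ⟨φ, hφ, .inl ⟨h0.symm, rfl⟩⟩
  rcases ht.2.eq_or_lt with h1 | h1
  · exact ⟨_, vsh (bb φ), .inr (.inl ⟨h1, fun z => rfl⟩)⟩
  obtain ⟨ℓ, K, h, H⟩ := exist hφ (div_pos h0 (sub_pos.2 h1))
  obtain ⟨Q, hQ, LQ⟩ := H.qhomeo (aa φ)
  exact ⟨Q.trans φ, LQ.trans hφ, .inr (.inr ⟨⟨h0, h1⟩, ℓ, K, h, H, fun z => by simp [hQ]⟩)⟩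

lemma Tr.lim (L : ∀ i, IsLift (φi i)) (hφ : IsLift φ) (C : Cv U φi φ) {ti : ι → ℝ} {t : ℝ} (ht : Tendsto ti U (𝓝 t)) {Θi : ι → ℂ ≃ₜ ℂ} {Θ : ℂ ≃ₜ ℂ}
    (T : ∀ i, Tr (φi i) (ti i) (Θi i)) (T0 : Tr φ t Θ) {zi : ι → ℂ} {z : ℂ} (hz : Tendsto zi U (𝓝 z)) :
    Tendsto (fun i => Θi i (zi i)) U (𝓝 (Θ z)) := by
  rcases Ultrafilter.eventually_or.1 (Eventually.of_forall (f := (U : Filter ι)) T) with h | h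
  · have : t = 0 := tendsto_nhds_unique ht (tendsto_const_nhds.congr' (h.mono fun i h => h.1.symm))
    subst this
    rcases T0 with ⟨-, rfl⟩ | h' | h'
    · exact (C.lim hz).congr' (h.mono fun i h => by simp only [h.2])
    · norm_num at h'
    · exact absurd h'.1.1 (lt_irrefl _)
  rcases Ultrafilter.eventually_or.1 h with h | h
  · have : t = 1 := tendsto_nhds_unique ht (tendsto_const_nhds.congr' (h.mono fun i h => h.1.symm))
    subst this
    rcases T0 with h' | h' | h'
    · norm_num at h'
    · rw [h'.2]
      exact (hz.add (((by unfold vi; fun_prop : Continuous vi).tendsto _).comp C.bb)).congr' (h.mono fun i h => (h.2 _).symm)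
    · exact absurd h'.1.2 (lt_irrefl _)
  have : ∀ i, ∃ r ℓ K h, CU (φi i) r ℓ K h ∧ (ti i ∈ Ioo (0:ℝ) 1 → r = ti i / (1 - ti i) ∧
      ∀ z, Θi i z = φi i (q r ℓ (HS.aa (φi i)) K h z)) := fun i => by
    by_cases hi : ti i ∈ Ioo (0:ℝ) 1
    · rcases T i with h | h | ⟨-, ℓ, K, h, H, e⟩
      · exact absurd hi.1 (by simp [h.1])
      · exact absurd hi.2 (by simp [h.1])
      · exact ⟨_, ℓ, K, h, H, fun _ => ⟨rfl, e⟩⟩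
    · obtain ⟨ℓ, K, h, H⟩ := exist (L i) one_pos
      exact ⟨_, ℓ, K, h, H, fun h => absurd h hi⟩
  choose ri ℓi Ki hi H e using this
  have er : ∀ᶠ i in (U : Filter ι), ti i / (1 - ti i) = ri i := h.mono fun i h => ((e i h.1).1).symm
  have eΘ : ∀ᶠ i in (U : Filter ι), φi i (q (ri i) (ℓi i) (HS.aa (φi i)) (Ki i) (hi i) (zi i)) = Θi i (zi i) := h.mono fun i h => ((e i h.1).2 _).symm
  have l1 : Tendsto (fun i => 1 - ti i) U (𝓝 (1 - t)) := ht.const_sub 1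
  rcases T0 with ⟨rfl, rfl⟩ | ⟨rfl, h'⟩ | ⟨ht', ℓ, K, h', H0, h2⟩
  · exact (C.lim (lim0 L hφ C H (by simpa using (ht.div l1 (by norm_num)).congr' er) _ hz)).congr' eΘ
  · rw [h']
    refine (limInf L C H ?_ hz).congr' eΘ
    refine Tendsto.congr' er ?_
    simp only [div_eq_mul_inv]
    refine ht.pos_mul_atTop one_pos (tendsto_inv_nhdsGT_zero.comp (tendsto_nhdsWithin_iff.2 ⟨by simpa using l1, h.mono fun i h => sub_pos.2 h.1.2⟩))
  · rw [h2]
    exact (C.lim (limq L hφ C H ((ht.div l1 (sub_pos.2 ht'.2).ne').congr' er) H0 C.aa hz)).congr' eΘ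

lemma Tr.rot {t : ℝ} {Θ : ℂ ≃ₜ ℂ} (T : Tr φ t Θ) (b : ℝ) : Tr (φ.trans (Homeomorph.addRight (vi b))) t (Θ.trans (Homeomorph.addRight (vi b))) := by
  rcases T with ⟨h, rfl⟩ | ⟨h, h'⟩ | ⟨h, ℓ, K, g, H, e⟩
  · exact .inl ⟨h, rfl⟩
  · refine .inr (.inl ⟨h, fun z => ?_⟩)
    simp only [bb, Homeomorph.trans_apply, Homeomorph.coe_addRight, h', Complex.add_im, vi_im]
    rw [add_assoc, ← vi_add]; congr 2; ring
  · refine .inr (.inr ⟨h, ℓ, K, g, ⟨H.r0, H.l0, H.cK, H.ch, H.mK, H.mh, H.Kh, H.hK, H.per, H.w0, H.w1,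
      H.hol.imp (fun h => h.add_const _) fun h => h.add_const _⟩, fun z => ?_⟩)
    simp [e, aa]

lemma Tr.id {t : ℝ} (ht : t ∈ Icc 0 1) : Tr (Homeomorph.refl ℂ) t (Homeomorph.refl ℂ) := by
  rcases ht.1.eq_or_lt with h0 | h0
  · exact .inl ⟨h0.symm, rfl⟩
  rcases ht.2.eq_or_lt with h1 | h1
  · exact .inr (.inl ⟨h1, fun z => by simp [bb, vi]⟩)
  set r := t / (1 - t)
  have hr : 0 < r := div_pos h0 (sub_pos.2 h1)
  have hr' : (r : ℂ) ≠ 0 := by exact_mod_cast hr.ne'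
  have hpi := Real.pi_pos
  have H : CU (Homeomorph.refl ℂ) r (π / r) (fun z => r * (2 * z - 1)) (fun w => (w / r + 1) / 2) := by
    refine ⟨hr, by positivity, by fun_prop, by fun_prop, fun z hz => ?_, fun w hw => ?_, fun w _ => by field_simp; ring, fun z _ => by field_simp; ring,
      fun z => ?_, fun z hz => by simp [hz], fun z hz => by simp [hz]; norm_num, .inl (by simp; fun_prop)⟩
    · have := hz.1; have := hz.2; constructor <;> simp <;> nlinarith
    · have h1 := hw.1; have h2 := hw.2
      have e : ((w / r + 1) / 2).re = (w.re / r + 1) / 2 := by simp [Complex.div_ofReal_re]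
      have h3 : -1 ≤ w.re / r := by rw [le_div_iff₀ hr]; linarith
      have h4 : w.re / r ≤ 1 := by rw [div_le_iff₀ hr]; linarith
      constructor <;> rw [e] <;> linarith
    · simp only [vi]; push_cast; field_simp; ring
  refine .inr (.inr ⟨⟨h0, h1⟩, _, _, _, H, fun z => ?_⟩)
  rcases le_total |z.re| r with hz | hz
  swap; · rw [H.q_out _ hz]
  have hz' := abs_le.1 hz
  rw [q_in _ hz']
  have e1 : cc (fun w => (w / r + 1) / 2) = 1 / 2 := by simp [cc, vi, Complex.div_ofReal_re]
  have e2 : mm (π / r) (fun w => (w / r + 1) / 2) = 0 := by simp [mm, vi, Complex.div_ofReal_im]; field_simp; norm_num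
  have e3 : vv r (π / r) (fun w => (w / r + 1) / 2) z.re z.im = z.im / (2 * r) := by
    simp only [vv, wv, e2]; simp [Complex.div_ofReal_im]; field_simp; ring
  have s1 : (r - z.re) / (2 * r) = 1 - (r + z.re) / (2 * r) := by field_simp; ring
  have s2 : 0 ≤ (r + z.re) / (2 * r) := div_nonneg (by linarith) (by linarith)
  have s3 : (r + z.re) / (2 * r) ≤ 1 := by rw [div_le_iff₀ (by linarith)]; linarith
  have e4 : mu r (1 / 2) (2 * π / (π / r)) (aa (Homeomorph.refl ℂ)) z.re = (r + z.re) / (2 * r) := by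
    have e : 1 / 2 + (z.re - aa (Homeomorph.refl ℂ)) / (2 * π / (π / r)) = (r + z.re) / (2 * r) := by simp [aa]; field_simp
    unfold mu
    have l1 := Lw_le (c := 1 / 2) (by norm_num) (by norm_num) s2 s3
    have l2 := Lw_le (c := 1 - 1 / 2) (s := (r - z.re) / (2 * r)) (by norm_num) (by norm_num) (by linarith) (by linarith)
    rw [e, min_eq_right (by linarith), max_eq_right l1]
  rw [e1, e3, e4]
  simp only [Homeomorph.refl_apply, vi]; push_cast; conv_lhs => rw [← Complex.re_add_im z]
  field_simp; ring

def sg : ℂ ≃ₜ ℂ := Complex.conjCLE.toHomeomorph.trans (Homeomorph.neg ℂ)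
lemma sg_eq (z : ℂ) : sg z = -(starRingEnd ℂ) z := rfl
@[simp] lemma sg_re (z : ℂ) : (sg z).re = -z.re := by simp [sg_eq]
@[simp] lemma sg_im (z : ℂ) : (sg z).im = z.im := by simp [sg_eq]
lemma sg_add (z w : ℂ) : sg (z + w) = sg z + sg w := by simp [sg_eq]; ring
@[simp] lemma sg_sg (z : ℂ) : sg (sg z) = z := by simp [sg_eq]
@[simp] lemma sg_vi (b : ℝ) : sg (vi b) = vi b := by apply Complex.ext <;> simp
def sc (φ : ℂ ≃ₜ ℂ) : ℂ ≃ₜ ℂ := sg.trans ((Homeomorph.addRight (vi π)).trans (φ.trans sg))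
lemma sc_ap (z : ℂ) : sc φ z = sg (φ (sg z + vi π)) := rfl

lemma IsLift.sc (H : IsLift φ) : IsLift (sc φ) where
  per z := by rw [sc_ap, sc_ap, TP_eq, sg_add, sg_vi, add_right_comm, H.per', sg_add, sg_vi]
  top M := by
    obtain ⟨N, h⟩ := H.bot (-M)
    exact ⟨-N, fun z hz => by have := h (sg z + vi π) (by simp; linarith); rw [sc_ap, sg_re]; linarith⟩
  bot M := by
    obtain ⟨N, h⟩ := H.top (-M)
    exact ⟨-N, fun z hz => by have := h (sg z + vi π) (by simp; linarith); rw [sc_ap, sg_re]; linarith⟩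

lemma sg_hol {f : ℂ → ℂ} (hf : DifferentiableOn ℂ f A) : DifferentiableOn ℂ (fun z => sg (f (1 + sg z))) A := fun z hz => by
  have h1 : DifferentiableAt ℂ f (1 - (starRingEnd ℂ) z) := hf.differentiableAt ((St_open 0 1).mem_nhds (by
    have h1 := hz.1; have h2 := hz.2
    constructor <;> simp <;> linarith))
  have h2 := (h1.comp ((starRingEnd ℂ) z) (f := fun w => 1 - w) (by fun_prop)).conj_conj
  rw [Complex.conj_conj] at h2
  exact h2.neg.differentiableWithinAt

lemma CU.sc (H : CU φ r ℓ K h) : CU (sc φ) r ℓ (fun z => sg (K (1 + sg z)) - vi π) (fun w => 1 + sg (h (sg w + vi π))) where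
  r0 := H.r0
  l0 := H.l0
  cK := by have := H.cK; have := sg.continuous; fun_prop
  ch := by have := H.ch; have := sg.continuous; fun_prop
  mK z hz := by
    have := H.mK (x := 1 + sg z) (by have h1 := hz.1; have h2 := hz.2; constructor <;> simp <;> linarith)
    have h1 := this.1; have h2 := this.2; constructor <;> simp <;> linarith
  mh z hz := by
    have := H.mh (x := sg z + vi π) (by have h1 := hz.1; have h2 := hz.2; constructor <;> simp <;> linarith)
    have h1 := this.1; have h2 := this.2; constructor <;> simp <;> linarith
  Kh w hw := by
    have e : (1 : ℂ) + sg (1 + sg (h (sg w + vi π))) = h (sg w + vi π) := by rw [sg_add, sg_sg]; simp [sg_eq]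
    rw [e, H.Kh _ (by have h1 := hw.1; have h2 := hw.2; constructor <;> simp <;> linarith), sg_add, sg_vi, sg_sg]; ring
  hK z hz := by
    have e : sg (sg (K (1 + sg z)) - vi π) + vi π = K (1 + sg z) := by rw [sub_eq_add_neg, sg_add, sg_sg]; simp [sg_eq, vi]
    rw [e, H.hK _ (by have h1 := hz.1; have h2 := hz.2; constructor <;> simp <;> linarith), sg_add, sg_sg]; simp [sg_eq]
  per z := by rw [sg_add, sg_vi, ← add_assoc, H.per, sg_add, sg_vi]; ring
  w0 z hz := by have := H.w1 (1 + sg z) (by simp [hz]); simp [this]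
  w1 z hz := by have := H.w0 (1 + sg z) (by simp [hz]); simp [this]
  hol := by
    have e : ∀ z, HS.sc φ (sg (K (1 + sg z)) - vi π) = sg (φ (K (1 + sg z))) := fun z => by
      rw [sc_ap, sub_eq_add_neg, sg_add, sg_sg]; simp [sg_eq, vi]
    simp only [e]
    refine H.hol.imp (fun h => sg_hol h) fun h => ?_
    have := sg_hol h
    convert this using 6; simp [sg_eq]

lemma mu_sym {c w a x : ℝ} (hr : 0 < r) (h0 : 0 < c) (h1 : c < 1) (hx : |x| ≤ r) : mu r (1 - c) w (-a) x = 1 - mu r c w a (-x) := by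
  have hx' := abs_le.1 hx
  have s1 : (r - x) / (2 * r) = 1 - (r + x) / (2 * r) := by field_simp; ring
  have s2 : 0 ≤ (r + x) / (2 * r) := div_nonneg (by linarith) (by linarith)
  have s3 : (r + x) / (2 * r) ≤ 1 := by rw [div_le_iff₀ (by linarith)]; linarith
  have l1 := Lw_le (c := 1 - c) (by linarith) (by linarith) s2 s3
  have l2 := Lw_le (c := c) (s := (r - x) / (2 * r)) h0 h1 (by linarith) (by linarith)
  unfold mu; rw [sub_sub_cancel, sub_neg_eq_add, sub_neg_eq_add r x, ← sub_eq_add_neg r x, max_min_distrib_left, max_eq_right (by linarith : Lw (1 - c) ((r + x) / (2 * r)) ≤ 1 - Lw c ((r - x) / (2 * r))),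
    ← min_sub_sub_left, ← max_sub_sub_left]
  congr 2
  · ring
  · ring

lemma Tr.sc {t : ℝ} {Θ : ℂ ≃ₜ ℂ} (T : Tr φ t Θ) (hφ : IsLift φ) : Tr (sc φ) t (sc Θ) := by
  have e1 : HS.sc φ 0 = sg (φ (vi π)) := by rw [sc_ap]; simp [sg_eq]
  have e2 : HS.sc φ (vi π) = sg (φ 0) + vi (2 * π) := by
    rw [sc_ap, sg_vi, ← vi_add, ← two_mul, ← zero_add (vi (2 * π)), hφ.per', sg_add, sg_vi, zero_add]
  rcases T with ⟨h, rfl⟩ | ⟨h, h'⟩ | ⟨ht, ℓ, K, h, H, e⟩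
  · exact .inl ⟨h, rfl⟩
  · refine .inr (.inl ⟨h, fun z => ?_⟩)
    rw [sc_ap, h', sg_add, sg_add, sg_sg, sg_vi, sg_vi, add_assoc, ← vi_add]
    congr 2; simp only [bb, e1, e2]; simp; ring
  refine .inr (.inr ⟨ht, ℓ, _, _, H.sc, fun z => ?_⟩)
  set r := t / (1 - t)
  have ea : aa (HS.sc φ) = -aa φ := by simp only [aa, e1, e2]; simp; ring
  have ez : sg (z + vi π) = sg z + vi π := by rw [sg_add, sg_vi]
  have eq : ∀ w, HS.sc φ (sg w - vi π) = sg (φ w) := fun z => by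
      rw [sc_ap, sub_eq_add_neg, sg_add, sg_sg]; simp [sg_eq, vi]
  rw [ea, sc_ap, e, ← eq]; congr 1
  rcases le_total |z.re| r with hz | hz
  swap; · rw [H.sc.q_out _ hz, H.q_out _ (by simpa), sg_add, sg_sg, sg_vi]; ring
  have hz' := abs_le.1 hz
  rw [q_in _ hz', q_in _ (by constructor <;> simp <;> linarith)]
  have p0 : h (vi (2 * π)) = h 0 + vi ℓ := by
    have := H.hper (w := 0) (by simp [cSt, H.r0.le]); rwa [zero_add] at this
  have ec : cc (fun w => 1 + sg (h (sg w + vi π))) = 1 - cc h := by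
    simp only [cc]; rw [sg_vi, ← vi_add, ← two_mul, p0]; simp [sg_eq 0]; ring
  have em : mm ℓ (fun w => 1 + sg (h (sg w + vi π))) = mm ℓ h + ℓ / 2 := by
    simp only [mm]; rw [sg_vi, ← vi_add, ← two_mul, p0]; simp [sg_eq 0]; ring
  have ev : vv r ℓ (fun w => 1 + sg (h (sg w + vi π))) z.re z.im = vv r ℓ h (-z.re) (z.im + π) := by
    have e3 : ∀ x : ℝ, sg ((x : ℂ) + vi z.im) + vi π = ((-x : ℝ) : ℂ) + vi (z.im + π) := fun x => by rw [sg_add, sg_vi, vi_add, sg_eq]; simp; ring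
    simp only [vv, wv, em, e3, HS.l0, abs_neg]; simp; field_simp; ring
  rw [ec, ev, mu_sym H.r0 H.cc0.1 H.cc0.2 hz]
  beta_reduce
  congr 3; apply Complex.ext <;> simp

lemma sph_sq (x : Sph) : x.1 0 ^ 2 + x.1 1 ^ 2 + x.1 2 ^ 2 = 1 := by
  have h := EuclideanSpace.norm_sq_eq x.1
  rw [norm_eq_of_mem_sphere x, Fin.sum_univ_three] at h
  simpa using h.symm

lemma sph_ext {x y : Sph} (h0 : x.1 0 = y.1 0) (h1 : x.1 1 = y.1 1) (h2 : x.1 2 = y.1 2) : x = y := by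
  apply Subtype.ext; ext i; fin_cases i <;> assumption

def m3 (a b c : ℝ) (h : a ^ 2 + b ^ 2 + c ^ 2 = 1) : Sph := ⟨!₂[a, b, c], by
  rw [mem_sphere_zero_iff_norm, EuclideanSpace.norm_eq, Fin.sum_univ_three]; simp [h]⟩

lemma sph_cont {X : Type*} [TopologicalSpace X] {f : X → Sph} (h : ∀ i, Continuous fun x => (f x).1 i) : Continuous f :=
  continuous_induced_rng.2 ((PiLp.continuous_toLp 2 _).comp (continuous_pi h))

lemma co_cont (i : Fin 3) : Continuous fun x : Sph => x.1 i :=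
  (EuclideanSpace.proj (𝕜 := ℝ) i).continuous.comp continuous_subtype_val

def st (w : ℂ) : Sph := m3 (2 * w.re / (1 + Complex.normSq w)) (2 * w.im / (1 + Complex.normSq w)) ((Complex.normSq w - 1) / (1 + Complex.normSq w)) (by
  have := Complex.normSq_nonneg w
  have e := Complex.normSq_apply w
  field_simp; rw [e]; ring)
lemma st0 (w : ℂ) : (st w).1 0 = 2 * w.re / (1 + Complex.normSq w) := rfl
lemma st1 (w : ℂ) : (st w).1 1 = 2 * w.im / (1 + Complex.normSq w) := rfl
lemma st2 (w : ℂ) : (st w).1 2 = (Complex.normSq w - 1) / (1 + Complex.normSq w) := rfl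
lemma st_cont : Continuous st := by
  have c := Complex.continuous_normSq
  have p : ∀ w : ℂ, 1 + Complex.normSq w ≠ 0 := fun w => by have := Complex.normSq_nonneg w; positivity
  refine sph_cont fun i => ?_
  fin_cases i
  · exact (continuous_const.mul Complex.continuous_re).div (continuous_const.add c) p
  · exact (continuous_const.mul Complex.continuous_im).div (continuous_const.add c) p
  · exact (c.sub continuous_const).div (continuous_const.add c) p
def ee (z : ℂ) : Sph := st (Complex.exp z)
lemma ee_cont : Continuous ee := st_cont.comp Complex.continuous_exp
def Np : Sph := m3 0 0 1 (by norm_num)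
def Sp : Sph := m3 0 0 (-1) (by norm_num)
def pr (x : Sph) : ℂ := ⟨x.1 0 / (1 - x.1 2), x.1 1 / (1 - x.1 2)⟩
lemma pr_st (w : ℂ) : pr (st w) = w := by
  have := Complex.normSq_nonneg w
  have h : 1 - (Complex.normSq w - 1) / (1 + Complex.normSq w) = 2 / (1 + Complex.normSq w) := by field_simp; ring
  apply Complex.ext <;> simp only [pr, st0, st1, st2, h] <;> field_simp
lemma pr_ee (z : ℂ) : pr (ee z) = Complex.exp z := pr_st _
lemma eqN {x : Sph} (h : x.1 2 = 1) : x = Np := by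
  have e := sph_sq x; rw [h] at e
  have h0 : x.1 0 = 0 := by nlinarith
  have h1 : x.1 1 = 0 := by nlinarith
  exact sph_ext h0 h1 h
lemma st_pr {x : Sph} (h : x ≠ Np) : st (pr x) = x := by
  have k : x.1 2 ≠ 1 := fun k => h (eqN k)
  have e := sph_sq x
  have hd : 1 - x.1 2 ≠ 0 := sub_ne_zero.2 (Ne.symm k)
  have hn : Complex.normSq (pr x) = (1 + x.1 2) / (1 - x.1 2) := by
    rw [Complex.normSq_apply]; simp only [pr]; field_simp; linear_combination e
  have h2 : 1 + (1 + x.1 2) / (1 - x.1 2) = 2 / (1 - x.1 2) := by field_simp; ring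
  have h3 : (1 + x.1 2) / (1 - x.1 2) - 1 = 2 * x.1 2 / (1 - x.1 2) := by field_simp; ring
  apply sph_ext
  · rw [st0, hn, h2]; simp only [pr]; field_simp
  · rw [st1, hn, h2]; simp only [pr]; field_simp
  · rw [st2, hn, h2, h3]; field_simp
lemma st_z : st 0 = Sp := sph_ext (by simp [st0, Sp, m3]) (by simp [st1, Sp, m3]) (by simp [st2, Sp, m3])
lemma st_N (w : ℂ) : st w ≠ Np := fun h => by
  have := Complex.normSq_nonneg w
  have h2 := congrArg (fun x : Sph => x.1 2) h
  have : (Complex.normSq w - 1) / (1 + Complex.normSq w) = 1 := h2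
  field_simp at this; linarith
lemma ee_S (z : ℂ) : ee z ≠ Sp := fun h => by
  have := pr_ee z
  rw [h, ← st_z, pr_st] at this; exact Complex.exp_ne_zero z this.symm
lemma ee_N (z : ℂ) : ee z ≠ Np := st_N _
lemma SN : Sp ≠ Np := st_z ▸ st_N 0
lemma pr_ne {x : Sph} (hN : x ≠ Np) (hS : x ≠ Sp) : pr x ≠ 0 := fun h => hS (by rw [← st_pr hN, h, st_z])
lemma ee_log {x : Sph} (hN : x ≠ Np) {z : ℂ} (h : Complex.exp z = pr x) : ee z = x := by rw [ee, h, st_pr hN]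
lemma ee_sur {x : Sph} (hN : x ≠ Np) (hS : x ≠ Sp) : ∃ z, ee z = x := ⟨_, ee_log hN (Complex.exp_log (pr_ne hN hS))⟩
lemma ee_inj {z w : ℂ} (h : ee z = ee w) : ∃ n : ℤ, z = w + n * TP := by
  have := congrArg pr h
  rw [pr_ee, pr_ee] at this
  exact Complex.exp_eq_exp_iff_exists_int.1 this
lemma ee_per (z : ℂ) (n : ℤ) : ee (z + n * TP) = ee z := by
  rw [ee, Complex.exp_eq_exp_iff_exists_int.2 ⟨n, rfl⟩]; rfl
lemma pr_at {x : Sph} (h : x ≠ Np) : ContinuousAt pr x := by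
  have k : 1 - x.1 2 ≠ 0 := sub_ne_zero.2 fun k => h (eqN k.symm)
  have c : ∀ i, ContinuousAt (fun y : Sph => y.1 i / (1 - y.1 2)) x := fun i =>
    (co_cont i).continuousAt.div (continuousAt_const.sub (co_cont 2).continuousAt) k
  have : pr = fun y : Sph => ((y.1 0 / (1 - y.1 2) : ℝ) : ℂ) + ((y.1 1 / (1 - y.1 2) : ℝ) : ℂ) * Complex.I := by
    funext y; apply Complex.ext <;> simp [pr, -Complex.ofReal_div]
  rw [this]
  exact (Complex.continuous_ofReal.continuousAt.comp (c 0)).add ((Complex.continuous_ofReal.continuousAt.comp (c 1)).mul continuousAt_const)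
/-- local section -/
lemma ee_loc {ι : Type*} {F : Filter ι} {x : ι → Sph} {z : ℂ} (h : Tendsto x F (𝓝 (ee z))) :
    ∃ zi : ι → ℂ, Tendsto zi F (𝓝 z) ∧ ∀ᶠ i in F, x i = ee (zi i) := by
  have h1 : Tendsto (fun i => pr (x i) / Complex.exp z) F (𝓝 1) := by
    have := ((pr_at (ee_N z)).tendsto.comp h).div_const (Complex.exp z)
    rwa [pr_ee, div_self (Complex.exp_ne_zero z)] at this
  have h2 := (continuousAt_clog (x := 1) (by simp)).tendsto.comp h1
  rw [Complex.log_one] at h2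
  refine ⟨fun i => z + Complex.log (pr (x i) / Complex.exp z), by simpa using h2.const_add z, ?_⟩
  filter_upwards [h.eventually_ne (ee_N z), h.eventually_ne (ee_S z)] with i a b
  rw [ee_log a]
  rw [Complex.exp_add, Complex.exp_log (div_ne_zero (pr_ne a b) (Complex.exp_ne_zero z))]
  field_simp [Complex.exp_ne_zero z]

def Rf (x : Sph) : Sph := m3 (x.1 0) (x.1 1) (-x.1 2) (by rw [neg_sq]; exact sph_sq x)
lemma Rf_Rf (x : Sph) : Rf (Rf x) = x := sph_ext rfl rfl (neg_neg _)
lemma Rf_cont : Continuous Rf := sph_cont fun i => by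
  fin_cases i
  exacts [co_cont 0, co_cont 1, (co_cont 2).neg]
lemma Rf_S : Rf Sp = Np := sph_ext rfl rfl (neg_neg _)
lemma Rf_N : Rf Np = Sp := sph_ext rfl rfl rfl
lemma ee_sg (z : ℂ) : ee (sg z) = Rf (ee z) := by
  have e : Complex.exp (sg z) = (starRingEnd ℂ (Complex.exp z))⁻¹ := by rw [sg_eq, Complex.exp_neg, Complex.exp_conj]
  have hw := Complex.exp_ne_zero z
  rw [ee, e, ee]
  generalize Complex.exp z = w at hw
  have p : 0 < Complex.normSq w := Complex.normSq_pos.2 hw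
  apply sph_ext
  · rw [st0, show (Rf (st w)).1 0 = (st w).1 0 from rfl, st0]; simp; field_simp; ring
  · rw [st1, show (Rf (st w)).1 1 = (st w).1 1 from rfl, st1]; simp; field_simp; ring
  · rw [st2, show (Rf (st w)).1 2 = -(st w).1 2 from rfl, st2]; simp; field_simp; ring
lemma ee_neg (z : ℂ) : ee (sg z + vi π) = -ee z := by
  have e : Complex.exp (sg z + vi π) = -Complex.exp (sg z) := by rw [Complex.exp_add, vi, Complex.exp_pi_mul_I]; ring
  have k : ee (sg z + vi π) = m3 (-(ee (sg z)).1 0) (-(ee (sg z)).1 1) ((ee (sg z)).1 2) (by rw [neg_sq, neg_sq]; exact sph_sq _) := by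
    rw [ee, e, ee]
    apply sph_ext
    · rw [st0]; simp only [m3]; simp [st0, neg_div]
    · rw [st1]; simp only [m3]; simp [st1, neg_div]
    · rw [st2]; simp only [m3]; simp [st2]
  rw [k, ee_sg]
  exact sph_ext (by simp [m3, Rf]) (by simp [m3, Rf]) (by simp [m3, Rf])
lemma S1 {V : Set Sph} (hV : V ∈ 𝓝 Sp) : ∃ M : ℝ, ∀ z : ℂ, z.re ≤ M → ee z ∈ V := by
  have h1 : Tendsto ee (comap Complex.re atBot) (𝓝 Sp) := by
    have := st_cont.tendsto 0; rw [st_z] at this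
    exact this.comp Complex.tendsto_exp_comap_re_atBot
  obtain ⟨s, hs, h⟩ := Filter.mem_comap.1 (h1 hV)
  obtain ⟨M, hM⟩ := mem_atBot_sets.1 hs
  exact ⟨M, fun z hz => h (hM _ hz)⟩
lemma S2 (M : ℝ) : ∀ᶠ x in 𝓝 Sp, x = Sp ∨ ∃ z, x = ee z ∧ z.re ≤ M := by
  have h1 := (pr_at SN).tendsto.norm
  rw [← st_z, pr_st, norm_zero] at h1
  rw [← st_z]
  filter_upwards [h1.eventually_lt_const (Real.exp_pos M), (continuous_id.tendsto (st 0)).eventually_ne (st_N 0)] with x hx hN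
  by_cases hS : x = Sp
  · left; rw [hS, st_z]
  obtain ⟨z, rfl⟩ := ee_sur hN hS
  exact .inr ⟨z, rfl, by rw [pr_ee, Complex.norm_exp] at hx; exact (Real.exp_lt_exp.1 hx).le⟩
lemma N1 {V : Set Sph} (hV : V ∈ 𝓝 Np) : ∃ M : ℝ, ∀ z : ℂ, M ≤ z.re → ee z ∈ V := by
  have h := Rf_cont.tendsto Sp; rw [Rf_S] at h
  obtain ⟨M, hM⟩ := S1 (h hV)
  refine ⟨-M, fun z hz => ?_⟩
  have := hM (sg z) (by simp; linarith)
  rwa [ee_sg, mem_preimage, Rf_Rf] at this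
lemma N2 (M : ℝ) : ∀ᶠ x in 𝓝 Np, x = Np ∨ ∃ z, x = ee z ∧ M ≤ z.re := by
  have h := Rf_cont.tendsto Np; rw [Rf_N] at h
  filter_upwards [h.eventually (S2 (-M))] with x hx
  rcases hx with hx | ⟨z, hx, hz⟩
  · left; rw [← Rf_Rf x, hx, Rf_S]
  · exact .inr ⟨sg z, by rw [ee_sg, ← hx, Rf_Rf], by simp; linarith⟩

abbrev O3 := Matrix.orthogonalGroup (Fin 3) ℝ
lemma om (Q : O3) : Q.1.transpose * Q.1 = 1 := (Matrix.mem_orthogonalGroup_iff' _ _).1 Q.2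
def Act (Q : O3) (x : Sph) : Sph := ⟨WithLp.toLp 2 (Q.1.mulVec x.1.ofLp), by
  have h := om Q
  have e : (Q.1.mulVec x.1.ofLp) ⬝ᵥ (Q.1.mulVec x.1.ofLp) = 1 := by
    rw [Matrix.dotProduct_mulVec, Matrix.vecMul_mulVec, h]
    have := sph_sq x
    simp [dotProduct, Fin.sum_univ_three]; linarith
  rw [mem_sphere_zero_iff_norm, EuclideanSpace.norm_eq]
  simp only [dotProduct, Fin.sum_univ_three] at e
  simp only [Fin.sum_univ_three, Real.norm_eq_abs, sq_abs]
  rw [Real.sqrt_eq_one]; linarith⟩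
lemma Act_c (Q : O3) (x : Sph) : (Act Q x).1.ofLp = Q.1.mulVec x.1.ofLp := rfl
lemma Act_i (Q : O3) (x : Sph) (i : Fin 3) : (Act Q x).1 i = Q.1 i 0 * x.1 0 + Q.1 i 1 * x.1 1 + Q.1 i 2 * x.1 2 := by
  rw [Act_c, Matrix.mulVec, dotProduct, Fin.sum_univ_three]
lemma Act_one (x : Sph) : Act 1 x = x := by apply Subtype.ext; ext1; rw [Act_c]; simp
lemma Act_mul (Q R : O3) (x : Sph) : Act (Q * R) x = Act Q (Act R x) := by
  apply Subtype.ext; ext1; rw [Act_c, Act_c, Act_c]; simp [Matrix.mulVec_mulVec]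
lemma Act_inv (Q : O3) (x : Sph) : Act Q⁻¹ (Act Q x) = x := by rw [← Act_mul, inv_mul_cancel, Act_one]
lemma Act_inv' (Q : O3) (x : Sph) : Act Q (Act Q⁻¹ x) = x := by rw [← Act_mul, mul_inv_cancel, Act_one]
lemma Act_neg (Q : O3) (x : Sph) : Act Q (-x) = -Act Q x := by
  apply Subtype.ext; ext1; rw [Act_c]; simp [Matrix.mulVec_neg, Act_c]
lemma inv_e (Q : O3) (i j : Fin 3) : (Q⁻¹).1 i j = Q.1 j i := rfl
lemma Act_lim {ι : Type} {U : Filter ι} {Qi : ι → O3} {Q : O3} (h : ∀ a b, Tendsto (fun i => (Qi i).1 a b) U (𝓝 (Q.1 a b)))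
    {xi : ι → Sph} {x : Sph} (hx : Tendsto xi U (𝓝 x)) : Tendsto (fun i => Act (Qi i) (xi i)) U (𝓝 (Act Q x)) := by
  have hc : ∀ a, Tendsto (fun i => (xi i).1 a) U (𝓝 (x.1 a)) := fun a => ((co_cont a).tendsto x).comp hx
  refine tendsto_subtype_rng.2 (((PiLp.continuous_toLp 2 _).tendsto _).comp (tendsto_pi_nhds.2 fun a => ?_))
  have := (((h a 0).mul (hc 0)).add ((h a 1).mul (hc 1))).add ((h a 2).mul (hc 2))
  rw [← Act_i] at this
  exact this.congr fun i => (Act_i _ _ _).symm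
lemma Act_cont (Q : O3) : Continuous (Act Q) := continuous_iff_continuousAt.2 fun _ =>
  Act_lim (Qi := fun _ => Q) (fun _ _ => tendsto_const_nhds) tendsto_id
lemma O3_lim {ι : Type} (U : Ultrafilter ι) (Qi : ι → O3) : ∃ Q : O3, ∀ a b, Tendsto (fun i => (Qi i).1 a b) U (𝓝 (Q.1 a b)) := by
  have h : ∀ a b, ∃ l, Tendsto (fun i => (Qi i).1 a b) U (𝓝 l) := fun a b => by
    have := (isCompact_Icc (a := (-1 : ℝ)) (b := 1)).ultrafilter_le_nhds (U.map fun i => (Qi i).1 a b) (by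
      rw [le_principal_iff]; refine Filter.mem_map.2 (univ_mem' fun i => ?_)
      have := entry_norm_bound_of_unitary (Qi i).2 a b
      exact abs_le.1 this)
    obtain ⟨l, -, hl⟩ := this
    exact ⟨l, hl⟩
  choose q hq using h
  refine ⟨⟨Matrix.of q, ?_⟩, hq⟩
  rw [Matrix.mem_orthogonalGroup_iff']
  have t : Tendsto (fun i => (Qi i).1) U (𝓝 (Matrix.of q)) := tendsto_pi_nhds.2 fun a => tendsto_pi_nhds.2 fun b => hq a b
  have c : Continuous fun M : Matrix (Fin 3) (Fin 3) ℝ => M.transpose * M := continuous_id.matrix_transpose.matrix_mul continuous_id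
  refine tendsto_nhds_unique ((c.tendsto _).comp t) (tendsto_const_nhds.congr fun i => ?_)
  exact (om (Qi i)).symm
lemma O3_N (n : Sph) : ∃ Q : O3, Act Q Np = n := by
  obtain ⟨b, hb⟩ := Orthonormal.exists_orthonormalBasis_extension_of_card_eq (𝕜 := ℝ) (E := E3) (ι := Fin 3) (by simp)
    (v := fun _ => n.1) (s := {2}) (by
      constructor
      · intro i; simp
      · intro i j hij; exact absurd (Subsingleton.elim i j) hij)
  refine ⟨⟨(EuclideanSpace.basisFun (Fin 3) ℝ).toBasis.toMatrix b, OrthonormalBasis.toMatrix_orthonormalBasis_mem_unitary _ _⟩, ?_⟩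
  have k : ∀ i, b 2 i = n.1 i := fun i => by rw [hb 2 rfl]
  have : ∀ i, (Act ⟨(EuclideanSpace.basisFun (Fin 3) ℝ).toBasis.toMatrix b, OrthonormalBasis.toMatrix_orthonormalBasis_mem_unitary _ _⟩ Np).1 i = n.1 i := fun i => by
    rw [Act_i, ← k]; simp [Np, m3, Module.Basis.toMatrix_apply]
  exact sph_ext (this 0) (this 1) (this 2)
lemma Act_N2 {Q : O3} {x : Sph} (h : Act Q Np = x) (i : Fin 3) : Q.1 i 2 = x.1 i := by
  rw [← h, Act_i]; simp [Np, m3]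
lemma Np_neg : -Np = Sp := sph_ext (by simp [Np, Sp, m3]) (by simp [Np, Sp, m3]) (by simp [Np, Sp, m3])
lemma Act_S {Q : O3} (h : Act Q Np = Np) : Act Q Sp = Sp := by rw [← Np_neg, Act_neg, h]
def cj (z : ℂ) : ℂ := starRingEnd ℂ z
lemma stab {R : O3} (h : Act R Np = Np) : (∃ θ : ℝ, ∀ z, Act R (ee z) = ee (z + vi θ)) ∨ ∃ θ : ℝ, ∀ z, Act R (ee z) = ee (cj z + vi θ) := by
  have k := om R
  have k0 : ∀ a b, R.1 0 a * R.1 0 b + R.1 1 a * R.1 1 b + R.1 2 a * R.1 2 b = (1 : Matrix (Fin 3) (Fin 3) ℝ) a b := fun a b => by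
    rw [← k, Matrix.mul_apply, Fin.sum_univ_three]; rfl
  have a0 : R.1 0 2 = 0 := Act_N2 h 0
  have a1 : R.1 1 2 = 0 := Act_N2 h 1
  have a2 : R.1 2 2 = 1 := Act_N2 h 2
  have e0 := k0 0 2; have e1 := k0 1 2; have e2 := k0 0 0; have e3 := k0 0 1; have e4 := k0 1 1
  simp [a0, a1, a2] at e0 e1 e2 e3 e4
  rw [e0] at e2 e3; rw [e1] at e3 e4
  set a := R.1 0 0 with ha; set c := R.1 1 0 with hc; set b := R.1 0 1 with hb'; set d := R.1 1 1 with hd'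
  have hw : ‖(⟨a, c⟩ : ℂ)‖ = 1 := by
    rw [Complex.norm_def, Complex.normSq_apply, Real.sqrt_eq_one]; simp; linarith
  have hθ : Complex.exp (vi (Complex.arg ⟨a, c⟩)) = ⟨a, c⟩ := by
    have := Complex.norm_mul_exp_arg_mul_I ⟨a, c⟩
    rw [hw] at this; simpa [vi] using this
  have hn : ∀ u : ℂ, Complex.normSq (u * ⟨a, c⟩) = Complex.normSq u := fun u => by
    rw [Complex.normSq_mul, Complex.normSq_eq_norm_sq ⟨a, c⟩, hw]; simp
  have hs : (a * d - b * c) ^ 2 = 1 := by nlinarith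
  have : (b = -c ∧ d = a) ∨ (b = c ∧ d = -a) := by
    rcases (sq_eq_sq_iff_eq_or_eq_neg.1 (hs.trans (one_pow 2).symm)) with h | h
    · left; constructor <;> nlinarith [sq_nonneg (b + c), sq_nonneg (d - a)]
    · right; constructor <;> nlinarith [sq_nonneg (b - c), sq_nonneg (d + a)]
  rcases this with ⟨hb, hd⟩ | ⟨hb, hd⟩
  · refine .inl ⟨Complex.arg ⟨a, c⟩, fun z => ?_⟩
    rw [ee, ee, Complex.exp_add, hθ]
    generalize Complex.exp z = u
    apply sph_ext <;> rw [Act_i] <;> simp only [st0, st1, st2, hn, a0, a1, a2, e0, e1, Complex.mul_re, Complex.mul_im, ← ha, ← hc, ← hb', ← hd', hb, hd] <;> ring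
  · refine .inr ⟨Complex.arg ⟨a, c⟩, fun z => ?_⟩
    rw [ee, ee, Complex.exp_add, hθ, cj, Complex.exp_conj]
    generalize Complex.exp z = u
    apply sph_ext <;> rw [Act_i] <;> simp only [st0, st1, st2, hn, a0, a1, a2, e0, e1, Complex.mul_re, Complex.mul_im, ← ha, ← hc, ← hb', ← hd', hb, hd, Complex.normSq_conj, Complex.conj_re, Complex.conj_im] <;> ring

lemma nTP (n : ℤ) : (n : ℂ) * TP = vi (n * (2 * π)) := by rw [TP_eq, vi_int]
lemma nTP_small {n : ℤ} (h : ‖(n : ℂ) * TP‖ ≤ 1) : n = 0 := by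
  by_contra hn
  rw [nTP, norm_vi, abs_mul, abs_of_pos Real.two_pi_pos] at h
  have : (1 : ℝ) ≤ |(n : ℝ)| := by exact_mod_cast Int.one_le_abs hn
  nlinarith [Real.pi_gt_three]
lemma TP_ne : TP ≠ 0 := fun h => by have := @nTP_small 1 (by simp [h]); omega
lemma ivt0 {d : ℂ → ℂ} (hd : Continuous d) {ε : ℝ} {z : ℂ} (h0 : ‖d 0‖ < ε) (h1 : ε ≤ ‖d z‖) : ∃ s ∈ Icc (0 : ℝ) 1, ‖d (s * z)‖ = ε := by
  have c : ContinuousOn (fun s : ℝ => ‖d (s * z)‖) (Icc 0 1) := by fun_prop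
  exact intermediate_value_Icc zero_le_one c ⟨by simpa using h0.le, by simpa using h1⟩
lemma dconst {d : ℂ → ℂ} (hd : Continuous d) (h : ∀ z, ∃ n : ℤ, d z = n * TP) (z : ℂ) : d z = d 0 := by
  by_contra hn
  have k : ∀ z, ∃ n : ℤ, d z - d 0 = n * TP := fun z => by
    obtain ⟨n, hn⟩ := h z; obtain ⟨m, hm⟩ := h 0
    exact ⟨n - m, by rw [hn, hm]; push_cast; ring⟩
  have big : ∀ z, ‖d z - d 0‖ ≤ 1 → d z - d 0 = 0 := fun z hz => by
    obtain ⟨n, hn⟩ := k z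
    rw [hn] at hz; rw [hn, nTP_small hz]; simp
  have : 1 ≤ ‖d z - d 0‖ := by
    by_contra hc; push Not at hc
    exact hn (sub_eq_zero.1 (big z hc.le))
  obtain ⟨s, -, hs⟩ := ivt0 (d := fun w => d w - d 0) (by fun_prop) (by simp) this
  have := big (s * z) hs.le
  rw [this] at hs; simp at hs
lemma liftlim {φi : ι → ℂ → ℂ} {φ : ℂ → ℂ} (ci : ∀ i, Continuous (φi i)) (c : Continuous φ)
    (H : ∀ (zi : ι → ℂ) z, Tendsto zi U (𝓝 z) → Tendsto (fun i => ee (φi i (zi i))) U (𝓝 (ee (φ z))))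
    (h0 : Tendsto (fun i => φi i 0) U (𝓝 (φ 0))) (zi : ι → ℂ) (z : ℂ) (hz : Tendsto zi U (𝓝 z)) :
    Tendsto (fun i => φi i (zi i)) U (𝓝 (φ z)) := by
  suffices h : Tendsto (fun i => φi i (zi i) - φ (zi i)) U (𝓝 0) by
    simpa using h.add ((c.tendsto z).comp hz)
  by_contra hn
  rw [Metric.tendsto_nhds] at hn; push Not at hn
  obtain ⟨ε, hε, hn⟩ := hn
  have hδ : 0 < min ε 1 := lt_min hε one_pos
  have e0 : ∀ᶠ i in (U : Filter ι), ‖φi i 0 - φ 0‖ < min ε 1 := by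
    have := h0.sub_const (φ 0); rw [sub_self] at this
    have := this.norm; rw [norm_zero] at this
    exact this.eventually_lt_const hδ
  have : ∀ i, ∃ s ∈ Icc (0 : ℝ) 1, ‖φi i 0 - φ 0‖ < min ε 1 → min ε 1 ≤ ‖φi i (zi i) - φ (zi i)‖ → ‖φi i (s * zi i) - φ (s * zi i)‖ = min ε 1 := fun i => by
    by_cases a : ‖φi i 0 - φ 0‖ < min ε 1 ∧ min ε 1 ≤ ‖φi i (zi i) - φ (zi i)‖
    · have := ci i
      obtain ⟨s, hs, h⟩ := ivt0 (d := fun w => φi i w - φ w) (by fun_prop) a.1 a.2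
      exact ⟨s, hs, fun _ _ => h⟩
    · exact ⟨0, by simp, fun x y => absurd ⟨x, y⟩ a⟩
  choose s hs hse using this
  obtain ⟨w, hw⟩ := ulim U (u := fun i => s i * zi i) (C := ‖z‖ + 1) (by
    filter_upwards [hz.norm.eventually_lt_const (lt_add_one ‖z‖)] with i h
    rw [norm_mul, Complex.norm_real, Real.norm_eq_abs, abs_of_nonneg (hs i).1]
    nlinarith [(hs i).2, norm_nonneg (zi i)])
  have hd : ∀ᶠ i in (U : Filter ι), ‖φi i (s i * zi i) - φ (s i * zi i)‖ = min ε 1 := by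
    filter_upwards [e0, hn] with i a b
    rw [dist_zero_right] at b
    exact hse i a ((min_le_left _ _).trans b)
  obtain ⟨d, hdl⟩ := ulim U (hd.mono fun i h => h.le)
  have e1 : ‖d‖ = min ε 1 := tendsto_nhds_unique hdl.norm (tendsto_const_nhds.congr' (hd.mono fun i h => h.symm))
  have e2 : Tendsto (fun i => φi i (s i * zi i)) U (𝓝 (d + φ w)) := by
    simpa using hdl.add ((c.tendsto w).comp hw)
  obtain ⟨n, hn⟩ := ee_inj (tendsto_nhds_unique ((ee_cont.tendsto _).comp e2) (H _ w hw))
  have e3 : d = n * TP := by linear_combination hn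
  have : n = 0 := nTP_small (by rw [← e3, e1]; exact min_le_right _ _)
  rw [e3, this] at e1; simp at e1; exact absurd e1 hδ.ne

structure Desc (g : Sph → Sph) (Θ : ℂ ≃ₜ ℂ) : Prop where
  e : ∀ z, g (ee z) = ee (Θ z)
  N : g Np = Np
  S : g Sp = Sp
lemma sph_cases (x : Sph) : x = Np ∨ x = Sp ∨ ∃ z, ee z = x := by
  by_cases a : x = Np
  · exact .inl a
  by_cases b : x = Sp
  · exact .inr (.inl b)
  exact .inr (.inr (ee_sur a b))
lemma Desc.uniq {g g' : Sph → Sph} {Θ Θ' : ℂ ≃ₜ ℂ} (d : Desc g Θ) (d' : Desc g' Θ') (h : ∀ z, ee (Θ z) = ee (Θ' z)) : g = g' := by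
  funext x
  rcases sph_cases x with rfl | rfl | ⟨z, rfl⟩
  · rw [d.N, d'.N]
  · rw [d.S, d'.S]
  · rw [d.e, d'.e, h]
lemma Desc.comp {g g' : Sph → Sph} {Θ Θ' : ℂ ≃ₜ ℂ} (d : Desc g Θ) (d' : Desc g' Θ') : Desc (g' ∘ g) (Θ.trans Θ') :=
  ⟨fun z => by simp [d.e, d'.e], by simp [d.N, d'.N], by simp [d.S, d'.S]⟩
lemma Desc_ex {Θ : ℂ ≃ₜ ℂ} (hp : ∀ z, Θ (z + vi (2 * π)) = Θ z + vi (2 * π)) : ∃ g, Desc g Θ := by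
  classical
  refine ⟨fun x => if x = Np then Np else if x = Sp then Sp else ee (Θ (Complex.log (pr x))), fun z => ?_, by simp, by simp [SN]⟩
  beta_reduce
  rw [if_neg (ee_N z), if_neg (ee_S z), pr_ee]
  obtain ⟨n, hn⟩ := Complex.exp_eq_exp_iff_exists_int.1 (Complex.exp_log (Complex.exp_ne_zero z))
  have : Complex.log (Complex.exp z) = z + n * TP := hn
  rw [this, nTP, vper hp, ← nTP, ee_per]
lemma gl {Θi : ι → ℂ ≃ₜ ℂ} {Θ : ℂ ≃ₜ ℂ} (C : Cv U Θi Θ) {gi : ι → Sph → Sph} {g : Sph → Sph} (di : ∀ i, Desc (gi i) (Θi i)) (d : Desc g Θ)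
    {xi : ι → Sph} {x : Sph} (hx : Tendsto xi U (𝓝 x)) : Tendsto (fun i => gi i (xi i)) U (𝓝 (g x)) := by
  rcases sph_cases x with rfl | rfl | ⟨z, rfl⟩
  · rw [d.N]; intro V hV
    obtain ⟨M, hM⟩ := N1 hV
    obtain ⟨N, hN⟩ := C.top M
    rw [mem_map]
    filter_upwards [hN, hx.eventually (N2 N)] with i a b
    rcases b with b | ⟨z, b, c⟩
    · rw [mem_preimage, b, (di i).N]; exact mem_of_mem_nhds hV
    · rw [mem_preimage, b, (di i).e]; exact hM _ (a _ c)
  · rw [d.S]; intro V hV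
    obtain ⟨M, hM⟩ := S1 hV
    obtain ⟨N, hN⟩ := C.bot M
    rw [mem_map]
    filter_upwards [hN, hx.eventually (S2 N)] with i a b
    rcases b with b | ⟨z, b, c⟩
    · rw [mem_preimage, b, (di i).S]; exact mem_of_mem_nhds hV
    · rw [mem_preimage, b, (di i).e]; exact hM _ (a _ c)
  · rw [d.e]
    obtain ⟨zi, hz, he⟩ := ee_loc hx
    refine ((ee_cont.tendsto _).comp (C.lim hz)).congr' (he.mono fun i h => ?_)
    beta_reduce; rw [h, (di i).e]; rfl
lemma Desc.homeo {g : Sph → Sph} {Θ : ℂ ≃ₜ ℂ} (d : Desc g Θ) (L : IsLift Θ) : IsHomeomorph g := by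
  have hc : Continuous g := continuous_iff_ultrafilter.2 fun x V hV =>
    gl (xi := id) (gi := fun _ => g) (Cv.of_lim (φi := fun _ => Θ) (fun _ => L) L fun zi z hz => (Θ.continuous.tendsto z).comp hz) (fun _ => d) d hV
  obtain ⟨g', d'⟩ := Desc_ex (Θ := Θ.symm) L.sper
  have i : Desc id (Homeomorph.refl ℂ) := ⟨fun _ => rfl, rfl, rfl⟩
  have e1 := (d.comp d').uniq i fun z => by simp
  have e2 := (d'.comp d).uniq i fun z => by simp
  exact isHomeomorph_iff_continuous_bijective.2 ⟨hc, Function.bijective_iff_has_inverse.2 ⟨g', congrFun e1, congrFun e2⟩⟩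

def cjH : ℂ ≃ₜ ℂ := Complex.conjCLE.toHomeomorph
lemma cjH_ap (z : ℂ) : cjH z = cj z := rfl
lemma cj_re (z : ℂ) : (cj z).re = z.re := Complex.conj_re z
lemma cj_add (z w : ℂ) : cj (z + w) = cj z + cj w := map_add _ _ _
lemma cj_TP : cj TP = -TP := by
  rw [TP_eq]; apply Complex.ext <;> simp [cj]
lemma clift {f : Sph → Sph} (hc : Continuous f) (hN : ∀ z, f (ee z) ≠ Np) (hS : ∀ z, f (ee z) ≠ Sp) : ∃ φ : C(ℂ, ℂ), ∀ z, f (ee z) = ee (φ z) := by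
  have c : Continuous fun z => pr (f (ee z)) := continuous_iff_continuousAt.2 fun z =>
    ContinuousAt.comp (f := fun z => f (ee z)) (pr_at (hN z)) (hc.comp ee_cont).continuousAt
  obtain ⟨F, ⟨-, h⟩, -⟩ := Complex.isCoveringMapOn_exp.existsUnique_continuousMap_lifts (A := ℂ) ⟨_, c⟩ (a₀ := 0)
    (e₀ := Complex.log (pr (f (ee 0)))) (Complex.exp_log (pr_ne (hN 0) (hS 0))) fun z => pr_ne (hN z) (hS z)
  exact ⟨F, fun z => (ee_log (hN z) (congrFun h z)).symm⟩
lemma ltop {f : Sph → Sph} (hc : Continuous f) (hN : f Np = Np) {φ : ℂ → ℂ} (h : ∀ z, f (ee z) = ee (φ z)) (M : ℝ) :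
    ∃ N : ℝ, ∀ z : ℂ, N ≤ z.re → M ≤ (φ z).re := by
  have t := hc.tendsto Np; rw [hN] at t
  obtain ⟨N, k⟩ := N1 (t (N2 M))
  refine ⟨N, fun z hz => ?_⟩
  rcases k z hz with k | ⟨w, k, hw⟩
  · rw [h] at k; exact absurd k (ee_N _)
  · rw [h] at k
    obtain ⟨n, hn⟩ := ee_inj k
    rw [hn, nTP]; simpa using hw
lemma lbot {f : Sph → Sph} (hc : Continuous f) (hS : f Sp = Sp) {φ : ℂ → ℂ} (h : ∀ z, f (ee z) = ee (φ z)) (M : ℝ) :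
    ∃ N : ℝ, ∀ z : ℂ, z.re ≤ N → (φ z).re ≤ M := by
  have t := hc.tendsto Sp; rw [hS] at t
  obtain ⟨N, k⟩ := S1 (t (S2 M))
  refine ⟨N, fun z hz => ?_⟩
  rcases k z hz with k | ⟨w, k, hw⟩
  · rw [h] at k; exact absurd k (ee_S _)
  · rw [h] at k
    obtain ⟨n, hn⟩ := ee_inj k
    rw [hn, nTP]; simpa using hw
lemma lper {f : Sph → Sph} {φ : ℂ → ℂ} (c : Continuous φ) (h : ∀ z, f (ee z) = ee (φ z)) : ∃ m : ℤ, ∀ z, φ (z + TP) = φ z + m * TP := by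
  have k : ∀ z, ∃ n : ℤ, φ (z + TP) - φ z = n * TP := fun z => by
    have := ee_per z 1
    rw [Int.cast_one, one_mul] at this
    obtain ⟨n, hn⟩ := ee_inj (show ee (φ (z + TP)) = ee (φ z) by rw [← h, ← h, this])
    exact ⟨n, by rw [hn]; ring⟩
  obtain ⟨m, hm⟩ := k 0
  refine ⟨m, fun z => ?_⟩
  have := dconst (d := fun z => φ (z + TP) - φ z) (by fun_prop) k z
  beta_reduce at this
  rw [hm] at this; linear_combination this
lemma plift (e : Sph ≃ₜ Sph) (hN : e Np = Np) (hS : e Sp = Sp) :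
    ∃ φ : ℂ ≃ₜ ℂ, (∀ z, e (ee z) = ee (φ z)) ∧ (IsLift φ ∨ IsLift (φ.trans cjH)) := by
  have key : ∀ e : Sph ≃ₜ Sph, e Np = Np → e Sp = Sp → ∃ φ : C(ℂ, ℂ), ∀ z, e (ee z) = ee (φ z) := fun e hN hS =>
    clift e.continuous (fun z h => ee_N z (e.injective (h.trans hN.symm))) (fun z h => ee_S z (e.injective (h.trans hS.symm)))
  obtain ⟨φ, h⟩ := key e hN hS
  obtain ⟨ψ0, h0⟩ := key e.symm (by rw [e.symm_apply_eq, hN]) (by rw [e.symm_apply_eq, hS])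
  have k : ∀ z, ∃ n : ℤ, ψ0 (φ z) - z = n * TP := fun z => by
    obtain ⟨n, hn⟩ := ee_inj (show ee (ψ0 (φ z)) = ee z by rw [← h0, ← h, e.symm_apply_apply])
    exact ⟨n, by rw [hn]; ring⟩
  obtain ⟨n, hn⟩ := k 0
  have k1 : ∀ z, ψ0 (φ z) - n * TP = z := fun z => by
    have := dconst (d := fun z => ψ0 (φ z) - z) (by fun_prop) k z
    beta_reduce at this
    rw [hn] at this; linear_combination this
  set ψ : ℂ → ℂ := fun z => ψ0 z - n * TP with hψ
  have cψ : Continuous ψ := by fun_prop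
  have h1 : ∀ z, e.symm (ee z) = ee (ψ z) := fun z => by
    rw [h0, hψ]; beta_reduce
    rw [← ee_per (ψ0 z - n * TP) n]; congr 1; ring
  have k2 : ∀ z, ∃ n : ℤ, φ (ψ z) - z = n * TP := fun z => by
    obtain ⟨n, hn⟩ := ee_inj (show ee (φ (ψ z)) = ee z by rw [← h, ← h1, e.apply_symm_apply])
    exact ⟨n, by rw [hn]; ring⟩
  have k3 : ∀ z, φ (ψ z) = z := fun z => by
    have a := dconst (d := fun z => φ (ψ z) - z) (by fun_prop) k2
    have b := (a z).trans (a (φ 0)).symm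
    beta_reduce at b
    rw [show ψ (φ 0) = 0 from k1 0, sub_self] at b
    exact sub_eq_zero.1 b
  obtain ⟨m, hm⟩ := lper φ.continuous h
  obtain ⟨m', hm'⟩ := lper cψ h1
  let Φ : ℂ ≃ₜ ℂ := { toFun := φ, invFun := ψ, left_inv := k1, right_inv := k3, continuous_toFun := φ.continuous, continuous_invFun := cψ }
  have mm : m * m' = 1 := by
    have a := k3 (0 + TP)
    have q := per_int (D := univ) (f := φ) (p := TP) (q := m * TP) (by simp) (fun z _ => hm z) m' (ψ 0) (mem_univ _)
    rw [hm', q.2, k3] at a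
    have : ((m * m' : ℤ) : ℂ) * TP = (1 : ℤ) * TP := by push_cast; linear_combination a
    exact_mod_cast mul_right_cancel₀ TP_ne this
  refine ⟨Φ, h, ?_⟩
  have tp := ltop e.continuous hN h
  have bt := lbot e.continuous hS h
  rcases Int.eq_one_or_neg_one_of_mul_eq_one mm with rfl | rfl
  · exact .inl ⟨fun z => by have := hm z; simp only [Int.cast_one, one_mul] at this; exact this, tp, bt⟩
  · refine .inr ⟨fun z => ?_, fun M => ?_, fun M => ?_⟩
    · show cj (φ (z + TP)) = cj (φ z) + TP
      rw [hm, cj_add]; congr 1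
      rw [show ((-1 : ℤ) : ℂ) * TP = -TP by simp, cj, map_neg, ← cj, cj_TP, neg_neg]
    · obtain ⟨N, h⟩ := tp M
      exact ⟨N, fun z hz => (h z hz).trans (cj_re (φ z)).ge⟩
    · obtain ⟨N, h⟩ := bt M
      exact ⟨N, fun z hz => (cj_re (φ z)).le.trans (h z hz)⟩
def dg (a b c : ℝ) (ha : a * a = 1) (hb : b * b = 1) (hc : c * c = 1) : O3 := ⟨Matrix.diagonal ![a, b, c], by
  rw [Matrix.mem_orthogonalGroup_iff', Matrix.diagonal_transpose, Matrix.diagonal_mul_diagonal, Matrix.diagonal_eq_one]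
  funext i; fin_cases i <;> simpa⟩
lemma Act_dg {a b c : ℝ} {ha : a * a = 1} {hb : b * b = 1} {hc : c * c = 1} (x : Sph) (i : Fin 3) : (Act (dg a b c ha hb hc) x).1 i = ![a, b, c] i * x.1 i := by
  rw [Act_c]; exact Matrix.mulVec_diagonal _ _ _
def Cj : O3 := dg 1 (-1) 1 (by norm_num) (by norm_num) (by norm_num)
def Ro : O3 := dg 1 1 (-1) (by norm_num) (by norm_num) (by norm_num)
lemma Act_Ro (x : Sph) : Act Ro x = Rf x := by
  apply sph_ext <;> rw [Ro, Act_dg] <;> simp [Rf, m3]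
lemma Act_Cj (z : ℂ) : Act Cj (ee z) = ee (cj z) := by
  have e : ee (cj z) = st (starRingEnd ℂ (Complex.exp z)) := by rw [ee, cj, Complex.exp_conj]
  rw [e, ee]
  apply sph_ext <;> rw [Cj, Act_dg] <;> simp [st0, st1, st2, neg_div]
lemma Cj_N : Act Cj Np = Np := by
  apply sph_ext <;> rw [Cj, Act_dg] <;> simp [Np, m3]
lemma Act_homeo (Q : O3) : IsHomeomorph (Act Q) := isHomeomorph_iff_continuous_bijective.2 ⟨Act_cont Q,
  Function.bijective_iff_has_inverse.2 ⟨Act Q⁻¹, Act_inv Q, Act_inv' Q⟩⟩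
lemma rep {f : Sph → Sph} (hf : IsHomeomorph f) (hp : f Sp = -f Np) : ∃ Q φ f', IsLift φ ∧ Desc f' φ ∧ f = Act Q ∘ f' := by
  obtain ⟨Q, hQ⟩ := O3_N (f Np)
  have hS : Act Q Sp = f Sp := by rw [hp, ← hQ, ← Np_neg, Act_neg]
  let e : Sph ≃ₜ Sph := ((Act_homeo Q⁻¹).comp hf).homeomorph
  have he : ∀ x, e x = Act Q⁻¹ (f x) := fun x => rfl
  obtain ⟨φ, h, L | L⟩ := plift e (by rw [he, ← hQ, Act_inv]) (by rw [he, ← hS, Act_inv])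
  · refine ⟨Q, φ, e, L, ⟨h, by rw [he, ← hQ, Act_inv], by rw [he, ← hS, Act_inv]⟩, ?_⟩
    funext x; simp [he, Act_inv']
  · refine ⟨Q * Cj, φ.trans cjH, Act Cj ∘ e, L, ⟨fun z => ?_, ?_, ?_⟩, ?_⟩
    · simp only [Function.comp_apply]; rw [h, Act_Cj]; rfl
    · simp only [Function.comp_apply]; rw [he, ← hQ, Act_inv, Cj_N]
    · simp only [Function.comp_apply]; rw [he, ← hS, Act_inv, Act_S Cj_N]
    · have : Cj * Cj = 1 := by
        apply Subtype.ext; exact (congrArg (· * Cj.1) (Matrix.diagonal_transpose _).symm).trans (om Cj)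
      funext x; simp only [Function.comp_apply]; rw [← Act_mul, mul_assoc, this, mul_one, he, Act_inv']

lemma adj {φi : ι → ℂ → ℂ} {φ : ℂ → ℂ} (ci : ∀ i, Continuous (φi i)) (c : Continuous φ)
    (H : ∀ (zi : ι → ℂ) z, Tendsto zi U (𝓝 z) → Tendsto (fun i => ee (φi i (zi i))) U (𝓝 (ee (φ z)))) :
    ∃ n : ι → ℤ, ∀ (zi : ι → ℂ) z, Tendsto zi U (𝓝 z) → Tendsto (fun i => φi i (zi i) + n i * TP) U (𝓝 (φ z)) := by
  obtain ⟨wi, hw, he⟩ := ee_loc (H (fun _ => 0) 0 tendsto_const_nhds)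
  have : ∀ i, ∃ n : ℤ, ee (φi i 0) = ee (wi i) → wi i = φi i 0 + n * TP := fun i => by
    by_cases h : ee (φi i 0) = ee (wi i)
    · obtain ⟨n, hn⟩ := ee_inj h.symm
      exact ⟨n, fun _ => hn⟩
    · exact ⟨0, fun k => absurd k h⟩
  choose n hn using this
  refine ⟨n, liftlim (φi := fun i z => φi i z + n i * TP) (fun i => by have := ci i; fun_prop) c (fun zi z hz => ?_) (hw.congr' (he.mono fun i h => hn i h))⟩
  simpa only [ee_per] using H zi z hz
def Rel (f : Sph → Sph) (t : ℝ) (g : Sph → Sph) : Prop := ∃ Q φ Θ f' g', IsLift φ ∧ IsLift Θ ∧ Desc f' φ ∧ Desc g' Θ ∧ Tr φ t Θ ∧ f = Act Q ∘ f' ∧ g = Act Q ∘ g'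
lemma Desc.act {R : O3} (h : Act R Np = Np) {κ : ℂ ≃ₜ ℂ} (hR : ∀ z, Act R (ee z) = ee (κ z)) : Desc (Act R) κ := ⟨hR, h, Act_S h⟩
lemma Rel.lim {fi gi : ι → Sph → Sph} {f g : Sph → Sph} {ti : ι → ℝ} {t : ℝ} (ht : Tendsto ti U (𝓝 t)) (Ri : ∀ i, Rel (fi i) (ti i) (gi i)) (R0 : Rel f t g)
    (hf : ∀ (xi : ι → Sph) x, Tendsto xi U (𝓝 x) → Tendsto (fun i => fi i (xi i)) U (𝓝 (f x)))
    {xi : ι → Sph} {x : Sph} (hx : Tendsto xi U (𝓝 x)) : Tendsto (fun i => gi i (xi i)) U (𝓝 (g x)) := by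
  choose Qi φi Θi f'i g'i Li Li' di di' Ti ei ei' using Ri
  obtain ⟨Q, φ, Θ, f', g', L, L', d, d', T, e, e'⟩ := R0
  obtain ⟨Q', hQ⟩ := O3_lim U Qi
  have hQi : ∀ a b, Tendsto (fun i => ((Qi i)⁻¹).1 a b) U (𝓝 ((Q'⁻¹).1 a b)) := fun a b => by simpa only [inv_e] using hQ b a
  have hN : Act Q' Np = Act Q Np := by
    have a := hf (fun _ => Np) Np tendsto_const_nhds
    simp only [ei, e, Function.comp_apply, (di _).N, d.N] at a
    exact tendsto_nhds_unique (Act_lim hQ tendsto_const_nhds) a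
  have hf' : ∀ (yi : ι → Sph) y, Tendsto yi U (𝓝 y) → Tendsto (fun i => f'i i (yi i)) U (𝓝 (Act (Q'⁻¹ * Q) (f' y))) := fun yi y hy => by
    have := Act_lim hQi (hf yi y hy)
    simpa only [ei, e, Function.comp_apply, ← Act_mul, inv_mul_cancel, Act_one] using this
  have hR : Act (Q'⁻¹ * Q) Np = Np := by rw [Act_mul, ← hN, Act_inv]
  have Hl : ∀ κ : ℂ → ℂ, (∀ z, Act (Q'⁻¹ * Q) (ee z) = ee (κ z)) → ∀ (zi : ι → ℂ) z, Tendsto zi U (𝓝 z) →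
      Tendsto (fun i => ee (φi i (zi i))) U (𝓝 (ee (κ (φ z)))) := fun κ hκ zi z hz => by
    have := hf' _ _ ((ee_cont.tendsto z).comp hz)
    simpa only [Function.comp_apply, (di _).e, d.e, hκ] using this
  rcases stab hR with ⟨θ, hθ⟩ | ⟨θ, hθ⟩
  · set κ := Homeomorph.addRight (vi θ)
    have hκ : ∀ z, Act (Q'⁻¹ * Q) (ee z) = ee (κ z) := hθ
    obtain ⟨n, hn⟩ := adj (fun i => (φi i).continuous) (κ.continuous.comp φ.continuous) (Hl κ hκ)
    set τ := fun i => Homeomorph.addRight (vi (n i * (2 * π)))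
    have dτ : ∀ {k : Sph → Sph} {ψ : ℂ ≃ₜ ℂ} i, Desc k ψ → Desc k (ψ.trans (τ i)) := fun {k ψ} i h =>
      ⟨fun z => by rw [h.e, Homeomorph.trans_apply, ← ee_per _ (n i), nTP]; rfl, h.N, h.S⟩
    have C : Cv U (fun i => (φi i).trans (τ i)) (φ.trans κ) := Cv.of_lim (fun i => (Li i).trans (vsh _)) (L.trans (vsh _)) fun zi z hz => by
      have := hn zi z hz
      simp only [nTP] at this; exact this
    have C' : Cv U (fun i => (Θi i).trans (τ i)) (Θ.trans κ) := Cv.of_lim (fun i => (Li' i).trans (vsh _)) (L'.trans (vsh _)) fun zi z hz =>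
      Tr.lim (fun i => (Li i).trans (vsh _)) (L.trans (vsh _)) C ht (fun i => (Ti i).rot _) (T.rot _) hz
    have := Act_lim hQ (gl C' (fun i => dτ i (di' i)) (d'.comp (Desc.act hR hκ)) hx)
    simpa only [ei', e', Function.comp_apply, ← Act_mul, mul_inv_cancel_left] using this
  · exfalso
    set κ := cjH.trans (Homeomorph.addRight (vi θ)) with hs
    obtain ⟨n, hn⟩ := adj (fun i => (φi i).continuous) (κ.continuous.comp φ.continuous) (Hl κ hθ)
    have a := (hn (fun _ => 0) 0 tendsto_const_nhds).add_const TP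
    have b := hn (fun _ => 0 + TP) _ tendsto_const_nhds
    simp only [(Li _).per] at b
    have c := tendsto_nhds_unique a (b.congr fun i => by ring)
    have k : ∀ w, κ w = cj w + vi θ := fun w => rfl
    simp only [Function.comp_apply, L.per, k, cj_add, cj_TP] at c
    have : 2 * TP = 0 := by linear_combination c
    simp [TP_ne] at this
lemma Rel_ex {f : Sph → Sph} (hf : IsHomeomorph f) (hp : f Sp = -f Np) {t : ℝ} (ht : t ∈ Icc 0 1) : ∃ g, IsHomeomorph g ∧ Rel f t g := by
  obtain ⟨Q, φ, f', L, d, e⟩ := rep hf hp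
  obtain ⟨Θ, L', T⟩ := Tr_ex L ht
  obtain ⟨g', d'⟩ := Desc_ex (Θ := Θ) L'.per'
  exact ⟨_, (Act_homeo Q).comp (d'.homeo L'), Q, φ, Θ, f', g', L, L', d, d', T, e, rfl⟩
lemma Rel.zero {f g : Sph → Sph} (h : Rel f 0 g) : g = f := by
  obtain ⟨Q, φ, Θ, f', g', L, L', d, d', T, e, e'⟩ := h
  rcases T with ⟨-, rfl⟩ | ⟨h, -⟩ | ⟨h, -⟩
  · rw [e, e', d'.uniq d fun _ => rfl]
  · norm_num at h
  · exact absurd h.1 (lt_irrefl _)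
lemma rot_ex (b : ℝ) : ∃ R : O3, Act R Np = Np ∧ ∀ z, Act R (ee z) = ee (z + vi b) := by
  have h : Real.cos b * Real.cos b + Real.sin b * Real.sin b = 1 := by have := Real.cos_sq_add_sin_sq b; linarith
  let M : Matrix (Fin 3) (Fin 3) ℝ := !![Real.cos b, -Real.sin b, 0; Real.sin b, Real.cos b, 0; 0, 0, 1]
  have hM : M ∈ Matrix.orthogonalGroup (Fin 3) ℝ := by
    rw [Matrix.mem_orthogonalGroup_iff']
    ext i j; fin_cases i <;> fin_cases j <;> simp [M, Matrix.mul_apply, Fin.sum_univ_three] <;> linarith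
  refine ⟨⟨M, hM⟩, sph_ext ?_ ?_ ?_, fun z => ?_⟩
  iterate 3 rw [Act_i]; simp [M, Np, m3]
  have e : Complex.exp (vi b) = ⟨Real.cos b, Real.sin b⟩ := by
    rw [vi, Complex.exp_mul_I]; apply Complex.ext <;> simp [Complex.cos_ofReal_re, Complex.sin_ofReal_re]
  rw [ee, ee, Complex.exp_add, e]
  generalize Complex.exp z = u
  have hn : Complex.normSq (u * ⟨Real.cos b, Real.sin b⟩) = Complex.normSq u := by
    rw [Complex.normSq_mul, Complex.normSq_mk (Real.cos b), h, mul_one]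
  apply sph_ext <;> rw [Act_i] <;> simp only [st0, st1, st2, hn, Complex.mul_re, Complex.mul_im] <;> simp [M] <;> ring
lemma Rel.one {f g : Sph → Sph} (h : Rel f 1 g) : ∃ Q, g = Act Q := by
  obtain ⟨Q, φ, Θ, f', g', L, L', d, d', T, e, e'⟩ := h
  rcases T with ⟨h, -⟩ | ⟨-, h⟩ | ⟨h, -⟩
  · norm_num at h
  · obtain ⟨R, h1, h2⟩ := rot_ex (bb φ)
    refine ⟨Q * R, ?_⟩
    rw [e', d'.uniq (Desc.act (κ := Homeomorph.addRight (vi (bb φ))) h1 h2) fun z => by rw [h]; rfl]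
    funext x; exact (Act_mul _ _ _).symm
  · exact absurd h.2 (lt_irrefl _)
lemma Rel.act {f g : Sph → Sph} {t : ℝ} (h : Rel f t g) (R : O3) : Rel (Act R ∘ f) t (Act R ∘ g) := by
  obtain ⟨Q, φ, Θ, f', g', L, L', d, d', T, rfl, rfl⟩ := h
  exact ⟨R * Q, φ, Θ, f', g', L, L', d, d', T, funext fun x => (Act_mul _ _ _).symm, funext fun x => (Act_mul _ _ _).symm⟩
lemma Rel.orth (Q : O3) {t : ℝ} (ht : t ∈ Icc 0 1) : Rel (Act Q) t (Act Q) := by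
  have d : Desc id (Homeomorph.refl ℂ) := ⟨fun _ => rfl, rfl, rfl⟩
  have L : IsLift (Homeomorph.refl ℂ) := ⟨fun _ => rfl, fun M => ⟨M, fun z h => h⟩, fun M => ⟨M, fun z h => h⟩⟩
  exact ⟨Q, _, _, id, id, L, L, d, d, Tr.id ht, rfl, rfl⟩
lemma Desc.sc {g : Sph → Sph} {Θ : ℂ ≃ₜ ℂ} (d : Desc g Θ) : Desc (fun x => Rf (g (-x))) (sc Θ) :=
  ⟨fun z => by rw [← ee_neg, d.e, ← ee_sg, sc_ap], by rw [Np_neg, d.S, Rf_S], by rw [← Np_neg, neg_neg, d.N, Rf_N, Np_neg]⟩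
lemma Rel.neg {f g : Sph → Sph} {t : ℝ} (h : Rel f t g) : Rel (fun x => f (-x)) t (fun x => g (-x)) := by
  obtain ⟨Q, φ, Θ, f', g', L, L', d, d', T, rfl, rfl⟩ := h
  have k : ∀ y, Act (Q * Ro) (Rf y) = Act Q y := fun y => by rw [Act_mul, Act_Ro, Rf_Rf]
  exact ⟨Q * Ro, _, _, _, _, L.sc, L'.sc, d.sc, d'.sc, T.sc L, funext fun x => (k _).symm, funext fun x => (k _).symm⟩

open Classical in
def Hc (c : E3) (x : Sph) : Sph := if h : x.1 = c then x else ⟨‖x.1 - c‖⁻¹ • (x.1 - c), by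
  rw [mem_sphere_zero_iff_norm, norm_smul, norm_inv, norm_norm, inv_mul_cancel₀ (norm_ne_zero_iff.2 (sub_ne_zero.2 h))]⟩
lemma ne_c {c : E3} (hc : ‖c‖ < 1) (x : Sph) : x.1 ≠ c := fun h => by
  rw [← h, norm_eq_of_mem_sphere] at hc; exact lt_irrefl _ hc
lemma Hc_v {c : E3} {x : Sph} (h : x.1 ≠ c) : (Hc c x).1 = ‖x.1 - c‖⁻¹ • (x.1 - c) := by rw [Hc, dif_neg h]
lemma Hc_0 (x : Sph) : Hc 0 x = x := Subtype.ext (by rw [Hc_v (ne_c (by simp) x), sub_zero, norm_eq_of_mem_sphere]; simp)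
lemma Hc_lim {F : Filter ι} {ci : ι → E3} {c : E3} (hc : ‖c‖ < 1) (h : Tendsto ci F (𝓝 c)) {xi : ι → Sph} {x : Sph} (hx : Tendsto xi F (𝓝 x)) :
    Tendsto (fun i => Hc (ci i) (xi i)) F (𝓝 (Hc c x)) := by
  have hx' := (continuous_subtype_val.tendsto x).comp hx
  have h2 := hx'.sub h
  have h3 := (h2.norm.inv₀ (norm_ne_zero_iff.2 (sub_ne_zero.2 (ne_c hc x)))).smul h2
  rw [← Hc_v (ne_c hc x)] at h3
  refine tendsto_subtype_rng.2 (h3.congr' ?_)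
  filter_upwards [h2.eventually_ne (sub_ne_zero.2 (ne_c hc x))] with i hi
  exact (Hc_v (sub_ne_zero.1 hi)).symm
lemma Hc_homeo {c : E3} (hc : ‖c‖ < 1) : IsHomeomorph (Hc c) := by
  have hp : ∀ x : Sph, 0 < ‖x.1 - c‖ := fun x => norm_pos_iff.2 (sub_ne_zero.2 (ne_c hc x))
  have hv : ∀ x : Sph, x.1 = c + ‖x.1 - c‖ • (Hc c x).1 := fun x => by
    rw [Hc_v (ne_c hc x), smul_smul, mul_inv_cancel₀ (hp x).ne', one_smul]; abel
  have hq : ∀ (y : Sph) (s : ℝ), ‖c + s • y.1‖ ^ 2 = ‖c‖ ^ 2 + 2 * s * inner ℝ c y.1 + s ^ 2 := fun y s => by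
    rw [norm_add_sq_real, inner_smul_right, norm_smul, norm_eq_of_mem_sphere y, mul_one, Real.norm_eq_abs, sq_abs]; ring
  have hc2 : ‖c‖ ^ 2 < 1 := by nlinarith [norm_nonneg c]
  refine isHomeomorph_iff_continuous_bijective.2 ⟨continuous_iff_continuousAt.2 fun x => Hc_lim hc tendsto_const_nhds tendsto_id, fun x y h => ?_, fun y => ?_⟩
  · have a := hq (Hc c x) ‖x.1 - c‖
    have b := hq (Hc c y) ‖y.1 - c‖
    rw [← hv, norm_eq_of_mem_sphere] at a b
    rw [← h] at b
    have hx := hp x; have hy := hp y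
    have e : ‖x.1 - c‖ = ‖y.1 - c‖ := by
      have k : (‖x.1 - c‖ - ‖y.1 - c‖) * (‖x.1 - c‖ * ‖y.1 - c‖ + (1 - ‖c‖ ^ 2)) = 0 := by linear_combination ‖x.1 - c‖ * b - ‖y.1 - c‖ * a
      rcases mul_eq_zero.1 k with k | k
      · linarith
      · nlinarith [mul_pos hx hy]
    apply Subtype.ext; rw [hv x, hv y, e, h]
  · set p := inner ℝ c y.1
    have hr : |p| < √(p ^ 2 + 1 - ‖c‖ ^ 2) := by rw [Real.lt_sqrt (abs_nonneg p), sq_abs]; linarith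
    have hs := Real.sq_sqrt (show 0 ≤ p ^ 2 + 1 - ‖c‖ ^ 2 by nlinarith [sq_nonneg p])
    set R := √(p ^ 2 + 1 - ‖c‖ ^ 2)
    have h0 : 0 < R - p := by linarith [le_abs_self p]
    have h1 : ‖c + (R - p) • y.1‖ = 1 := by
      rw [← sq_eq_sq₀ (norm_nonneg _) zero_le_one, hq]; linear_combination hs
    refine ⟨⟨c + (R - p) • y.1, by rwa [mem_sphere_zero_iff_norm]⟩, Subtype.ext ?_⟩
    rw [Hc_v (ne_c hc _)]
    simp only [add_sub_cancel_left]
    rw [norm_smul, norm_eq_of_mem_sphere y, Real.norm_eq_abs, abs_of_pos h0, mul_one, smul_smul, inv_mul_cancel₀ h0.ne', one_smul]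
def cf (f : Sph → Sph) : E3 := (1 / 2 : ℝ) • ((f Np).1 + (f Sp).1)
def Sf (f : Sph → Sph) (u : ℝ) (x : Sph) : Sph := Hc (u • cf f) (f x)
lemma cf_lt {f : Sph → Sph} (hf : IsHomeomorph f) : ‖cf f‖ < 1 := by
  have h : (f Np).1 ≠ (f Sp).1 := fun h => SN (hf.injective (Subtype.ext h)).symm
  have := norm_midpoint_lt_iff (x := (f Np).1) (y := (f Sp).1) (by rw [norm_eq_of_mem_sphere, norm_eq_of_mem_sphere])
  rw [norm_eq_of_mem_sphere] at this
  exact this.2 h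
lemma ucf_lt {f : Sph → Sph} (hf : IsHomeomorph f) {u : ℝ} (hu : u ∈ Icc 0 1) : ‖u • cf f‖ < 1 := by
  have := cf_lt hf
  rw [norm_smul, Real.norm_eq_abs, abs_of_nonneg hu.1]
  nlinarith [hu.2, hu.1, norm_nonneg (cf f)]
lemma Sf_homeo {f : Sph → Sph} (hf : IsHomeomorph f) {u : ℝ} (hu : u ∈ Icc 0 1) : IsHomeomorph (Sf f u) := (Hc_homeo (ucf_lt hf hu)).comp hf
lemma i1 : (1 : ℝ) ∈ Icc (0 : ℝ) 1 := by simp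
lemma Sf_pole {f : Sph → Sph} (hf : IsHomeomorph f) : Sf f 1 Sp = -Sf f 1 Np := by
  have h := cf_lt hf
  apply Subtype.ext
  rw [Sf, Sf, one_smul, show (-Hc (cf f) (f Np)).1 = -(Hc (cf f) (f Np)).1 from rfl, Hc_v (ne_c h _), Hc_v (ne_c h _)]
  have e : (f Np).1 - cf f = -((f Sp).1 - cf f) := by rw [cf]; module
  rw [e, norm_neg, smul_neg, neg_neg]
lemma Sf_0 (f : Sph → Sph) : Sf f 0 = f := by funext x; rw [Sf, zero_smul, Hc_0]
lemma Sf_lim {fi : ι → Sph → Sph} {f : Sph → Sph} (h : IsHomeomorph f)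
    (hf : ∀ (xi : ι → Sph) x, Tendsto xi U (𝓝 x) → Tendsto (fun i => fi i (xi i)) U (𝓝 (f x)))
    {ui : ι → ℝ} {u : ℝ} (hu : Tendsto ui U (𝓝 u)) (hu' : u ∈ Icc 0 1) (xi : ι → Sph) (x : Sph) (hx : Tendsto xi U (𝓝 x)) :
    Tendsto (fun i => Sf (fi i) (ui i) (xi i)) U (𝓝 (Sf f u x)) := by
  have k : ∀ y, Tendsto (fun i => (fi i y).1) U (𝓝 (f y).1) := fun y => (continuous_subtype_val.tendsto _).comp (hf (fun _ => y) y tendsto_const_nhds)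
  exact Hc_lim (ucf_lt h hu') (hu.smul (((k Np).add (k Sp)).const_smul _)) (hf xi x hx)
def AA (Q : O3) : E3 →ₗ[ℝ] E3 := Matrix.toEuclideanLin Q.1
lemma AA_v (Q : O3) (x : Sph) : (Act Q x).1 = AA Q x.1 := rfl
lemma AA_n (Q : O3) (v : E3) : ‖AA Q v‖ = ‖v‖ := by
  by_cases h : v = 0
  · simp [h]
  have hn := norm_ne_zero_iff.2 h
  have k := norm_eq_of_mem_sphere (Act Q ⟨‖v‖⁻¹ • v, by rw [mem_sphere_zero_iff_norm, norm_smul, norm_inv, norm_norm, inv_mul_cancel₀ hn]⟩)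
  rw [AA_v, map_smul, norm_smul, norm_inv, norm_norm] at k
  field_simp at k; exact k
lemma Hc_act (Q : O3) {c : E3} (hc : ‖c‖ < 1) (x : Sph) : Hc (AA Q c) (Act Q x) = Act Q (Hc c x) := by
  apply Subtype.ext
  rw [Hc_v (ne_c (by rwa [AA_n]) _), AA_v, AA_v, Hc_v (ne_c hc x), ← map_sub, AA_n, map_smul]
lemma Sf_act {f : Sph → Sph} (hf : IsHomeomorph f) {u : ℝ} (hu : u ∈ Icc 0 1) (Q : O3) : Sf (Act Q ∘ f) u = Act Q ∘ Sf f u := by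
  funext x
  have : u • cf (Act Q ∘ f) = AA Q (u • cf f) := by simp only [cf, Function.comp_apply, AA_v, map_smul, map_add]
  simp only [Sf, this, Function.comp_apply]; exact Hc_act Q (ucf_lt hf hu) _
lemma Sf_neg (f : Sph → Sph) (u : ℝ) : Sf (fun x => f (-x)) u = fun x => Sf f u (-x) := by
  have : cf (fun x => f (-x)) = cf f := by
    simp only [cf]; rw [← Np_neg, neg_neg, add_comm]
  funext x; simp only [Sf, this]
lemma Sf_orth (Q : O3) (u : ℝ) : Sf (Act Q) u = Act Q := by
  have : cf (Act Q) = 0 := by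
    rw [cf, ← Np_neg, Act_neg, show (-Act Q Np).1 = -(Act Q Np).1 from rfl]; simp
  funext x; rw [Sf, this, smul_zero, Hc_0]

def Rel2 (f : Sph → Sph) (t : ℝ) (g : Sph → Sph) : Prop := (t ≤ 1 / 2 ∧ g = Sf f (2 * t)) ∨ (1 / 2 ≤ t ∧ Rel (Sf f 1) (2 * t - 1) g)
lemma Rel2_ex {f : Sph → Sph} (hf : IsHomeomorph f) {t : ℝ} (ht : t ∈ Icc 0 1) : ∃ g, IsHomeomorph g ∧ Rel2 f t g := by
  rcases le_total t (1 / 2) with h | h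
  · exact ⟨_, Sf_homeo hf ⟨by linarith [ht.1], by linarith⟩, .inl ⟨h, rfl⟩⟩
  · obtain ⟨g, h1, h2⟩ := Rel_ex (Sf_homeo hf i1) (Sf_pole hf) (t := 2 * t - 1) ⟨by linarith, by linarith [ht.2]⟩
    exact ⟨g, h1, .inr ⟨h, h2⟩⟩
lemma Rel2.lo {f g : Sph → Sph} {t : ℝ} (h : Rel2 f t g) (ht : t ≤ 1 / 2) : g = Sf f (2 * t) := by
  rcases h with ⟨-, h⟩ | ⟨h1, h⟩
  · exact h
  · have e := le_antisymm ht h1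
    subst e
    norm_num at h ⊢; exact h.zero
lemma Rel2.up {f g : Sph → Sph} {t : ℝ} (hf : IsHomeomorph f) (h : Rel2 f t g) (ht : 1 / 2 ≤ t) : Rel (Sf f 1) (2 * t - 1) g := by
  rcases h with ⟨h1, h⟩ | ⟨-, h⟩
  · have e := le_antisymm h1 ht
    subst e
    norm_num at h ⊢
    obtain ⟨g', -, h2⟩ := Rel_ex (Sf_homeo hf i1) (Sf_pole hf) (t := 0) (by simp)
    rw [h]; rwa [h2.zero] at h2
  · exact h
lemma Rel2.lim {fi gi : ι → Sph → Sph} {f g : Sph → Sph} {ti : ι → ℝ} {t : ℝ} (ht : Tendsto ti U (𝓝 t)) (ht' : ∀ i, ti i ∈ Icc 0 1) (ht0 : t ∈ Icc 0 1)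
    (Fi : ∀ i, IsHomeomorph (fi i)) (F0 : IsHomeomorph f) (Ri : ∀ i, Rel2 (fi i) (ti i) (gi i)) (R0 : Rel2 f t g)
    (hf : ∀ (xi : ι → Sph) x, Tendsto xi U (𝓝 x) → Tendsto (fun i => fi i (xi i)) U (𝓝 (f x)))
    {xi : ι → Sph} {x : Sph} (hx : Tendsto xi U (𝓝 x)) : Tendsto (fun i => gi i (xi i)) U (𝓝 (g x)) := by
  rcases Ultrafilter.eventually_or.1 (Eventually.of_forall (f := (U : Filter ι)) fun i => le_total (ti i) (1 / 2)) with h | h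
  · have hl := le_of_tendsto ht h
    rw [R0.lo hl]
    refine (Sf_lim F0 hf (ht.const_mul 2) ⟨by linarith [ht0.1], by linarith⟩ xi x hx).congr' (h.mono fun i h => ?_)
    beta_reduce; rw [(Ri i).lo h]
  · have hl := ge_of_tendsto ht h
    have : ∀ i, ∃ g', Rel (Sf (fi i) 1) (2 * max (ti i) (1 / 2) - 1) g' ∧ (1 / 2 ≤ ti i → g' = gi i) := fun i => by
      by_cases k : 1 / 2 ≤ ti i
      · exact ⟨gi i, by rw [max_eq_left k]; exact (Ri i).up (Fi i) k, fun _ => rfl⟩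
      · obtain ⟨g, -, h2⟩ := Rel_ex (Sf_homeo (Fi i) i1) (Sf_pole (Fi i)) (t := 2 * max (ti i) (1 / 2) - 1)
          ⟨by linarith [le_max_right (ti i) (1 / 2)], by linarith [max_le (ht' i).2 (show (1 / 2 : ℝ) ≤ 1 by norm_num)]⟩
        exact ⟨g, h2, fun a => absurd a k⟩
    choose g' h1 h2 using this
    have ht2 : Tendsto (fun i => 2 * max (ti i) (1 / 2) - 1) U (𝓝 (2 * t - 1)) := by
      have := ((ht.max (tendsto_const_nhds (x := (1 / 2 : ℝ)))).const_mul 2).sub_const 1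
      rwa [max_eq_left hl] at this
    refine (Rel.lim ht2 h1 (R0.up F0 hl) (Sf_lim F0 hf tendsto_const_nhds i1) hx).congr' (h.mono fun i h => ?_)
    beta_reduce; rw [h2 i h]
lemma Rel2.uniq {f g g' : Sph → Sph} {t : ℝ} (hf : IsHomeomorph f) (ht : t ∈ Icc 0 1) (h : Rel2 f t g) (h' : Rel2 f t g') : g = g' := by
  funext x
  exact tendsto_nhds_unique tendsto_const_nhds (Rel2.lim (U := (pure () : Ultrafilter Unit)) (fi := fun _ => f) (gi := fun _ => g) (ti := fun _ => t) (xi := fun _ => x) tendsto_const_nhds (fun _ => ht) ht (fun _ => hf) hf (fun _ => h) h'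
    (fun xi x hx => (hf.continuous.tendsto x).comp hx) tendsto_const_nhds)
lemma Rel2.act {f g : Sph → Sph} {t : ℝ} (hf : IsHomeomorph f) (ht : t ∈ Icc 0 1) (h : Rel2 f t g) (Q : O3) : Rel2 (Act Q ∘ f) t (Act Q ∘ g) := by
  rcases h with ⟨h1, h⟩ | ⟨h1, h⟩
  · exact .inl ⟨h1, by rw [h, Sf_act hf ⟨by linarith [ht.1], by linarith⟩]⟩
  · exact .inr ⟨h1, by rw [Sf_act hf i1]; exact h.act Q⟩
lemma Rel2.neg {f g : Sph → Sph} {t : ℝ} (h : Rel2 f t g) : Rel2 (fun x => f (-x)) t (fun x => g (-x)) := by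
  rcases h with ⟨h1, h⟩ | ⟨h1, h⟩
  · exact .inl ⟨h1, by rw [h, Sf_neg]⟩
  · exact .inr ⟨h1, by rw [Sf_neg]; exact h.neg⟩
lemma Rel2.orth (Q : O3) {t : ℝ} (ht : t ∈ Icc 0 1) : Rel2 (Act Q) t (Act Q) := by
  rcases le_total t (1 / 2) with h | h
  · exact .inl ⟨h, (Sf_orth _ _).symm⟩
  · exact .inr ⟨h, by rw [Sf_orth]; exact Rel.orth Q ⟨by linarith, by linarith [ht.2]⟩⟩
theorem main : ∃ ρ : HomS2 × unitInterval → HomS2, Continuous ρ ∧ ∀ p, Rel2 p.1.1 p.2 (ρ p).1 := by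
  have : ∀ p : HomS2 × unitInterval, ∃ g : HomS2, Rel2 p.1.1 p.2 g.1 := fun p => by
    obtain ⟨g, h1, h2⟩ := Rel2_ex p.1.2 p.2.2
    exact ⟨⟨⟨g, h1.continuous⟩, h1⟩, h2⟩
  choose ρ hρ using this
  refine ⟨ρ, continuous_induced_rng.2 (ContinuousMap.continuous_of_continuous_uncurry _ ?_), hρ⟩
  refine continuous_iff_ultrafilter.2 fun x V hV => ?_
  have hV1 : Tendsto (fun i : (HomS2 × unitInterval) × Sph => i.1.1.1) V (𝓝 x.1.1.1) := ((show Continuous fun i : (HomS2 × unitInterval) × Sph => i.1.1.1 by fun_prop).tendsto x).mono_left hV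
  have hV2 : Tendsto (fun i : (HomS2 × unitInterval) × Sph => (i.1.2 : ℝ)) V (𝓝 x.1.2) := ((show Continuous fun i : (HomS2 × unitInterval) × Sph => (i.1.2 : ℝ) by fun_prop).tendsto x).mono_left hV
  exact Rel2.lim (U := V) (fi := fun i => i.1.1.1) (gi := fun i => (ρ i.1).1) hV2 (fun i => i.1.2.2) x.1.2.2 (fun i => i.1.1.2) x.1.1.2 (fun i => hρ i.1) (hρ x.1)
    (fun xi y hy => ((continuous_eval (F := C(Sph, Sph))).tendsto (x.1.1.1, y)).comp (hV1.prodMk_nhds hy)) ((continuous_snd.tendsto x).mono_left hV)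

end HS

/-- There is a strong `(O₃ × ℤ₂)`-equivariant deformation retraction from `Hom(S²)` to `O₃`. -/
theorem deformation_retraction_homS2_to_O3 :
    ∃ ρ : HomS2 × unitInterval → HomS2,
      Continuous ρ ∧
      (∀ f : HomS2, ρ (f, 0) = f) ∧
      (∀ f : HomS2, ∃ Q ∈ Matrix.orthogonalGroup (Fin 3) ℝ, AgreesWith (ρ (f, 1)) Q) ∧
      (∀ Q ∈ Matrix.orthogonalGroup (Fin 3) ℝ, ∀ g : HomS2, AgreesWith g Q →
        ∀ t : unitInterval, ρ (g, t) = g) ∧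
      (∀ Q ∈ Matrix.orthogonalGroup (Fin 3) ℝ, ∀ s : ℝ, s = 1 ∨ s = -1 →
        ∀ f σs g : HomS2,
          (∀ x : Sph, ((σs.1 x : E3)) = s • (x : E3)) →
          (∀ x : Sph, ((g.1 x : E3)) = Q.mulVec ((f.1 (σs.1 x)) : E3)) →
          ∀ t : unitInterval, ∀ x : Sph,
            (((ρ (g, t)).1 x : E3)) = Q.mulVec (((ρ (f, t)).1 (σs.1 x)) : E3)) := by
  obtain ⟨ρ, hc, h⟩ := HS.main
  have ext : ∀ {f g : HomS2}, (⇑f.1 : Sph → Sph) = ⇑g.1 → f = g := fun h => Subtype.ext (ContinuousMap.ext (congrFun h))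
  refine ⟨ρ, hc, fun f => ext ?_, fun f => ?_, fun Q hQ g hg t => ext ?_, fun Q hQ s hs f σs g h1 h2 t x => ?_⟩
  · have := (h (f, 0)).lo (by norm_num)
    rw [this]; norm_num; exact HS.Sf_0 _
  · have := (h (f, 1)).up f.2 (by norm_num)
    norm_num at this
    obtain ⟨Q, e⟩ := this.one
    exact ⟨Q.1, Q.2, fun x => by rw [e]; rfl⟩
  · have e : (⇑g.1 : Sph → Sph) = HS.Act ⟨Q, hQ⟩ := funext fun x => Subtype.ext (WithLp.ofLp_injective 2 (hg x))
    have k := HS.Rel2.orth ⟨Q, hQ⟩ t.2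
    rw [← e] at k
    exact HS.Rel2.uniq g.2 t.2 (h (g, t)) k
  · have e : (⇑g.1 : Sph → Sph) = HS.Act ⟨Q, hQ⟩ ∘ fun x => f.1 (σs.1 x) := funext fun x => Subtype.ext (WithLp.ofLp_injective 2 (h2 x))
    have k : HS.Rel2 (fun x => f.1 (σs.1 x)) t (fun x => (ρ (f, t)).1 (σs.1 x)) := by
      rcases hs with rfl | rfl
      · have : ∀ x, σs.1 x = x := fun x => Subtype.ext (by rw [h1, one_smul])
        simp only [this]; exact h (f, t)
      · have : ∀ x, σs.1 x = -x := fun x => Subtype.ext (by rw [h1, neg_one_smul]; rfl)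
        simp only [this]; exact (h (f, t)).neg
    have k2 : HS.Rel2 (HS.Act ⟨Q, hQ⟩ ∘ fun x => f.1 (σs.1 x)) t _ := k.act (f.2.comp σs.2) t.2 ⟨Q, hQ⟩
    rw [← e] at k2
    rw [HS.Rel2.uniq g.2 t.2 (h (g, t)) k2]; rfl
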